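/- Let X be an (M,p̄)-cookie random walk with 0 < α < 1, set ν := (α+1)/2 and T_n := inf{k ≥ 0 : X_k = n}. Then there exists a constant a > 0 such that T_n / n^{1/ν} converges in distribution, as n → ∞, to the probability measure on [0,∞) whose Laplace transform is λ ↦ e^{−a λ^ν} (a positive strictly stable law of index ν). -/

import Mathlib

open MeasureTheory ProbabilityTheory Filter Set Asymptotics
open scoped ENNReal NNReal Topology

noncomputable section

/-- The strength of the `j`-th cookie: `p j` for `j ≤ M`, and `1/2` afterwards. -/
def cookieP (M : ℕ) (p : ℕ → ℝ) (j : ℕ) : ℝ :=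
  if j ≤ M then p j else 1 / 2

/-- The parameter `α = (∑_{i=1}^M (2 p_i - 1)) - 1`. -/
def cookieAlpha (M : ℕ) (p : ℕ → ℝ) : ℝ :=
  (∑ i ∈ Finset.Icc 1 M, (2 * p i - 1)) - 1

/-- `X` is an `(M, p̄)`-cookie random walk under the probability measure `P`:
`X 0 = 0` a.s., nearest-neighbour steps, and upon the `j`-th visit of the current
site the walk steps to the right with probability `p j` if `j ≤ M` and `1/2` otherwise. -/
structure IsCookieRW (M : ℕ) (p : ℕ → ℝ) {Ω : Type*} [MeasurableSpace Ω]
    (P : Measure Ω) (X : ℕ → Ω → ℤ) : Prop where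
  isProb : IsProbabilityMeasure P
  meas : ∀ n, Measurable (X n)
  init : P {ω | X 0 ω = 0} = 1
  steps : ∀ n, P {ω | |X (n + 1) ω - X n ω| = 1} = 1
  cond : ∀ (n : ℕ) (x : ℕ → ℤ), x 0 = 0 →
    0 < P {ω | ∀ i ≤ n, X i ω = x i} →
    P ({ω | X (n + 1) ω = x n + 1} ∩ {ω | ∀ i ≤ n, X i ω = x i})
      = ENNReal.ofReal
          (cookieP M p (((Finset.range (n + 1)).filter (fun i => x i = x n)).card))
        * P {ω | ∀ i ≤ n, X i ω = x i}

/-- First hitting time of level `n` by the walk `X`. -/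
def hitT {Ω : Type*} (X : ℕ → Ω → ℤ) (n : ℕ) (ω : Ω) : ℕ :=
  sInf {k | X k ω = (n : ℤ)}

/-- `F`, with first three derivatives `F₁, F₂, F₃` on `(0, ∞)`, behaves like `x ^ (1 + β)`
up to third order. -/
structure PowerType (β C : ℝ) (F F₁ F₂ F₃ : ℝ → ℝ) : Prop where
  cont : ContinuousOn F (Ici 0)
  deriv₁ : ∀ x, 0 < x → HasDerivAt F (F₁ x) x
  deriv₂ : ∀ x, 0 < x → HasDerivAt F₁ (F₂ x) x
  deriv₃ : ∀ x, 0 < x → HasDerivAt F₂ (F₃ x) x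
  bound₁ : ∀ x, 0 < x → |F₁ x| ≤ C * x ^ β
  bound₂ : ∀ x, 0 < x → |F₂ x| ≤ C * x ^ (β - 1)
  bound₃ : ∀ x, 0 < x → |F₃ x| ≤ C * x ^ (β - 2)

/-- Increments of a function whose derivative is bounded along a segment. -/
lemma abs_sub_le_of_hasDerivAt_uIcc {f f' : ℝ → ℝ} {x y K : ℝ}
    (hf : ∀ z ∈ uIcc x y, HasDerivAt f (f' z) z) (hK : ∀ z ∈ uIcc x y, |f' z| ≤ K) :
    ∀ z ∈ uIcc x y, |f z - f x| ≤ K * |z - x| := by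
  intro z hz
  exact (convex_uIcc x y).norm_image_sub_le_of_norm_hasDerivWithin_le
    (fun w hw => (hf w hw).hasDerivWithinAt) hK left_mem_uIcc hz

lemma taylor_two_remainder_le {F F₁ F₂ F₃ : ℝ → ℝ} {x y K : ℝ}
    (h1 : ∀ z ∈ uIcc x y, HasDerivAt F (F₁ z) z)
    (h2 : ∀ z ∈ uIcc x y, HasDerivAt F₁ (F₂ z) z)
    (h3 : ∀ z ∈ uIcc x y, HasDerivAt F₂ (F₃ z) z)
    (hK : ∀ z ∈ uIcc x y, |F₃ z| ≤ K) :
    |F y - F x - F₁ x * (y - x) - F₂ x * (y - x) ^ 2 / 2| ≤ K * |y - x| ^ 3 := by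
  have hK0 : 0 ≤ K := (abs_nonneg _).trans (hK x left_mem_uIcc)
  have hd : ∀ z ∈ uIcc x y, |z - x| ≤ |y - x| := fun z hz => abs_sub_left_of_mem_uIcc hz
  have e2 : ∀ z ∈ uIcc x y, |F₂ z - F₂ x| ≤ K * |y - x| := fun z hz =>
    (abs_sub_le_of_hasDerivAt_uIcc h3 hK z hz).trans
      (mul_le_mul_of_nonneg_left (hd z hz) hK0)
  have e1 : ∀ z ∈ uIcc x y, |F₁ z - F₁ x - F₂ x * (z - x)| ≤ K * |y - x| ^ 2 := by
    intro z hz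
    have := abs_sub_le_of_hasDerivAt_uIcc (f := fun z => F₁ z - F₁ x - F₂ x * (z - x))
      (f' := fun z => F₂ z - F₂ x) (fun w hw => by
        have := ((h2 w hw).sub_const (F₁ x)).fun_sub
          (((hasDerivAt_id' w).sub_const x).const_mul (F₂ x))
        rwa [mul_one] at this) e2 z hz
    simp only [sub_self, mul_zero, sub_zero] at this
    refine this.trans ?_
    calc K * |y - x| * |z - x| ≤ K * |y - x| * |y - x| :=
          mul_le_mul_of_nonneg_left (hd z hz) (by positivity)
      _ = _ := by ring
  have := abs_sub_le_of_hasDerivAt_uIcc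
      (f := fun z => F z - F x - F₁ x * (z - x) - F₂ x * (z - x) ^ 2 / 2)
      (f' := fun z => F₁ z - F₁ x - F₂ x * (z - x)) (fun w hw => by
        have := (((h1 w hw).sub_const (F x)).fun_sub
          (((hasDerivAt_id' w).sub_const x).const_mul (F₁ x))).fun_sub
          (((((hasDerivAt_id' w).sub_const x).fun_pow 2).const_mul (F₂ x)).div_const 2)
        refine this.congr_deriv ?_
        norm_num
        ring) e1 y right_mem_uIcc
  simp only [sub_self, mul_zero, sub_zero, ne_eq, OfNat.ofNat_ne_zero, not_false_eq_true,
    zero_pow, zero_div] at this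
  refine this.trans (le_of_eq (by ring))

namespace PowerType

variable {β C : ℝ} {F F₁ F₂ F₃ : ℝ → ℝ}

lemma const_nonneg (h : PowerType β C F F₁ F₂ F₃) : 0 ≤ C := by
  have := (abs_nonneg _).trans (h.bound₁ 1 one_pos)
  simpa using this

lemma taylor (h : PowerType β C F F₁ F₂ F₃) (hβ0 : 0 ≤ β) (hβ2 : β ≤ 2) {x y : ℝ}
    (hx : 0 < x) (hy : 0 ≤ y) :
    |F y - F x - F₁ x * (y - x) - F₂ x * (y - x) ^ 2 / 2|
      ≤ 20 * C * x ^ (β - 2) * |y - x| ^ 3 := by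
  have hC := h.const_nonneg
  rcases le_or_gt (x / 2) y with hxy | hxy
  · have hpos : ∀ z ∈ uIcc x y, x / 2 ≤ z := by
      intro z hz
      have := hz.1
      refine le_trans ?_ this
      simp only [le_inf_iff]
      exact ⟨by linarith, hxy⟩
    have hpos' : ∀ z ∈ uIcc x y, 0 < z := fun z hz => by linarith [hpos z hz]
    refine (taylor_two_remainder_le (fun z hz => h.deriv₁ z (hpos' z hz))
      (fun z hz => h.deriv₂ z (hpos' z hz)) (fun z hz => h.deriv₃ z (hpos' z hz))
      (K := 20 * C * x ^ (β - 2)) ?_)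
    intro z hz
    refine (h.bound₃ z (hpos' z hz)).trans ?_
    have h1 : z ^ (β - 2) ≤ (x / 2) ^ (β - 2) :=
      Real.rpow_le_rpow_of_nonpos (by linarith) (hpos z hz) (by linarith)
    have h2 : (x / 2) ^ (β - 2) = x ^ (β - 2) * 2 ^ (2 - β) := by
      rw [Real.div_rpow hx.le (by norm_num), div_eq_mul_inv, ← Real.rpow_neg (by norm_num)]
      congr 2; ring
    have h3 : (2 : ℝ) ^ (2 - β) ≤ 4 := by
      calc (2 : ℝ) ^ (2 - β) ≤ 2 ^ (2 : ℝ) :=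
            Real.rpow_le_rpow_of_exponent_le (by norm_num) (by linarith)
        _ = 4 := by norm_num
    have h4 : 0 ≤ x ^ (β - 2) := by positivity
    calc C * z ^ (β - 2) ≤ C * (x ^ (β - 2) * 2 ^ (2 - β)) := by
          rw [← h2]; exact mul_le_mul_of_nonneg_left h1 hC
      _ ≤ C * (x ^ (β - 2) * 4) := by gcongr
      _ ≤ 20 * C * x ^ (β - 2) := by nlinarith [mul_nonneg hC h4]
  · have hyx : y < x := by linarith
    obtain ⟨c, hc, hce⟩ := exists_hasDerivAt_eq_slope F F₁ hyx
      (h.cont.mono (fun z hz => hy.trans hz.1)) (fun z hz => h.deriv₁ z (hy.trans_lt hz.1))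
    have hc0 : 0 < c := hy.trans_lt hc.1
    have hb : x ^ β = x ^ (β - 2) * x ^ 2 := by
      rw [← Real.rpow_natCast, ← Real.rpow_add hx]; norm_num
    have hb1 : x ^ (β - 1) = x ^ (β - 2) * x := by
      conv_rhs => rw [← Real.rpow_one x, ← Real.rpow_mul hx.le, ← Real.rpow_add hx]
      congr 1; ring
    set q := x ^ (β - 2) with hq
    have hq0 : 0 ≤ q := by positivity
    have hF : |F y - F x| ≤ C * q * x ^ 3 := by
      have h1 : F y - F x = - (F₁ c * (x - y)) := by
        rw [hce]; field_simp [sub_ne_zero.2 hyx.ne']; ring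
      rw [h1, abs_neg, abs_mul, abs_of_pos (sub_pos.2 hyx)]
      calc |F₁ c| * (x - y) ≤ (C * x ^ β) * x := by
            refine mul_le_mul ((h.bound₁ c hc0).trans ?_) (by linarith) (by linarith)
              (by positivity)
            exact mul_le_mul_of_nonneg_left (Real.rpow_le_rpow hc0.le hc.2.le hβ0) hC
        _ = _ := by rw [hb]; ring
    have h1 : |F₁ x * (y - x)| ≤ C * q * x ^ 3 := by
      rw [abs_mul]
      calc |F₁ x| * |y - x| ≤ (C * x ^ β) * x := by
            refine mul_le_mul (h.bound₁ x hx) ?_ (abs_nonneg _) (by positivity)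
            rw [abs_le]; constructor <;> linarith
        _ = _ := by rw [hb]; ring
    have h2 : |F₂ x * (y - x) ^ 2 / 2| ≤ C * q * x ^ 3 / 2 := by
      rw [abs_div, abs_mul, abs_two, abs_pow, sq_abs]
      have : |F₂ x| * (y - x) ^ 2 ≤ (C * x ^ (β - 1)) * x ^ 2 := by
        refine mul_le_mul (h.bound₂ x hx) (by nlinarith) (by positivity) (by positivity)
      rw [hb1] at this
      have h3 : C * (q * x) * x ^ 2 = C * q * x ^ 3 := by ring
      linarith
    have h3 : x ^ 3 / 8 ≤ |y - x| ^ 3 := by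
      have : x / 2 ≤ |y - x| := by rw [abs_sub_comm, abs_of_pos (by linarith)]; linarith
      calc x ^ 3 / 8 = (x / 2) ^ 3 := by ring
        _ ≤ _ := by gcongr
    calc |F y - F x - F₁ x * (y - x) - F₂ x * (y - x) ^ 2 / 2|
        ≤ |F y - F x| + |F₁ x * (y - x)| + |F₂ x * (y - x) ^ 2 / 2| :=
          (abs_sub _ _).trans (add_le_add_left (abs_sub _ _) _)
      _ ≤ 20 * C * q * (x ^ 3 / 8) := by nlinarith
      _ ≤ _ := by gcongr

end PowerType

/-- The power function itself is of power type. -/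
lemma powerType_rpow {β : ℝ} (hβ0 : 0 ≤ β) (hβ1 : β ≤ 1) :
    PowerType β 2 (fun x => x ^ (1 + β)) (fun x => (1 + β) * x ^ β)
      (fun x => (1 + β) * (β * x ^ (β - 1)))
      (fun x => (1 + β) * (β * ((β - 1) * x ^ (β - 2)))) where
  cont := (Real.continuous_rpow_const (by linarith)).continuousOn
  deriv₁ x hx := by
    have := Real.hasDerivAt_rpow_const (x := x) (p := 1 + β) (Or.inl hx.ne')
    simpa using this
  deriv₂ x hx := (Real.hasDerivAt_rpow_const (x := x) (p := β) (Or.inl hx.ne')).const_mul _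
  deriv₃ x hx := by
    have := (((Real.hasDerivAt_rpow_const (x := x) (p := β - 1) (Or.inl hx.ne')).const_mul
      β).const_mul (1 + β))
    rwa [show β - 1 - 1 = β - 2 by ring] at this
  bound₁ x hx := by
    rw [abs_of_nonneg (by positivity)]
    gcongr; linarith
  bound₂ x hx := by
    rw [abs_of_nonneg (by positivity), ← mul_assoc]
    gcongr; nlinarith
  bound₃ x hx := by
    rw [← mul_assoc, ← mul_assoc, abs_mul, abs_of_nonneg (a := x ^ (β - 2)) (by positivity)]
    gcongr
    rw [abs_le]; constructor <;> nlinarith [mul_nonneg hβ0 (sub_nonneg.2 hβ1)]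

/-- One step of the chain with kernel `κ`, killed at rate `μ` times the current state. -/
def killOp (κ : ℕ → Measure ℕ) (μ : ℝ) (f : ℕ → ℝ) (j : ℕ) : ℝ :=
  Real.exp (-μ * j) * ∫ k, f k ∂κ j

/-- Functions growing at most quadratically. -/
def QuadGrowth (f : ℕ → ℝ) : Prop := ∃ A : ℝ, 0 ≤ A ∧ ∀ j : ℕ, |f j| ≤ A * (1 + (j : ℝ)) ^ 2

/-- A stochastically monotone kernel on `ℕ` with drift `-α` and variance `2 j + O(1)` at `j`. -/
structure MigrationKernel (α C : ℝ) (J : ℕ) (κ : ℕ → Measure ℕ) : Prop where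
  prob : ∀ j, IsProbabilityMeasure (κ j)
  mono : ∀ f : ℕ → ℝ, Monotone f → (∀ j, Integrable f (κ j)) → Monotone fun j => ∫ k, f k ∂κ j
  charge : ∀ j k, 0 < κ j {k}
  integrable_pow_four : ∀ j, Integrable (fun k : ℕ => (k : ℝ) ^ 4) (κ j)
  mean : ∀ j, J ≤ j → ∫ k, ((k : ℝ) - j) ∂κ j = -α
  var : ∀ j, J ≤ j → |∫ k, ((k : ℝ) - j) ^ 2 ∂κ j - 2 * j| ≤ C
  fourth : ∀ j, J ≤ j → ∫ k, ((k : ℝ) - j) ^ 4 ∂κ j ≤ C * (j : ℝ) ^ 2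

namespace QuadGrowth

lemma of_abs_le {f g : ℕ → ℝ} (hg : QuadGrowth g) (h : ∀ j, |f j| ≤ |g j|) : QuadGrowth f := by
  obtain ⟨A, hA, hAg⟩ := hg
  exact ⟨A, hA, fun j => (h j).trans (hAg j)⟩

lemma add {f g : ℕ → ℝ} (hf : QuadGrowth f) (hg : QuadGrowth g) :
    QuadGrowth (fun j => f j + g j) := by
  obtain ⟨A, hA, hAf⟩ := hf
  obtain ⟨B, hB, hBg⟩ := hg
  refine ⟨A + B, by positivity, fun j => ?_⟩
  have := abs_add_le (f j) (g j)
  nlinarith [hAf j, hBg j]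

lemma const_mul {f : ℕ → ℝ} (c : ℝ) (hf : QuadGrowth f) : QuadGrowth (fun j => c * f j) := by
  obtain ⟨A, hA, hAf⟩ := hf
  refine ⟨|c| * A, by positivity, fun j => ?_⟩
  rw [abs_mul, mul_assoc]
  exact mul_le_mul_of_nonneg_left (hAf j) (abs_nonneg c)

lemma sub {f g : ℕ → ℝ} (hf : QuadGrowth f) (hg : QuadGrowth g) :
    QuadGrowth (fun j => f j - g j) := by
  have := hf.add (hg.const_mul (-1))
  refine this.of_abs_le fun j => le_of_eq ?_
  congr 1; ring

lemma of_bounded {f : ℕ → ℝ} {B : ℝ} (h : ∀ j, |f j| ≤ B) : QuadGrowth f := by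
  have hB : 0 ≤ B := (abs_nonneg _).trans (h 0)
  refine ⟨B, hB, fun j => (h j).trans ?_⟩
  have : (1 : ℝ) ≤ (1 + (j : ℝ)) ^ 2 := by
    have : (0 : ℝ) ≤ j := by positivity
    nlinarith
  nlinarith

lemma const (c : ℝ) : QuadGrowth (fun _ => c) := of_bounded (B := |c|) fun _ => le_rfl

lemma rpow {γ : ℝ} (h0 : 0 ≤ γ) (h2 : γ ≤ 2) : QuadGrowth (fun j => (j : ℝ) ^ γ) := by
  refine ⟨1, zero_le_one, fun j => ?_⟩
  rw [abs_of_nonneg (by positivity), one_mul]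
  calc (j : ℝ) ^ γ ≤ (1 + (j : ℝ)) ^ γ := by gcongr; linarith
    _ ≤ (1 + (j : ℝ)) ^ (2 : ℝ) := by
        apply Real.rpow_le_rpow_of_exponent_le _ h2
        have : (0 : ℝ) ≤ j := by positivity
        linarith
    _ = _ := by norm_num

end QuadGrowth

namespace MigrationKernel

variable {α C : ℝ} {J : ℕ} {κ : ℕ → Measure ℕ}

lemma integrable_one_add_pow (h : MigrationKernel α C J κ) (j : ℕ) :
    Integrable (fun k : ℕ => (1 + (k : ℝ)) ^ 4) (κ j) := by
  have := h.prob j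
  refine (((h.integrable_pow_four j).add (integrable_const 1)).const_mul 8).mono'
    (Measurable.of_discrete.aestronglyMeasurable) (ae_of_all _ fun k => ?_)
  rw [Real.norm_of_nonneg (by positivity)]
  simp only [Pi.add_apply]
  have : (0 : ℝ) ≤ k := by positivity
  nlinarith [sq_nonneg ((k : ℝ) - 1), sq_nonneg ((k : ℝ) ^ 2 - 1), sq_nonneg ((k : ℝ) ^ 2 - k),
    mul_nonneg this (sq_nonneg ((k : ℝ) - 1))]

lemma integrable_of_le (h : MigrationKernel α C J κ) {f : ℕ → ℝ} {A : ℝ} (j : ℕ)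
    (hf : ∀ k : ℕ, |f k| ≤ A * (1 + (k : ℝ)) ^ 4) : Integrable f (κ j) :=
  ((h.integrable_one_add_pow j).const_mul A).mono'
    (Measurable.of_discrete.aestronglyMeasurable) (ae_of_all _ hf)

lemma integrable (h : MigrationKernel α C J κ) {f : ℕ → ℝ} (hf : QuadGrowth f) (j : ℕ) :
    Integrable f (κ j) := by
  obtain ⟨A, hA, hAf⟩ := hf
  refine h.integrable_of_le (A := A) j fun k => (hAf k).trans ?_
  have : (1 : ℝ) ≤ 1 + (k : ℝ) := by
    have : (0 : ℝ) ≤ k := by positivity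
    linarith
  exact mul_le_mul_of_nonneg_left (pow_le_pow_right₀ this (by norm_num)) hA

lemma integrable_sub_pow (h : MigrationKernel α C J κ) (j : ℕ) {r : ℕ} (hr : r ≤ 4) :
    Integrable (fun k : ℕ => ((k : ℝ) - j) ^ r) (κ j) := by
  refine h.integrable_of_le (A := (1 + (j : ℝ)) ^ r) j fun k => ?_
  have hk : (0 : ℝ) ≤ k := by positivity
  have hj : (0 : ℝ) ≤ j := by positivity
  have h1 : |(k : ℝ) - j| ≤ (1 + (j : ℝ)) * (1 + (k : ℝ)) := by
    rw [abs_le]; constructor <;> nlinarith [mul_nonneg hk hj]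
  rw [abs_pow]
  calc |(k : ℝ) - j| ^ r ≤ ((1 + (j : ℝ)) * (1 + (k : ℝ))) ^ r := by gcongr
    _ = (1 + (j : ℝ)) ^ r * (1 + (k : ℝ)) ^ r := mul_pow _ _ _
    _ ≤ _ := by
      have : (1 + (k : ℝ)) ^ r ≤ (1 + (k : ℝ)) ^ 4 :=
        pow_le_pow_right₀ (by linarith) hr
      gcongr

lemma const_nonneg (h : MigrationKernel α C J κ) : 0 ≤ C :=
  (abs_nonneg _).trans (h.var J le_rfl)

lemma var_le (h : MigrationKernel α C J κ) {j : ℕ} (hj : J ≤ j) :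
    ∫ k, ((k : ℝ) - j) ^ 2 ∂κ j ≤ 2 * j + C := by
  have := (abs_le.1 (h.var j hj)).2
  linarith

lemma exists_quad_bound (h : MigrationKernel α C J κ) :
    ∃ B : ℝ, 0 ≤ B ∧ ∀ j : ℕ, ∫ k, (1 + (k : ℝ)) ^ 2 ∂κ j ≤ B * (1 + (j : ℝ)) ^ 2 := by
  have hq : QuadGrowth (fun k : ℕ => (1 + (k : ℝ)) ^ 2) :=
    ⟨1, zero_le_one, fun j => by rw [one_mul, abs_of_nonneg (by positivity)]⟩
  have hC := h.const_nonneg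
  set B₀ := ∑ j ∈ Finset.range J, ∫ k, (1 + (k : ℝ)) ^ 2 ∂κ j with hB₀
  have hnn : ∀ j, 0 ≤ ∫ k, (1 + (k : ℝ)) ^ 2 ∂κ j := fun j =>
    integral_nonneg fun k => by positivity
  have hB₀0 : 0 ≤ B₀ := Finset.sum_nonneg fun j _ => hnn j
  refine ⟨B₀ + (6 + 2 * C), by positivity, fun j => ?_⟩
  have hj0 : (0 : ℝ) ≤ j := by positivity
  have h1 : (1 : ℝ) ≤ (1 + (j : ℝ)) ^ 2 := by nlinarith
  rcases lt_or_ge j J with hj | hj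
  · have : ∫ k, (1 + (k : ℝ)) ^ 2 ∂κ j ≤ B₀ :=
      Finset.single_le_sum (f := fun j => ∫ k, (1 + (k : ℝ)) ^ 2 ∂κ j)
        (fun j _ => hnn j) (Finset.mem_range.2 hj)
    nlinarith
  · have := h.prob j
    have hi := h.integrable_sub_pow j (r := 2) (by norm_num)
    have : ∫ k, (1 + (k : ℝ)) ^ 2 ∂κ j
        ≤ ∫ k, (2 * (1 + (j : ℝ)) ^ 2 + 2 * ((k : ℝ) - j) ^ 2) ∂κ j := by
      refine integral_mono (h.integrable hq j) ((integrable_const _).add (hi.const_mul 2))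
        fun k => ?_
      simp only
      nlinarith [sq_nonneg ((1 + (j : ℝ)) - ((k : ℝ) - j))]
    rw [integral_add (integrable_const _) (hi.const_mul 2)] at this
    simp only [integral_const_mul, integral_const, probReal_univ, smul_eq_mul, one_mul] at this
    have hv := h.var_le hj
    nlinarith

lemma quadGrowth_killOp (h : MigrationKernel α C J κ) {μ : ℝ} (hμ : 0 ≤ μ) {f : ℕ → ℝ}
    (hf : QuadGrowth f) : QuadGrowth (killOp κ μ f) := by
  obtain ⟨B, hB, hB'⟩ := h.exists_quad_bound
  obtain ⟨A, hA, hAf⟩ := id hf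
  have hq : QuadGrowth (fun k : ℕ => (1 + (k : ℝ)) ^ 2) :=
    ⟨1, zero_le_one, fun j => by rw [one_mul, abs_of_nonneg (by positivity)]⟩
  refine ⟨A * B, by positivity, fun j => ?_⟩
  have he : Real.exp (-μ * j) ≤ 1 := Real.exp_le_one_iff.2 (by
    have : (0 : ℝ) ≤ j := by positivity
    nlinarith)
  rw [killOp, abs_mul, abs_of_pos (Real.exp_pos _)]
  calc Real.exp (-μ * j) * |∫ k, f k ∂κ j| ≤ 1 * ∫ k, |f k| ∂κ j :=
        mul_le_mul he (abs_integral_le_integral_abs) (abs_nonneg _) zero_le_one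
    _ ≤ ∫ k, A * (1 + (k : ℝ)) ^ 2 ∂κ j := by
        rw [one_mul]
        exact integral_mono (h.integrable hf j).abs ((h.integrable hq j).const_mul A) hAf
    _ ≤ A * B * (1 + (j : ℝ)) ^ 2 := by
        rw [integral_const_mul, mul_assoc]
        exact mul_le_mul_of_nonneg_left (hB' j) hA

lemma quadGrowth_iterate (h : MigrationKernel α C J κ) {μ : ℝ} (hμ : 0 ≤ μ) (n : ℕ) :
    ∀ {f : ℕ → ℝ}, QuadGrowth f → QuadGrowth ((killOp κ μ)^[n] f) := by
  induction n with
  | zero => exact fun hf => hf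
  | succ n ih => exact fun hf => ih (h.quadGrowth_killOp hμ hf)

lemma killOp_add (h : MigrationKernel α C J κ) (μ : ℝ) {f g : ℕ → ℝ}
    (hf : QuadGrowth f) (hg : QuadGrowth g) :
    killOp κ μ (fun j => f j + g j) = fun j => killOp κ μ f j + killOp κ μ g j := by
  funext j
  simp only [killOp]
  rw [integral_add (h.integrable hf j) (h.integrable hg j), mul_add]

lemma killOp_const_mul (μ c : ℝ) (f : ℕ → ℝ) :
    killOp κ μ (fun j => c * f j) = fun j => c * killOp κ μ f j := by
  funext j
  simp only [killOp]
  rw [integral_const_mul]; ring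

lemma killOp_mono (h : MigrationKernel α C J κ) (μ : ℝ) {f g : ℕ → ℝ}
    (hf : QuadGrowth f) (hg : QuadGrowth g) (hfg : ∀ j, f j ≤ g j) (j : ℕ) :
    killOp κ μ f j ≤ killOp κ μ g j :=
  mul_le_mul_of_nonneg_left (integral_mono (h.integrable hf j) (h.integrable hg j) hfg)
    (Real.exp_pos _).le

lemma killOp_nonneg {μ : ℝ} {f : ℕ → ℝ} (hf : ∀ j, 0 ≤ f j) (j : ℕ) : 0 ≤ killOp κ μ f j :=
  mul_nonneg (Real.exp_pos _).le (integral_nonneg hf)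

lemma killOp_zero (f : ℕ → ℝ) (j : ℕ) : killOp κ 0 f j = ∫ k, f k ∂κ j := by simp [killOp]

lemma killOp_le_zero {μ : ℝ} (hμ : 0 ≤ μ) {f : ℕ → ℝ} (hf : ∀ j, 0 ≤ f j) (j : ℕ) :
    killOp κ μ f j ≤ killOp κ 0 f j := by
  rw [killOp_zero, killOp]
  refine mul_le_of_le_one_left (integral_nonneg hf) (Real.exp_le_one_iff.2 ?_)
  have : (0 : ℝ) ≤ j := by positivity
  nlinarith

lemma iterate_add (h : MigrationKernel α C J κ) {μ : ℝ} (hμ : 0 ≤ μ) (n : ℕ) :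
    ∀ {f g : ℕ → ℝ}, QuadGrowth f → QuadGrowth g →
    (killOp κ μ)^[n] (fun j => f j + g j)
      = fun j => (killOp κ μ)^[n] f j + (killOp κ μ)^[n] g j := by
  induction n with
  | zero => intros; rfl
  | succ n ih =>
    intro f g hf hg
    simp only [Function.iterate_succ, Function.comp]
    rw [h.killOp_add μ hf hg]
    exact ih (h.quadGrowth_killOp hμ hf) (h.quadGrowth_killOp hμ hg)

lemma iterate_const_mul (μ c : ℝ) (n : ℕ) : ∀ f : ℕ → ℝ,
    (killOp κ μ)^[n] (fun j => c * f j) = fun j => c * (killOp κ μ)^[n] f j := by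
  induction n with
  | zero => intros; rfl
  | succ n ih =>
    intro f
    simp only [Function.iterate_succ, Function.comp]
    rw [killOp_const_mul, ih]

lemma iterate_sub (h : MigrationKernel α C J κ) {μ : ℝ} (hμ : 0 ≤ μ) (n : ℕ)
    {f g : ℕ → ℝ} (hf : QuadGrowth f) (hg : QuadGrowth g) :
    (killOp κ μ)^[n] (fun j => f j - g j)
      = fun j => (killOp κ μ)^[n] f j - (killOp κ μ)^[n] g j := by
  have := h.iterate_add hμ n hf (hg.const_mul (-1))
  rw [iterate_const_mul] at this
  simpa [sub_eq_add_neg] using this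

lemma iterate_mono (h : MigrationKernel α C J κ) {μ : ℝ} (hμ : 0 ≤ μ) (n : ℕ) :
    ∀ {f g : ℕ → ℝ}, QuadGrowth f → QuadGrowth g → (∀ j, f j ≤ g j) →
    ∀ j, (killOp κ μ)^[n] f j ≤ (killOp κ μ)^[n] g j := by
  induction n with
  | zero => exact fun _ _ hfg => hfg
  | succ n ih =>
    intro f g hf hg hfg
    exact ih (h.quadGrowth_killOp hμ hf) (h.quadGrowth_killOp hμ hg)
      (h.killOp_mono μ hf hg hfg)

lemma iterate_nonneg {μ : ℝ} (n : ℕ) : ∀ {f : ℕ → ℝ}, (∀ j, 0 ≤ f j) →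
    ∀ j, 0 ≤ (killOp κ μ)^[n] f j := by
  induction n with
  | zero => exact fun hf => hf
  | succ n ih => exact fun hf => ih (killOp_nonneg hf)

lemma iterate_le_zero (h : MigrationKernel α C J κ) {μ : ℝ} (hμ : 0 ≤ μ) (n : ℕ) :
    ∀ {f : ℕ → ℝ}, QuadGrowth f → (∀ j, 0 ≤ f j) →
    ∀ j, (killOp κ μ)^[n] f j ≤ (killOp κ 0)^[n] f j := by
  induction n with
  | zero => exact fun _ _ _ => le_rfl
  | succ n ih =>
    intro f hf hf0 j
    exact (ih (h.quadGrowth_killOp hμ hf) (killOp_nonneg hf0) j).trans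
      (h.iterate_mono le_rfl n (h.quadGrowth_killOp hμ hf) (h.quadGrowth_killOp le_rfl hf)
        (killOp_le_zero hμ hf0) j)

lemma abs_iterate_le (h : MigrationKernel α C J κ) {μ : ℝ} (hμ : 0 ≤ μ) (n : ℕ)
    {f g : ℕ → ℝ} (hg : QuadGrowth g) (hfg : ∀ j, |f j| ≤ g j) (j : ℕ) :
    |(killOp κ μ)^[n] f j| ≤ (killOp κ 0)^[n] g j := by
  have hg0 : ∀ j, 0 ≤ g j := fun j => (abs_nonneg _).trans (hfg j)
  have hf : QuadGrowth f := hg.of_abs_le fun j => (hfg j).trans (le_abs_self _)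
  refine le_trans ?_ (h.iterate_le_zero hμ n hg hg0 j)
  rw [abs_le]
  constructor
  · have := h.iterate_mono hμ n (hg.const_mul (-1)) hf
      (fun j => by linarith [(abs_le.1 (hfg j)).1]) j
    rw [iterate_const_mul] at this
    linarith
  · exact h.iterate_mono hμ n hf hg (fun j => (abs_le.1 (hfg j)).2) j

lemma iterate_zero_const (h : MigrationKernel α C J κ) (c : ℝ) (n : ℕ) :
    (killOp κ 0)^[n] (fun _ => c) = fun _ => c := by
  induction n with
  | zero => rfl
  | succ n ih =>
    have : killOp κ 0 (fun _ => c) = fun _ => c := by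
      funext j
      have := h.prob j
      simp [killOp_zero]
    rw [Function.iterate_succ, Function.comp, this, ih]

lemma monotone_killOp_zero (h : MigrationKernel α C J κ) {f : ℕ → ℝ} (hf : QuadGrowth f)
    (hm : Monotone f) : Monotone (killOp κ 0 f) := by
  have := h.mono f hm (h.integrable hf)
  intro a b hab
  rw [killOp_zero, killOp_zero]
  exact this hab

lemma monotone_iterate_zero (h : MigrationKernel α C J κ) (n : ℕ) :
    ∀ {f : ℕ → ℝ}, QuadGrowth f → Monotone f → Monotone ((killOp κ 0)^[n] f) := by
  induction n with
  | zero => exact fun _ hm => hm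
  | succ n ih =>
    exact fun hf hm => ih (h.quadGrowth_killOp le_rfl hf) (h.monotone_killOp_zero hf hm)

/-- Started from `0`, the chain is stochastically increasing in time. -/
lemma monotone_iterate_at_zero (h : MigrationKernel α C J κ) {f : ℕ → ℝ} (hf : QuadGrowth f)
    (hm : Monotone f) : Monotone fun n => (killOp κ 0)^[n] f 0 := by
  refine monotone_nat_of_le_succ fun n => ?_
  rw [Function.iterate_succ_apply', killOp_zero]
  have := h.prob 0
  have hg := h.quadGrowth_iterate (μ := 0) le_rfl n hf
  calc (killOp κ 0)^[n] f 0 = ∫ _, (killOp κ 0)^[n] f 0 ∂κ 0 := by simp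
    _ ≤ _ := integral_mono (integrable_const _) (h.integrable hg 0)
      fun k => h.monotone_iterate_zero n hf hm (Nat.zero_le k)

/-- The generator acting on (rescaled) functions of power type. -/
lemma exists_generator_bound (h : MigrationKernel α C J κ) {β D : ℝ} {F F₁ F₂ F₃ : ℝ → ℝ}
    (hF : PowerType β D F F₁ F₂ F₃) (hβ0 : 0 ≤ β) (hβ1 : β ≤ 1) :
    ∃ K : ℝ, 0 ≤ K ∧ ∀ s : ℝ, 0 < s → ∀ j : ℕ, J ≤ j → 1 ≤ j →
      |∫ k, F (s * k) ∂κ j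
        - (F (s * j) - α * (s * F₁ (s * j)) + s ^ 2 * j * F₂ (s * j))|
        ≤ K * s ^ (1 + β) * (j : ℝ) ^ (β - 1 / 2) := by
  have hC := h.const_nonneg
  have hD := hF.const_nonneg
  refine ⟨20 * D * (2 + C) + D * C, by positivity, fun s hs j hJ hj1 => ?_⟩
  have := h.prob j
  have hj : (1 : ℝ) ≤ j := by exact_mod_cast hj1
  have hj0 : (0 : ℝ) < j := by linarith
  have hx : 0 < s * j := by positivity
  set R : ℕ → ℝ := fun k => F (s * k) - F (s * j) - F₁ (s * j) * (s * k - s * j)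
    - F₂ (s * j) * (s * k - s * j) ^ 2 / 2 with hR
  set A := 20 * D * (s * j) ^ (β - 2) * s ^ 3 with hA
  have hA0 : 0 ≤ A := by positivity
  have hRb : ∀ k : ℕ, |R k| ≤ A * |(k : ℝ) - j| ^ 3 := by
    intro k
    refine (hF.taylor hβ0 (by linarith) hx (by positivity)).trans (le_of_eq ?_)
    rw [← mul_sub, abs_mul, abs_of_pos hs, mul_pow, hA]; ring
  have i1 : Integrable (fun k : ℕ => (k : ℝ) - j) (κ j) := by
    simpa using h.integrable_sub_pow j (r := 1) (by norm_num)
  have i2 := h.integrable_sub_pow j (r := 2) (by norm_num)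
  have i3 := (h.integrable_sub_pow j (r := 3) (by norm_num)).abs
  have i4 := h.integrable_sub_pow j (r := 4) (by norm_num)
  simp only [abs_pow] at i3
  have iR : Integrable R (κ j) := (i3.const_mul A).mono'
    (Measurable.of_discrete.aestronglyMeasurable) (ae_of_all _ hRb)
  have hdec : ∀ k : ℕ, F (s * k) = R k + (F (s * j) + (F₁ (s * j) * s) * ((k : ℝ) - j)
      + (F₂ (s * j) * s ^ 2 / 2) * ((k : ℝ) - j) ^ 2) := by
    intro k; simp only [hR]; ring
  have h_int : ∫ k, F (s * k) ∂κ j = ∫ k, R k ∂κ j + (F (s * j) + (F₁ (s * j) * s) * (-α)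
      + (F₂ (s * j) * s ^ 2 / 2) * ∫ k, ((k : ℝ) - j) ^ 2 ∂κ j) := by
    rw [integral_congr_ae (ae_of_all _ hdec)]
    have j0 : Integrable (fun k : ℕ => F (s * j) + (F₁ (s * j) * s) * ((k : ℝ) - j)) (κ j) :=
      (integrable_const _).add (i1.const_mul _)
    have j1 : Integrable (fun k : ℕ => F (s * j) + (F₁ (s * j) * s) * ((k : ℝ) - j)
        + (F₂ (s * j) * s ^ 2 / 2) * ((k : ℝ) - j) ^ 2) (κ j) := j0.add (i2.const_mul _)
    rw [integral_add iR j1, integral_add j0 (i2.const_mul _),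
      integral_add (integrable_const _) (i1.const_mul _), integral_const_mul,
      integral_const_mul, h.mean j hJ]
    simp only [integral_const, probReal_univ, smul_eq_mul, one_mul]
  set q : ℝ := (j : ℝ) ^ (1 / 2 : ℝ) with hq
  have hq0 : 0 < q := by positivity
  have hqq : q * q = j := by
    rw [hq, ← Real.rpow_add hj0]; norm_num
  have h3 : ∫ k, |(k : ℝ) - j| ^ 3 ∂κ j ≤ (2 + C) * j * q := by
    have hle : ∀ k : ℕ, |(k : ℝ) - j| ^ 3
        ≤ (q / 2) * ((k : ℝ) - j) ^ 2 + (q⁻¹ / 2) * ((k : ℝ) - j) ^ 4 := by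
      intro k
      set d := |(k : ℝ) - j| with hd
      have e2 : ((k : ℝ) - j) ^ 2 = d ^ 2 := (sq_abs _).symm
      have e4 : ((k : ℝ) - j) ^ 4 = d ^ 4 := by
        rw [show (4 : ℕ) = 2 * 2 from rfl, pow_mul, e2, ← pow_mul]
      rw [e2, e4]
      have : (q / 2) * d ^ 2 + (q⁻¹ / 2) * d ^ 4 - d ^ 3
          = (q⁻¹ / 2) * d ^ 2 * (q - d) ^ 2 := by
        field_simp; ring
      have h0 : 0 ≤ (q⁻¹ / 2) * d ^ 2 * (q - d) ^ 2 := by positivity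
      linarith
    calc ∫ k, |(k : ℝ) - j| ^ 3 ∂κ j
        ≤ ∫ k, ((q / 2) * ((k : ℝ) - j) ^ 2 + (q⁻¹ / 2) * ((k : ℝ) - j) ^ 4) ∂κ j :=
          integral_mono i3 ((i2.const_mul _).add (i4.const_mul _)) hle
      _ = (q / 2) * ∫ k, ((k : ℝ) - j) ^ 2 ∂κ j + (q⁻¹ / 2) * ∫ k, ((k : ℝ) - j) ^ 4 ∂κ j := by
          rw [integral_add (i2.const_mul _) (i4.const_mul _), integral_const_mul,
            integral_const_mul]
      _ ≤ (q / 2) * (2 * j + C) + (q⁻¹ / 2) * (C * (j : ℝ) ^ 2) := by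
          gcongr
          · exact h.var_le hJ
          · exact h.fourth j hJ
      _ = q * j + q * C / 2 + C * j * q / 2 := by
          have : q⁻¹ * (j : ℝ) = q := by rw [← hqq]; field_simp
          calc _ = q * j + q * C / 2 + C * j * (q⁻¹ * j) / 2 := by ring
            _ = _ := by rw [this]
      _ ≤ _ := by nlinarith [mul_nonneg hC hq0.le, mul_pos hq0 hj0]
  have hpow1 : (s * j) ^ (β - 2) * s ^ 3 * (j * q) = s ^ (1 + β) * (j : ℝ) ^ (β - 1 / 2) := by
    rw [Real.mul_rpow hs.le hj0.le, hq, ← Real.rpow_natCast s 3]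
    have e1 : s ^ (1 + β) = s ^ (β - 2) * s ^ ((3 : ℕ) : ℝ) := by
      rw [← Real.rpow_add hs]; congr 1; push_cast; ring
    have e2 : (j : ℝ) ^ (β - 1 / 2) = (j : ℝ) ^ (β - 2) * ((j : ℝ) * (j : ℝ) ^ (1 / 2 : ℝ)) := by
      conv_rhs => rw [← Real.rpow_one_add' hj0.le (by norm_num), ← Real.rpow_add hj0]
      congr 1; ring
    rw [e1, e2]; ring
  have hpow2 : (s * j) ^ (β - 1) * s ^ 2 ≤ s ^ (1 + β) * (j : ℝ) ^ (β - 1 / 2) := by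
    rw [Real.mul_rpow hs.le hj0.le]
    have e1 : s ^ (1 + β) = s ^ (β - 1) * s ^ 2 := by
      rw [← Real.rpow_natCast s 2, ← Real.rpow_add hs]; congr 1; push_cast; ring
    have e2 : (j : ℝ) ^ (β - 1) ≤ (j : ℝ) ^ (β - 1 / 2) :=
      Real.rpow_le_rpow_of_exponent_le hj (by linarith)
    rw [e1]
    have : 0 ≤ s ^ (β - 1) * s ^ 2 := by positivity
    nlinarith
  have hR1 : |∫ k, R k ∂κ j| ≤ 20 * D * (2 + C) * (s ^ (1 + β) * (j : ℝ) ^ (β - 1 / 2)) := by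
    calc |∫ k, R k ∂κ j| ≤ ∫ k, |R k| ∂κ j := abs_integral_le_integral_abs
      _ ≤ ∫ k, A * |(k : ℝ) - j| ^ 3 ∂κ j := integral_mono iR.abs (i3.const_mul A) hRb
      _ ≤ A * ((2 + C) * j * q) := by
          rw [integral_const_mul]; exact mul_le_mul_of_nonneg_left h3 hA0
      _ = 20 * D * (2 + C) * ((s * j) ^ (β - 2) * s ^ 3 * (j * q)) := by rw [hA]; ring
      _ = _ := by rw [hpow1]
  have hV : |F₂ (s * j) * s ^ 2 / 2 * (∫ k, ((k : ℝ) - j) ^ 2 ∂κ j - 2 * j)|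
      ≤ D * C * (s ^ (1 + β) * (j : ℝ) ^ (β - 1 / 2)) := by
    rw [abs_mul, abs_div, abs_mul, abs_two, abs_of_nonneg (sq_nonneg s)]
    calc |F₂ (s * j)| * s ^ 2 / 2 * |∫ k, ((k : ℝ) - j) ^ 2 ∂κ j - 2 * j|
        ≤ (D * (s * j) ^ (β - 1)) * s ^ 2 / 2 * C := by
          gcongr
          · exact hF.bound₂ _ hx
          · exact h.var j hJ
      _ = D * C / 2 * ((s * j) ^ (β - 1) * s ^ 2) := by ring
      _ ≤ D * C / 2 * (s ^ (1 + β) * (j : ℝ) ^ (β - 1 / 2)) := by gcongr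
      _ ≤ _ := by
          have : 0 ≤ D * C * (s ^ (1 + β) * (j : ℝ) ^ (β - 1 / 2)) := by positivity
          linarith
  rw [h_int]
  have heq : ∫ k, R k ∂κ j + (F (s * j) + (F₁ (s * j) * s) * (-α)
      + (F₂ (s * j) * s ^ 2 / 2) * ∫ k, ((k : ℝ) - j) ^ 2 ∂κ j)
      - (F (s * j) - α * (s * F₁ (s * j)) + s ^ 2 * j * F₂ (s * j))
      = ∫ k, R k ∂κ j
        + F₂ (s * j) * s ^ 2 / 2 * (∫ k, ((k : ℝ) - j) ^ 2 ∂κ j - 2 * j) := by ring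
  rw [heq]
  refine (abs_add_le _ _).trans ((add_le_add hR1 hV).trans (le_of_eq ?_))
  ring

end MigrationKernel

lemma exists_forall_le_of_eventually_le {f : ℕ → ℝ} {c : ℝ} (h : ∀ᶠ j in atTop, f j ≤ c) :
    ∃ K : ℝ, 0 ≤ K ∧ ∀ j, f j ≤ K := by
  obtain ⟨N, hN⟩ := eventually_atTop.1 h
  refine ⟨|c| + ∑ j ∈ Finset.range N, |f j|, by positivity, fun j => ?_⟩
  have hs : 0 ≤ ∑ j ∈ Finset.range N, |f j| := Finset.sum_nonneg fun j _ => abs_nonneg _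
  rcases lt_or_ge j N with hj | hj
  · have := Finset.single_le_sum (f := fun j => |f j|) (fun j _ => abs_nonneg _)
      (Finset.mem_range.2 hj)
    linarith [le_abs_self (f j), abs_nonneg c]
  · linarith [hN j hj, le_abs_self c]

/-- A power of smaller exponent is eventually dominated. -/
lemma eventually_mul_rpow_le {a b K c : ℝ} (hab : a < b) (hc : 0 < c) :
    ∀ᶠ j : ℕ in atTop, K * (j : ℝ) ^ a ≤ c * (j : ℝ) ^ b := by
  have h1 : Tendsto (fun j : ℕ => (j : ℝ) ^ (b - a)) atTop atTop :=
    (tendsto_rpow_atTop (sub_pos.2 hab)).comp tendsto_natCast_atTop_atTop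
  filter_upwards [h1.eventually_ge_atTop (K / c), eventually_ge_atTop 1] with j hj hj1
  have hj0 : (0 : ℝ) < j := by exact_mod_cast hj1
  have e : (j : ℝ) ^ b = (j : ℝ) ^ (b - a) * (j : ℝ) ^ a := by
    rw [← Real.rpow_add hj0]; congr 1; ring
  rw [e, ← mul_assoc]
  rw [div_le_iff₀' hc] at hj
  gcongr

namespace MigrationKernel

variable {α C : ℝ} {J : ℕ} {κ : ℕ → Measure ℕ}

/-- Lyapunov drift of `j ^ (1 + β)`. -/
lemma eventually_generator_rpow (h : MigrationKernel α C J κ) {β : ℝ} (hβ0 : 0 ≤ β)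
    (hβ1 : β ≤ 1) : ∃ K : ℝ, 0 ≤ K ∧ ∀ᶠ j : ℕ in atTop,
      |∫ k : ℕ, (k : ℝ) ^ (1 + β) ∂κ j - (j : ℝ) ^ (1 + β)
        + (1 + β) * (α - β) * (j : ℝ) ^ β| ≤ K * (j : ℝ) ^ (β - 1 / 2) := by
  obtain ⟨K, hK0, hK⟩ := h.exists_generator_bound (powerType_rpow hβ0 hβ1) hβ0 hβ1
  refine ⟨K, hK0, ?_⟩
  filter_upwards [eventually_ge_atTop J, eventually_ge_atTop 1] with j hJ hj
  have hj0 : (0 : ℝ) < j := by exact_mod_cast hj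
  have := hK 1 one_pos j hJ hj
  simp only [one_mul, Real.one_rpow, mul_one, one_pow] at this
  have e : (j : ℝ) ^ β = (j : ℝ) ^ (β - 1) * j := by
    rw [← Real.rpow_add_one hj0.ne']; congr 1; ring
  convert this using 2
  rw [e]; ring

/-- Moments of order less than `α` stay bounded along the chain started at `0`. -/
lemma exists_moment_bound (h : MigrationKernel α C J κ) {β : ℝ} (hβ0 : 0 < β) (hβα : β < α)
    (hα1 : α < 1) :
    ∃ B : ℝ, 0 ≤ B ∧ ∀ n, (killOp κ 0)^[n] (fun j : ℕ => (j : ℝ) ^ β) 0 ≤ B := by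
  obtain ⟨K, -, hK⟩ := h.eventually_generator_rpow hβ0.le (by linarith)
  set c := (1 + β) * (α - β) / 2 with hc
  have hc0 : 0 < c := by have := sub_pos.2 hβα; positivity
  have hV : QuadGrowth (fun j : ℕ => (j : ℝ) ^ (1 + β)) :=
    QuadGrowth.rpow (by linarith) (by linarith)
  have hb : QuadGrowth (fun j : ℕ => (j : ℝ) ^ β) := QuadGrowth.rpow hβ0.le (by linarith)
  obtain ⟨K', hKpos, hK'⟩ := exists_forall_le_of_eventually_le (c := 0)
    (f := fun j : ℕ => ∫ k : ℕ, (k : ℝ) ^ (1 + β) ∂κ j - (j : ℝ) ^ (1 + β) + c * (j : ℝ) ^ β) (by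
      filter_upwards [hK, eventually_mul_rpow_le (K := K) (a := β - 1 / 2) (b := β)
        (by linarith) hc0] with j h1 h2
      have := (abs_le.1 h1).2
      have e : (1 + β) * (α - β) * (j : ℝ) ^ β = c * (j : ℝ) ^ β + c * (j : ℝ) ^ β := by
        rw [hc]; ring
      linarith)
  set b : ℕ → ℝ := fun n => (killOp κ 0)^[n] (fun j : ℕ => (j : ℝ) ^ β) 0 with hbdef
  have hbm : Monotone b := h.monotone_iterate_at_zero hb (fun i j hij => by
    gcongr)
  have hb0 : ∀ n, 0 ≤ b n := fun n => iterate_nonneg n (fun j => by positivity) 0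
  have hsum : ∀ n, (killOp κ 0)^[n] (fun j : ℕ => (j : ℝ) ^ (1 + β)) 0
      + c * ∑ i ∈ Finset.range n, b i ≤ n * K' := by
    intro n
    induction n with
    | zero => simp [Real.zero_rpow (by linarith : 1 + β ≠ 0)]
    | succ n ih =>
      have hstep := h.iterate_mono (μ := 0) le_rfl n (h.quadGrowth_killOp le_rfl hV)
        (g := fun j : ℕ => ((j : ℝ) ^ (1 + β) - c * (j : ℝ) ^ β) + K')
        ((hV.sub (hb.const_mul c)).add (QuadGrowth.const K'))
        (fun j => by rw [killOp_zero]; linarith [hK' j]) 0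
      rw [h.iterate_add le_rfl n (hV.sub (hb.const_mul c)) (QuadGrowth.const K'),
        h.iterate_sub le_rfl n hV (hb.const_mul c), h.iterate_zero_const,
        iterate_const_mul] at hstep
      rw [Function.iterate_succ, Function.comp, Finset.sum_range_succ, mul_add]
      push_cast
      have : b n = (killOp κ 0)^[n] (fun j : ℕ => (j : ℝ) ^ β) 0 := rfl
      rw [this]
      linarith
  refine ⟨2 * K' / c, by positivity, fun m => ?_⟩
  have h1 := hsum (2 * (m + 1))
  have h2 : 0 ≤ (killOp κ 0)^[2 * (m + 1)] (fun j : ℕ => (j : ℝ) ^ (1 + β)) 0 :=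
    iterate_nonneg _ (fun j => by positivity) 0
  have h3 : (m + 1 : ℝ) * b m ≤ ∑ i ∈ Finset.range (2 * (m + 1)), b i := by
    rw [two_mul, Finset.sum_range_add]
    have h4 : (m + 1 : ℝ) * b m ≤ ∑ i ∈ Finset.range (m + 1), b (m + 1 + i) := by
      have := Finset.card_nsmul_le_sum (Finset.range (m + 1)) (fun i => b (m + 1 + i)) (b m)
        (fun i _ => hbm (by omega))
      simpa using this
    have h5 : 0 ≤ ∑ i ∈ Finset.range (m + 1), b i := Finset.sum_nonneg fun i _ => hb0 i
    linarith
  have hm : (0 : ℝ) < m + 1 := by positivity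
  rw [le_div_iff₀ hc0]
  push_cast at h1
  have h6 : c * ((m + 1 : ℝ) * b m) ≤ 2 * (m + 1) * K' := by
    have := mul_le_mul_of_nonneg_left h3 hc0.le
    linarith
  have h7 : (m + 1 : ℝ) * (b m * c) ≤ (m + 1) * (2 * K') := by linarith
  exact le_of_mul_le_mul_left h7 hm

lemma quadGrowth_of_le_rpow {γ A : ℝ} (hγ0 : 0 ≤ γ) (hγ1 : γ ≤ 1) {f : ℕ → ℝ}
    (hf : ∀ j : ℕ, |f j| ≤ A * (1 + (j : ℝ) ^ γ)) : QuadGrowth f := by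
  have := ((QuadGrowth.const 1).add (QuadGrowth.rpow hγ0 (by linarith : γ ≤ 2))).const_mul A
  exact this.of_abs_le fun j => (hf j).trans (le_abs_self _)

lemma exists_tail_bound (h : MigrationKernel α C J κ) {γ : ℝ} (hγ0 : 0 ≤ γ) (hγα : γ < α)
    (hα1 : α < 1) {A : ℝ} (hA : 0 ≤ A) {ε : ℝ} (hε : 0 < ε) :
    ∃ K : ℕ, ∀ n, (killOp κ 0)^[n]
      (fun j : ℕ => if K ≤ j then A * (1 + (j : ℝ) ^ γ) else 0) 0 ≤ ε := by
  obtain ⟨β, hγβ, hβα⟩ := exists_between hγα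
  have hβ0 : 0 < β := by linarith
  obtain ⟨B, hB0, hB⟩ := h.exists_moment_bound hβ0 hβα hα1
  have hb : QuadGrowth (fun j : ℕ => (j : ℝ) ^ β) := QuadGrowth.rpow hβ0.le (by linarith)
  have hδ : 0 < ε / (B + 1) := by positivity
  obtain ⟨N, hN⟩ := eventually_atTop.1 ((eventually_mul_rpow_le (K := 2 * A) hγβ hδ).and
    (eventually_ge_atTop 1))
  have hle : ∀ j : ℕ, |if N ≤ j then A * (1 + (j : ℝ) ^ γ) else 0|
      ≤ ε / (B + 1) * (j : ℝ) ^ β := by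
    intro j
    split_ifs with hj
    · obtain ⟨h1, h2⟩ := hN j hj
      rw [abs_of_nonneg (by positivity)]
      have : (1 : ℝ) ≤ (j : ℝ) ^ γ := Real.one_le_rpow (by exact_mod_cast h2) hγ0
      nlinarith
    · rw [abs_zero]; positivity
  refine ⟨N, fun n => ?_⟩
  have := h.abs_iterate_le (μ := 0) le_rfl n (hb.const_mul _) hle 0
  rw [iterate_const_mul] at this
  calc _ ≤ _ := le_abs_self _
    _ ≤ _ := this
    _ ≤ ε / (B + 1) * B := mul_le_mul_of_nonneg_left (hB n) (by positivity)
    _ ≤ ε := by rw [div_mul_eq_mul_div, div_le_iff₀ (by positivity)]; nlinarith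

/-- A pointwise vanishing family of uniformly moderate growth vanishes in mean, uniformly
in time. -/
lemma eventually_iterate_le_of_tendsto (h : MigrationKernel α C J κ) {γ : ℝ} (hγ0 : 0 ≤ γ)
    (hγα : γ < α) (hα1 : α < 1) {ι : Type*} {l : Filter ι} {w : ι → ℕ → ℝ} {A : ℝ}
    (hA : 0 ≤ A) (hw : ∀ᶠ i in l, ∀ j : ℕ, |w i j| ≤ A * (1 + (j : ℝ) ^ γ))
    (hlim : ∀ j, Tendsto (fun i => w i j) l (𝓝 0)) {ε : ℝ} (hε : 0 < ε) :
    ∀ᶠ i in l, ∀ (μ : ℝ) (n : ℕ), 0 ≤ μ → |(killOp κ μ)^[n] (w i) 0| ≤ ε := by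
  obtain ⟨K, hK⟩ := h.exists_tail_bound hγ0 hγα hα1 hA (half_pos hε)
  have hfin : ∀ᶠ i in l, ∀ j ∈ Finset.range K, |w i j| ≤ ε / 2 := by
    rw [Filter.eventually_all_finset]
    intro j _
    have := (hlim j).abs
    rw [abs_zero] at this
    exact this.eventually_le_const (half_pos hε)
  filter_upwards [hw, hfin] with i hwi hi μ n hμ
  have hT : QuadGrowth (fun j : ℕ => if K ≤ j then A * (1 + (j : ℝ) ^ γ) else 0) := by
    refine quadGrowth_of_le_rpow (A := A) hγ0 (by linarith) fun j => ?_
    split_ifs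
    · rw [abs_of_nonneg (by positivity)]
    · rw [abs_zero]; positivity
  have hg : QuadGrowth (fun j : ℕ => ε / 2 + if K ≤ j then A * (1 + (j : ℝ) ^ γ) else 0) :=
    (QuadGrowth.const _).add hT
  have := h.abs_iterate_le hμ n hg (f := w i) (fun j => by
    split_ifs with hj
    · linarith [hwi j]
    · simpa using hi j (Finset.mem_range.2 (by omega))) 0
  rw [h.iterate_add le_rfl n (QuadGrowth.const _) hT, h.iterate_zero_const] at this
  linarith [hK n]

lemma tendsto_killOp_of_bounded (h : MigrationKernel α C J κ) {ι : Type*} {l : Filter ι}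
    [l.IsCountablyGenerated] {w : ι → ℕ → ℝ} {B : ℝ} (hw : ∀ᶠ i in l, ∀ j, |w i j| ≤ B)
    {v : ℕ → ℝ} (hlim : ∀ j, Tendsto (fun i => w i j) l (𝓝 (v j))) (j : ℕ) :
    Tendsto (fun i => ∫ k, w i k ∂κ j) l (𝓝 (∫ k, v k ∂κ j)) := by
  have := h.prob j
  exact tendsto_integral_filter_of_dominated_convergence (fun _ => B)
    (Eventually.of_forall fun i => Measurable.of_discrete.aestronglyMeasurable)
    (hw.mono fun i hi => ae_of_all _ hi) (integrable_const B)
    (ae_of_all _ hlim)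

lemma abs_killOp_iterate_le_of_bounded (h : MigrationKernel α C J κ) {μ : ℝ} (hμ : 0 ≤ μ)
    (n : ℕ) {f : ℕ → ℝ} {B : ℝ} (hf : ∀ j, |f j| ≤ B) (j : ℕ) :
    |(killOp κ μ)^[n] f j| ≤ B := by
  have := h.abs_iterate_le hμ n (QuadGrowth.const B) hf j
  rwa [h.iterate_zero_const] at this

/-- For a fixed number of steps, the killing disappears in the limit of small rate. -/
lemma tendsto_iterate_killOp (h : MigrationKernel α C J κ) {G : ℕ → ℝ} {B : ℝ}
    (hG : ∀ j, |G j| ≤ B) (m : ℕ) (j : ℕ) :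
    Tendsto (fun μ => (killOp κ μ)^[m] G j) (𝓝[≥] 0) (𝓝 ((killOp κ 0)^[m] G j)) := by
  induction m generalizing j with
  | zero => exact tendsto_const_nhds
  | succ m ih =>
    simp only [Function.iterate_succ_apply']
    have h1 : Tendsto (fun μ : ℝ => Real.exp (-μ * j)) (𝓝[≥] 0) (𝓝 (Real.exp (-0 * j))) :=
      ((by fun_prop : Continuous fun μ : ℝ => Real.exp (-μ * j)).tendsto 0).mono_left
        nhdsWithin_le_nhds
    refine h1.mul (h.tendsto_killOp_of_bounded (B := B) ?_ ih j)
    filter_upwards [self_mem_nhdsWithin] with μ hμ k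
    exact h.abs_killOp_iterate_le_of_bounded hμ m hG k

end MigrationKernel

/-- Along the chain started at `0` and killed at a small rate, `f` averages to `a`
after a few steps. -/
def Mixes (κ : ℕ → Measure ℕ) (f : ℕ → ℝ) (a : ℝ) : Prop :=
  ∀ ε : ℝ, 0 < ε → ∃ m : ℕ, ∀ᶠ μ in 𝓝[≥] (0 : ℝ), ∀ k, m ≤ k →
    |(killOp κ μ)^[k] f 0 - a * (killOp κ μ)^[k] (fun _ => 1) 0| ≤ ε

namespace MigrationKernel

variable {α C : ℝ} {J : ℕ} {κ : ℕ → Measure ℕ}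

lemma tendsto_of_mixes (h : MigrationKernel α C J κ) {f : ℕ → ℝ} {a : ℝ} (hf : Mixes κ f a) :
    Tendsto (fun n => (killOp κ 0)^[n] f 0) atTop (𝓝 a) := by
  rw [Metric.tendsto_atTop]
  intro ε hε
  obtain ⟨m, hm⟩ := hf (ε / 2) (half_pos hε)
  refine ⟨m, fun k hk => ?_⟩
  have := hm.self_of_nhdsWithin (mem_Ici.2 le_rfl) k hk
  rw [h.iterate_zero_const, mul_one] at this
  rw [Real.dist_eq]; linarith

lemma mixes_add (h : MigrationKernel α C J κ) {f g : ℕ → ℝ} {a b : ℝ} (hf : QuadGrowth f)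
    (hg : QuadGrowth g) (hfa : Mixes κ f a) (hgb : Mixes κ g b) :
    Mixes κ (fun j => f j + g j) (a + b) := by
  intro ε hε
  obtain ⟨m₁, h₁⟩ := hfa (ε / 2) (half_pos hε)
  obtain ⟨m₂, h₂⟩ := hgb (ε / 2) (half_pos hε)
  refine ⟨max m₁ m₂, ?_⟩
  filter_upwards [h₁, h₂, self_mem_nhdsWithin] with μ e₁ e₂ hμ k hk
  rw [h.iterate_add hμ k hf hg]
  have e₁ := abs_le.1 (e₁ k (le_of_max_le_left hk))
  have e₂ := abs_le.1 (e₂ k (le_of_max_le_right hk))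
  rw [abs_le]; constructor <;> nlinarith

lemma mixes_const_mul {f : ℕ → ℝ} {a : ℝ} (c : ℝ) (hfa : Mixes κ f a) :
    Mixes κ (fun j => c * f j) (c * a) := by
  intro ε hε
  obtain ⟨m, hm⟩ := hfa (ε / (|c| + 1)) (by positivity)
  refine ⟨m, ?_⟩
  filter_upwards [hm] with μ e k hk
  rw [iterate_const_mul, mul_assoc, ← mul_sub, abs_mul]
  calc _ ≤ |c| * (ε / (|c| + 1)) := mul_le_mul_of_nonneg_left (e k hk) (abs_nonneg c)
    _ ≤ ε := by
      rw [mul_div_assoc', div_le_iff₀ (by positivity)]; nlinarith [abs_nonneg c]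

/-- Monotone functions with values in `[0, 1]` mix. -/
lemma exists_mixes_of_monotone (h : MigrationKernel α C J κ) (hα0 : 0 < α) (hα1 : α < 1)
    {G : ℕ → ℝ} (hm : Monotone G) (hG0 : ∀ j, 0 ≤ G j) (hG1 : ∀ j, G j ≤ 1) :
    ∃ a, Mixes κ G a := by
  have hGb : ∀ j, |G j| ≤ 1 := fun j => by rw [abs_of_nonneg (hG0 j)]; exact hG1 j
  have hGq : QuadGrowth G := QuadGrowth.of_bounded hGb
  set b : ℕ → ℝ := fun n => (killOp κ 0)^[n] G 0 with hb
  have hbm : Monotone b := h.monotone_iterate_at_zero hGq hm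
  have hbabs : ∀ n, |b n| ≤ 1 := fun n => h.abs_killOp_iterate_le_of_bounded le_rfl n hGb 0
  have hbdd : BddAbove (range b) := ⟨1, by rintro _ ⟨n, rfl⟩; exact (abs_le.1 (hbabs n)).2⟩
  have hlim := tendsto_atTop_ciSup hbm hbdd
  set L := ⨆ n, b n with hL
  refine ⟨L, fun ε hε => ?_⟩
  obtain ⟨m, hmL⟩ := ((hlim.eventually_const_lt (show L - ε / 4 < L by linarith))).exists
  refine ⟨m, ?_⟩
  have hε4 : 0 < ε / 4 := by positivity
  have hneg : ∀ {G : ℕ → ℝ}, (∀ j, |G j| ≤ 1) → ∀ᶠ μ in 𝓝[≥] (0 : ℝ), ∀ n : ℕ,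
      |(killOp κ μ)^[n] (fun j => (killOp κ μ)^[m] G j - (killOp κ 0)^[m] G j) 0| ≤ ε / 4 := by
    intro G hG
    have := h.eventually_iterate_le_of_tendsto (γ := 0) le_rfl hα0 hα1 (l := 𝓝[≥] (0 : ℝ))
      (w := fun μ j => (killOp κ μ)^[m] G j - (killOp κ 0)^[m] G j) (A := 1) zero_le_one
      (by
        filter_upwards [self_mem_nhdsWithin] with μ hμ j
        have e1 := h.abs_killOp_iterate_le_of_bounded hμ m hG j
        have e2 := h.abs_killOp_iterate_le_of_bounded le_rfl m hG j
        rw [Real.rpow_zero]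
        exact (abs_sub _ _).trans (by linarith))
      (fun j => by
        have := (h.tendsto_iterate_killOp hG m j).sub_const ((killOp κ 0)^[m] G j)
        rwa [sub_self] at this) hε4
    filter_upwards [this, self_mem_nhdsWithin] with μ h1 hμ n
    exact h1 μ n hμ
  filter_upwards [hneg hGb, hneg (G := fun _ => 1) (by simp), self_mem_nhdsWithin]
    with μ e₁ e₂ hμ k hk
  obtain ⟨r, rfl⟩ : ∃ r, k = r + m := ⟨k - m, by omega⟩
  have q1 := h.quadGrowth_iterate (μ := μ) hμ m hGq
  have q2 := h.quadGrowth_iterate (μ := 0) le_rfl m hGq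
  have q3 := h.quadGrowth_iterate (μ := μ) hμ m (QuadGrowth.const 1)
  have d₁ := e₁ r
  have d₂ := e₂ r
  rw [h.iterate_sub hμ r q1 q2] at d₁
  rw [h.iterate_zero_const, h.iterate_sub hμ r q3 (QuadGrowth.const 1)] at d₂
  have hmono := h.monotone_iterate_zero m hGq hm
  have hc0 : 0 ≤ b m := iterate_nonneg m hG0 0
  have hc1 : b m ≤ 1 := (abs_le.1 (hbabs m)).2
  have hpos : ∀ j, 0 ≤ (killOp κ 0)^[m] G j - b m := fun j => sub_nonneg.2 (hmono (Nat.zero_le j))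
  have d₃ := iterate_nonneg (κ := κ) (μ := μ) r hpos 0
  have d₄ := h.iterate_le_zero hμ r (q2.sub (QuadGrowth.const (b m))) hpos 0
  have hcm := iterate_const_mul (κ := κ) μ (b m) r (fun _ => 1)
  simp only [mul_one] at hcm
  rw [h.iterate_sub hμ r q2 (QuadGrowth.const (b m)), hcm] at d₃ d₄
  rw [h.iterate_sub le_rfl r q2 (QuadGrowth.const (b m)), h.iterate_zero_const,
    ← Function.iterate_add_apply] at d₄
  have hle : b (r + m) ≤ L := le_ciSup hbdd _
  have hmle : b m ≤ L := le_ciSup hbdd _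
  have hu0 : 0 ≤ (killOp κ μ)^[r + m] (fun _ => (1 : ℝ)) 0 :=
    iterate_nonneg _ (fun _ => zero_le_one) 0
  have hu1 : (killOp κ μ)^[r + m] (fun _ => (1 : ℝ)) 0 ≤ 1 :=
    (abs_le.1 (h.abs_killOp_iterate_le_of_bounded hμ (r + m) (B := 1) (by simp) 0)).2
  simp only [← Function.iterate_add_apply] at d₁ d₂ d₃ d₄
  set u := (killOp κ μ)^[r + m] (fun _ => (1 : ℝ)) 0
  set x := (killOp κ μ)^[r + m] G 0
  set y := (killOp κ μ)^[r] ((killOp κ 0)^[m] G) 0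
  set z := (killOp κ μ)^[r] (fun _ => (1 : ℝ)) 0
  have hb' : b (r + m) = (killOp κ 0)^[r + m] G 0 := rfl
  rw [← hb'] at d₄
  rw [abs_le] at d₁ d₂ ⊢
  have t1 : b m * (u - z) ≤ ε / 4 := by nlinarith
  have t2 : -(ε / 4) ≤ b m * (u - z) := by nlinarith
  have t3 : (L - b m) * u ≤ ε / 4 := by nlinarith
  have t4 : 0 ≤ (L - b m) * u := by nlinarith
  constructor <;> nlinarith

lemma exists_mixes_ite_lt (h : MigrationKernel α C J κ) (hα0 : 0 < α) (hα1 : α < 1)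
    (f : ℕ → ℝ) (K : ℕ) : ∃ a, Mixes κ (fun j => if j < K then f j else 0) a := by
  have hG : ∀ i : ℕ, ∃ a, Mixes κ (fun j => if i ≤ j then (1 : ℝ) else 0) a := fun i =>
    h.exists_mixes_of_monotone hα0 hα1
      (fun a b hab => by
        split_ifs with h1 h2
        · exact le_rfl
        · exact absurd (h1.trans hab) h2
        · exact zero_le_one
        · exact le_rfl)
      (fun j => by split_ifs <;> norm_num) (fun j => by split_ifs <;> norm_num)
  have hq : ∀ i : ℕ, QuadGrowth (fun j => if i ≤ j then (1 : ℝ) else 0) := fun i =>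
    QuadGrowth.of_bounded (B := 1) fun j => by split_ifs <;> norm_num
  induction K with
  | zero =>
    obtain ⟨a, ha⟩ := hG 0
    refine ⟨0 * a, ?_⟩
    convert mixes_const_mul 0 ha using 2
    simp
  | succ K ih =>
    obtain ⟨a, ha⟩ := ih
    obtain ⟨b, hb⟩ := hG K
    obtain ⟨c, hc⟩ := hG (K + 1)
    refine ⟨a + (f K * b + (-f K) * c), ?_⟩
    have hfq : QuadGrowth (fun j => if j < K then f j else 0) := by
      refine QuadGrowth.of_bounded (B := ∑ i ∈ Finset.range K, |f i|) fun j => ?_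
      split_ifs with hj
      · exact Finset.single_le_sum (f := fun j => |f j|) (fun j _ => abs_nonneg _)
          (Finset.mem_range.2 hj)
      · rw [abs_zero]; positivity
    convert h.mixes_add hfq (((hq K).const_mul (f K)).add ((hq (K + 1)).const_mul (-f K))) ha
      (h.mixes_add ((hq K).const_mul (f K)) ((hq (K + 1)).const_mul (-f K))
        (mixes_const_mul (f K) hb) (mixes_const_mul (-f K) hc)) using 2 with j
    rcases lt_trichotomy j K with hj | hj | hj
    · have hj' := hj.trans (Nat.lt_succ_self K)
      simp [hj, hj', not_le.2 hj, not_le.2 hj']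
    · subst hj; simp
    · simp [not_lt.2 hj.le, hj.le, Nat.succ_le_of_lt hj, not_lt.2 (Nat.succ_le_of_lt hj)]

/-- Functions of moderate growth mix. -/
lemma exists_mixes (h : MigrationKernel α C J κ) {γ : ℝ} (hγ0 : 0 ≤ γ) (hγα : γ < α)
    (hα1 : α < 1) {A : ℝ} (hA : 0 ≤ A) {f : ℕ → ℝ}
    (hf : ∀ j : ℕ, |f j| ≤ A * (1 + (j : ℝ) ^ γ)) : ∃ a, Mixes κ f a := by
  have hfq : QuadGrowth f := quadGrowth_of_le_rpow hγ0 (by linarith) hf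
  have htrunc : ∀ ε : ℝ, 0 < ε → ∃ K : ℕ, ∀ (μ : ℝ) (n : ℕ), 0 ≤ μ →
      |(killOp κ μ)^[n] f 0 - (killOp κ μ)^[n] (fun j => if j < K then f j else 0) 0| ≤ ε := by
    intro ε hε
    obtain ⟨K, hK⟩ := h.exists_tail_bound hγ0 hγα hα1 hA hε
    refine ⟨K, fun μ n hμ => ?_⟩
    have hT : QuadGrowth (fun j : ℕ => if K ≤ j then A * (1 + (j : ℝ) ^ γ) else 0) := by
      refine quadGrowth_of_le_rpow (A := A) hγ0 (by linarith) fun j => ?_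
      split_ifs
      · rw [abs_of_nonneg (by positivity)]
      · rw [abs_zero]; positivity
    have hq : QuadGrowth (fun j => if j < K then f j else 0) :=
      hfq.of_abs_le fun j => by split_ifs <;> simp
    have := h.abs_iterate_le hμ n hT (f := fun j => f j - if j < K then f j else 0) (fun j => by
      by_cases hj : j < K
      · simp [hj, not_le.2 hj]
      · simp only [hj, if_false, sub_zero, not_lt.1 hj, if_true]; exact hf j) 0
    rw [h.iterate_sub hμ n hfq hq] at this
    exact this.trans (hK n)
  have hcau : CauchySeq fun n => (killOp κ 0)^[n] f 0 := by
    rw [Metric.cauchySeq_iff']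
    intro ε hε
    obtain ⟨K, hK⟩ := htrunc (ε / 8) (by positivity)
    obtain ⟨a, ha⟩ := h.exists_mixes_ite_lt (by linarith) hα1 f K
    obtain ⟨N, hN⟩ := (Metric.tendsto_atTop.1 (h.tendsto_of_mixes ha)) (ε / 8) (by positivity)
    refine ⟨N, fun n hn => ?_⟩
    have e1 := abs_le.1 (hK 0 n le_rfl)
    have e2 := abs_le.1 (hK 0 N le_rfl)
    have e3 := hN n hn
    have e4 := hN N le_rfl
    rw [Real.dist_eq, abs_lt] at e3 e4 ⊢
    constructor <;> linarith
  obtain ⟨a, ha⟩ := cauchySeq_tendsto_of_complete hcau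
  refine ⟨a, fun ε hε => ?_⟩
  obtain ⟨K, hK⟩ := htrunc (ε / 4) (by positivity)
  obtain ⟨b, hb⟩ := h.exists_mixes_ite_lt (by linarith) hα1 f K
  obtain ⟨m, hm⟩ := hb (ε / 4) (by positivity)
  have hab : |a - b| ≤ ε / 4 :=
    le_of_tendsto (ha.sub (h.tendsto_of_mixes hb)).abs (Eventually.of_forall fun n => hK 0 n le_rfl)
  refine ⟨m, ?_⟩
  filter_upwards [hm, self_mem_nhdsWithin] with μ e hμ k hk
  have e1 := abs_le.1 (e k hk)
  have e2 := abs_le.1 (hK μ k hμ)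
  have hu0 : 0 ≤ (killOp κ μ)^[k] (fun _ => (1 : ℝ)) 0 :=
    iterate_nonneg _ (fun _ => zero_le_one) 0
  have hu1 : (killOp κ μ)^[k] (fun _ => (1 : ℝ)) 0 ≤ 1 :=
    (abs_le.1 (h.abs_killOp_iterate_le_of_bounded hμ k (B := 1) (by simp) 0)).2
  set u := (killOp κ μ)^[k] (fun _ => (1 : ℝ)) 0
  have e3 : |(a - b) * u| ≤ ε / 4 := by
    rw [abs_mul, abs_of_nonneg hu0]
    nlinarith [abs_nonneg (a - b)]
  rw [abs_le] at e3 ⊢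
  constructor <;> nlinarith

end MigrationKernel

lemma exists_pos_forall_lt_le {f : ℕ → ℝ} (hf : ∀ j, 0 < f j) (K : ℕ) :
    ∃ c : ℝ, 0 < c ∧ ∀ j < K, c ≤ f j := by
  induction K with
  | zero => exact ⟨1, one_pos, by simp⟩
  | succ K ih =>
    obtain ⟨c, hc, hcf⟩ := ih
    refine ⟨min c (f K), lt_min hc (hf K), fun j hj => ?_⟩
    rcases Nat.lt_succ_iff_lt_or_eq.1 hj with hj | rfl
    · exact (min_le_left _ _).trans (hcf j hj)
    · exact min_le_right _ _

/-- The error of the harmonic approximation `j ^ (1 + α)` of the chain with kernel `κ`. -/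
def harmonicDefect (κ : ℕ → Measure ℕ) (α : ℝ) (j : ℕ) : ℝ :=
  ∫ k : ℕ, (k : ℝ) ^ (1 + α) ∂κ j - (j : ℝ) ^ (1 + α)

namespace MigrationKernel

variable {α C : ℝ} {J : ℕ} {κ : ℕ → Measure ℕ}

lemma exists_harmonicDefect_bound (h : MigrationKernel α C J κ) (hα0 : 0 < α) (hα1 : α < 1) :
    ∃ A : ℝ, 0 ≤ A ∧ ∀ j : ℕ, |harmonicDefect κ α j| ≤ A * (1 + (j : ℝ) ^ max (α - 1 / 2) 0) := by
  obtain ⟨K, hK0, hK⟩ := h.eventually_generator_rpow hα0.le hα1.le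
  obtain ⟨K', hKpos, hK'⟩ := exists_forall_le_of_eventually_le (c := 0)
    (f := fun j => |harmonicDefect κ α j| - K * (j : ℝ) ^ max (α - 1 / 2) 0) (by
      filter_upwards [hK, eventually_ge_atTop 1] with j hj hj1
      rw [sub_self, mul_zero, zero_mul, add_zero] at hj
      have : (j : ℝ) ^ (α - 1 / 2) ≤ (j : ℝ) ^ max (α - 1 / 2) 0 :=
        Real.rpow_le_rpow_of_exponent_le (by exact_mod_cast hj1) (le_max_left _ _)
      have := mul_le_mul_of_nonneg_left this hK0
      rw [harmonicDefect]; linarith)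
  refine ⟨K + K', by positivity, fun j => ?_⟩
  have h1 := hK' j
  have h2 : 0 ≤ (j : ℝ) ^ max (α - 1 / 2) 0 := by positivity
  nlinarith [mul_nonneg hKpos h2]

/-- The chain started at `0` returns to `0` with probability bounded below. -/
lemma exists_return_bound (h : MigrationKernel α C J κ) (hα0 : 0 < α) (hα1 : α < 1) :
    ∃ η : ℝ, 0 < η ∧ ∀ n, η ≤ (killOp κ 0)^[n + 1] (fun j => if j = 0 then 1 else 0) 0 := by
  obtain ⟨K, hK⟩ := h.exists_tail_bound (γ := 0) le_rfl hα0 hα1 (A := 1 / 2) (by norm_num)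
    (ε := 1 / 2) (by norm_num)
  obtain ⟨c, hc, hcf⟩ := exists_pos_forall_lt_le (f := fun j => (κ j).real {0}) (fun j => by
    have := h.prob j
    exact ENNReal.toReal_pos (h.charge j 0).ne' (measure_ne_top _ _)) K
  refine ⟨c * (1 / 2), by positivity, fun n => ?_⟩
  have hT : QuadGrowth (fun j : ℕ => if K ≤ j then 1 / 2 * (1 + (j : ℝ) ^ (0 : ℝ)) else 0) :=
    QuadGrowth.of_bounded (B := 1) fun j => by split_ifs <;> norm_num
  have hq : QuadGrowth (fun j : ℕ => if j = 0 then (1 : ℝ) else 0) :=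
    QuadGrowth.of_bounded (B := 1) fun j => by split_ifs <;> norm_num
  have h_int : ∀ j, killOp κ 0 (fun j => if j = 0 then 1 else 0) j = (κ j).real {0} := by
    intro j
    have : (fun j : ℕ => if j = 0 then (1 : ℝ) else 0) = indicator {0} 1 := by
      ext j; simp [indicator]
    rw [killOp_zero, this, integral_indicator_one (by trivial)]
  have h1 := h.iterate_mono (μ := 0) le_rfl n
    (((QuadGrowth.const 1).sub hT).const_mul c) (h.quadGrowth_killOp le_rfl hq)
    (fun j => by
      rw [h_int]
      split_ifs with hj
      · norm_num
      · simpa using hcf j (by omega)) 0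
  rw [iterate_const_mul, h.iterate_sub le_rfl n (QuadGrowth.const 1) hT, h.iterate_zero_const] at h1
  rw [Function.iterate_succ, Function.comp]
  refine le_trans ?_ h1
  have := hK n
  exact mul_le_mul_of_nonneg_left (by linarith) hc.le

/-- The average of the harmonic defect is positive. -/
lemma exists_mixes_harmonicDefect (h : MigrationKernel α C J κ) (hα0 : 0 < α) (hα1 : α < 1) :
    ∃ a : ℝ, 0 < a ∧ Mixes κ (harmonicDefect κ α) a := by
  obtain ⟨A, hA0, hA⟩ := h.exists_harmonicDefect_bound hα0 hα1
  have hγα : max (α - 1 / 2) 0 < α := max_lt (by linarith) hα0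
  obtain ⟨a, ha⟩ := h.exists_mixes (le_max_right _ _) hγα hα1 hA0 hA
  refine ⟨a, ?_, ha⟩
  have hgq : QuadGrowth (harmonicDefect κ α) :=
    quadGrowth_of_le_rpow (le_max_right _ _) (by linarith) hA
  obtain ⟨η, hη, hret⟩ := h.exists_return_bound hα0 hα1
  set V : ℕ → ℝ := fun j => (j : ℝ) ^ (1 + α) with hV
  set W : ℕ → ℝ := fun j => (j : ℝ) ^ (1 + α) - (j : ℝ) ^ (1 + α / 2) with hW
  have hVq : QuadGrowth V := QuadGrowth.rpow (by linarith) (by linarith)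
  have hUq : QuadGrowth (fun j : ℕ => (j : ℝ) ^ (1 + α / 2)) :=
    QuadGrowth.rpow (by linarith) (by linarith)
  have hWq : QuadGrowth W := hVq.sub hUq
  have hWsub : ∀ᶠ j in atTop, W j ≤ ∫ k, W k ∂κ j := by
    obtain ⟨K, hK0, hK⟩ := h.eventually_generator_rpow hα0.le hα1.le
    obtain ⟨L, hL0, hL⟩ := h.eventually_generator_rpow (β := α / 2) (by linarith) (by linarith)
    have hc : 0 < (1 + α / 2) * (α - α / 2) / 2 := by
      have : 0 < α - α / 2 := by linarith
      positivity
    filter_upwards [hK, hL, eventually_mul_rpow_le (K := K) (a := α - 1 / 2) (b := α / 2)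
      (by linarith) hc, eventually_mul_rpow_le (K := L) (a := α / 2 - 1 / 2) (b := α / 2)
      (by linarith) hc] with j e1 e2 e3 e4
    have e5 : ∫ k, W k ∂κ j = ∫ k : ℕ, (k : ℝ) ^ (1 + α) ∂κ j
        - ∫ k : ℕ, (k : ℝ) ^ (1 + α / 2) ∂κ j :=
      integral_sub (h.integrable hVq j) (h.integrable hUq j)
    rw [e5]
    rw [sub_self, mul_zero, zero_mul, add_zero] at e1
    have e1 := (abs_le.1 e1).1
    have e2 := (abs_le.1 e2).2
    simp only [hW]
    nlinarith
  obtain ⟨N, hN⟩ := eventually_atTop.1 hWsub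
  set B : ℝ := ∑ j ∈ Finset.range N, |W j| with hB
  have hB0 : 0 ≤ B := by positivity
  have hWB : ∀ j < N, W j ≤ B := fun j hj => (le_abs_self _).trans
    (Finset.single_le_sum (f := fun j => |W j|) (fun j _ => abs_nonneg _) (Finset.mem_range.2 hj))
  set H : ℕ → ℝ := fun j => max (W j) B with hH
  have hHq : QuadGrowth H := by
    obtain ⟨D, hD0, hD⟩ := hWq
    obtain ⟨E, hE0, hE⟩ := QuadGrowth.const B
    refine ⟨D + E, by positivity, fun j => ?_⟩
    have h1 := hD j
    have h2 := hE j
    rw [add_mul]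
    rcases max_cases (W j) B with ⟨e, -⟩ | ⟨e, -⟩ <;> simp only [hH, e]
    · have : 0 ≤ |B| := abs_nonneg B
      linarith
    · have : 0 ≤ |W j| := abs_nonneg _
      linarith
  have hPH : ∀ j, H j ≤ killOp κ 0 H j := by
    intro j
    have hp := h.prob j
    rw [killOp_zero]
    have hBle : B ≤ ∫ k, H k ∂κ j := by
      calc B = ∫ _, B ∂κ j := by simp
        _ ≤ _ := integral_mono (integrable_const _) (h.integrable hHq j) fun k => le_max_right _ _
    refine max_le ?_ hBle
    rcases lt_or_ge j N with hj | hj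
    · exact (hWB j hj).trans hBle
    · exact (hN j hj).trans
        (integral_mono (h.integrable hWq j) (h.integrable hHq j) fun k => le_max_left _ _)
  have hW0 : W 0 = 0 := by
    simp [hW, Real.zero_rpow (by linarith : 1 + α ≠ 0),
      Real.zero_rpow (by linarith : 1 + α / 2 ≠ 0)]
  have hH0 : H 0 = B := by simp [hH, hW0, hB0]
  have hδ : 0 < killOp κ 0 H 0 - H 0 := by
    have hp := h.prob 0
    have e : killOp κ 0 H 0 - H 0 = ∫ k, (H k - B) ∂κ 0 := by
      rw [integral_sub (h.integrable hHq 0) (integrable_const _), killOp_zero, hH0]; simp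
    rw [e, integral_pos_iff_support_of_nonneg (fun k => sub_nonneg.2 (le_max_right _ _))
      ((h.integrable hHq 0).sub (integrable_const _))]
    obtain ⟨k, hk⟩ : ∃ k, B < W k := by
      have h1 := eventually_mul_rpow_le (K := 2) (a := 1 + α / 2) (b := 1 + α) (c := 1)
        (by linarith) one_pos
      have h2 : Tendsto (fun j : ℕ => (j : ℝ) ^ (1 + α / 2)) atTop atTop :=
        (tendsto_rpow_atTop (by linarith)).comp tendsto_natCast_atTop_atTop
      obtain ⟨k, hk1, hk2⟩ := (h1.and (h2.eventually_gt_atTop B)).exists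
      exact ⟨k, by simp only [hW]; linarith⟩
    refine (h.charge 0 k).trans_le (measure_mono ?_)
    simp only [singleton_subset_iff, Function.mem_support]
    rw [max_eq_left hk.le]
    linarith
  set δ := killOp κ 0 H 0 - H 0 with hδdef
  have hgrow : ∀ n : ℕ, B + δ * η * n ≤ (killOp κ 0)^[n + 1] H 0 := by
    intro n
    induction n with
    | zero =>
      have : B ≤ killOp κ 0 H 0 := hH0 ▸ hPH 0
      simpa using this
    | succ n ih =>
      have hPHq := h.quadGrowth_killOp (μ := 0) le_rfl hHq
      have hq : QuadGrowth (fun j : ℕ => if j = 0 then (1 : ℝ) else 0) :=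
        QuadGrowth.of_bounded (B := 1) fun j => by split_ifs <;> norm_num
      have h1 := h.iterate_mono (μ := 0) le_rfl (n + 1) (hq.const_mul δ) (hPHq.sub hHq)
        (fun j => by
          by_cases hj : j = 0
          · subst hj; simp [hδdef]
          · simpa [hj] using hPH j) 0
      rw [iterate_const_mul, h.iterate_sub le_rfl _ hPHq hHq] at h1
      rw [Function.iterate_succ, Function.comp]
      have h2 := mul_le_mul_of_nonneg_left (hret n) hδ.le
      push_cast
      linarith
  have hVH : ∀ n : ℕ, δ * η * n ≤ (killOp κ 0)^[n + 1] V 0 := by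
    intro n
    have h1 := h.iterate_mono (μ := 0) le_rfl (n + 1) (hHq.sub (QuadGrowth.const B)) hVq
      (fun j => by
        have hj : (0 : ℝ) ≤ (j : ℝ) ^ (1 + α / 2) := by positivity
        have hj' : (0 : ℝ) ≤ (j : ℝ) ^ (1 + α) := by positivity
        rcases max_cases (W j) B with ⟨e, -⟩ | ⟨e, -⟩ <;> simp only [hH, hV, hW] <;> linarith) 0
    rw [h.iterate_sub le_rfl _ hHq (QuadGrowth.const B), h.iterate_zero_const] at h1
    linarith [hgrow n]
  have hsum : ∀ n : ℕ, (killOp κ 0)^[n] V 0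
      = ∑ i ∈ Finset.range n, (killOp κ 0)^[i] (harmonicDefect κ α) 0 := by
    intro n
    induction n with
    | zero => simp [hV, Real.zero_rpow (by linarith : 1 + α ≠ 0)]
    | succ n ih =>
      have e : harmonicDefect κ α = fun j => killOp κ 0 V j - V j := by
        funext j; rw [killOp_zero, harmonicDefect]
      rw [Finset.sum_range_succ, ← ih]
      conv_rhs => rw [e, h.iterate_sub le_rfl n (h.quadGrowth_killOp le_rfl hVq) hVq]
      rw [Function.iterate_succ, Function.comp]; ring
  have hces := (h.tendsto_of_mixes ha).cesaro.comp (tendsto_add_atTop_nat 1)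
  have hlow : Tendsto (fun n : ℕ => ((n + 1 : ℕ) : ℝ)⁻¹ * (δ * η * n)) atTop (𝓝 (δ * η)) := by
    have := (tendsto_natCast_div_add_atTop (1 : ℝ)).const_mul (δ * η)
    rw [mul_one] at this
    refine this.congr fun n => ?_
    push_cast
    ring
  have hle := le_of_tendsto_of_tendsto' hlow hces fun n => by
    simp only [Function.comp, ← hsum]
    exact mul_le_mul_of_nonneg_left (hVH n) (by positivity)
  have : 0 < δ * η := by positivity
  linarith

end MigrationKernel

/-- The integral `∫₀^∞ s ^ a * exp (-s - q / s) ds`, a modified Bessel function of `2 √q`. -/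
def besselInt (a q : ℝ) : ℝ := ∫ s in Ioi (0 : ℝ), s ^ a * Real.exp (-s - q / s)

lemma exp_neg_le_factorial_mul_pow {y : ℝ} (hy : 0 < y) (m : ℕ) :
    Real.exp (-y) ≤ m.factorial * (1 / y) ^ m := by
  have h := Real.pow_div_factorial_le_exp y hy.le m
  have hf : (0 : ℝ) < m.factorial := by positivity
  rw [Real.exp_neg, one_div, inv_pow, ← div_eq_mul_inv,
    inv_le_comm₀ (Real.exp_pos _) (by positivity),
    inv_div]
  exact h

lemma rpow_mul_exp_neg_div_le {a q s : ℝ} (hq : 0 < q) (hs : 0 < s) (m : ℕ) :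
    s ^ a * Real.exp (-(q / s)) ≤ m.factorial * q⁻¹ ^ m * s ^ (a + m) := by
  have h := exp_neg_le_factorial_mul_pow (div_pos hq hs) m
  rw [Real.rpow_add_natCast hs.ne']
  calc _ ≤ s ^ a * (m.factorial * (1 / (q / s)) ^ m) := by gcongr
    _ = _ := by rw [one_div_div, div_pow, inv_pow]; ring

lemma measurable_besselIntegrand (a q : ℝ) :
    Measurable fun s : ℝ => s ^ a * Real.exp (-s - q / s) := by fun_prop

lemma integrableOn_rpow_mul_exp_neg {a : ℝ} (ha : -1 < a) :
    IntegrableOn (fun s : ℝ => s ^ a * Real.exp (-s)) (Ioi 0) := by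
  have := Real.GammaIntegral_convergent (s := a + 1) (by linarith)
  simpa [mul_comm] using this

lemma integrableOn_besselIntegrand (a : ℝ) {q : ℝ} (hq : 0 < q) :
    IntegrableOn (fun s : ℝ => s ^ a * Real.exp (-s - q / s)) (Ioi 0) := by
  obtain ⟨m, hm⟩ := exists_nat_gt (-1 - a)
  refine ((integrableOn_rpow_mul_exp_neg (a := a + m) (by linarith)).const_mul
    (m.factorial * q⁻¹ ^ m)).mono' (measurable_besselIntegrand a q).aestronglyMeasurable
    ((ae_restrict_mem measurableSet_Ioi).mono fun s hs => ?_)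
  have hs : 0 < s := hs
  rw [Real.norm_of_nonneg (by positivity), sub_eq_add_neg, Real.exp_add]
  have := mul_le_mul_of_nonneg_right (rpow_mul_exp_neg_div_le (a := a) hq hs m)
    (Real.exp_pos (-s)).le
  linarith

lemma besselInt_nonneg (a q : ℝ) : 0 ≤ besselInt a q :=
  setIntegral_nonneg measurableSet_Ioi fun s hs => by
    have hs : 0 < s := hs
    positivity

lemma hasDerivAt_besselInt (a : ℝ) {q : ℝ} (hq : 0 < q) :
    HasDerivAt (besselInt a) (-besselInt (a - 1) q) q := by
  have hd : ∀ s : ℝ, 0 < s → ∀ x : ℝ, HasDerivAt (fun q => s ^ a * Real.exp (-s - q / s))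
      (-(s ^ (a - 1) * Real.exp (-s - x / s))) x := by
    intro s hs x
    have h1 : HasDerivAt (fun q => -s - q / s) (-(1 / s)) x :=
      ((hasDerivAt_id x).div_const s).const_sub (-s)
    refine (h1.exp.const_mul (s ^ a)).congr_deriv ?_
    rw [Real.rpow_sub_one hs.ne']; ring
  have h := hasDerivAt_integral_of_dominated_loc_of_deriv_le (μ := volume.restrict (Ioi (0 : ℝ)))
    (F := fun q s => s ^ a * Real.exp (-s - q / s))
    (F' := fun q s => -(s ^ (a - 1) * Real.exp (-s - q / s)))
    (bound := fun s => s ^ (a - 1) * Real.exp (-s - q / 2 / s)) (x₀ := q)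
    (Ioi_mem_nhds (half_lt_self hq))
    (Eventually.of_forall fun x => (measurable_besselIntegrand a x).aestronglyMeasurable)
    (integrableOn_besselIntegrand a hq)
    (measurable_besselIntegrand (a - 1) q).neg.aestronglyMeasurable
    ((ae_restrict_mem measurableSet_Ioi).mono fun s hs x hx => by
      have hs : 0 < s := hs
      have hx : q / 2 < x := hx
      rw [norm_neg, Real.norm_of_nonneg (by positivity)]
      gcongr)
    (integrableOn_besselIntegrand (a - 1) (half_pos hq))
    ((ae_restrict_mem measurableSet_Ioi).mono fun s hs x _ => hd s hs x)
  have h2 := h.2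
  rw [integral_neg] at h2
  exact h2

lemma integrableOn_rpow_mul_exp_neg_inv {a : ℝ} (ha : a < -1) :
    IntegrableOn (fun u : ℝ => u ^ a * Real.exp (-(1 / u))) (Ioi 0) := by
  have hm : Measurable fun u : ℝ => u ^ a * Real.exp (-(1 / u)) := by fun_prop
  rw [← Ioc_union_Ioi_eq_Ioi (zero_le_one (α := ℝ))]
  refine IntegrableOn.union ?_ ?_
  · obtain ⟨m, hma⟩ := exists_nat_gt (-1 - a)
    have h1 : IntegrableOn (fun u : ℝ => u ^ (a + m)) (Ioc 0 1) :=
      (intervalIntegral.intervalIntegrable_rpow' (a := 0) (b := 1) (by linarith)).1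
    refine (h1.const_mul (m.factorial * (1 : ℝ)⁻¹ ^ m)).mono' hm.aestronglyMeasurable
      ((ae_restrict_mem measurableSet_Ioc).mono fun u hu => ?_)
    have hu0 : 0 < u := hu.1
    rw [Real.norm_of_nonneg (by positivity)]
    exact rpow_mul_exp_neg_div_le one_pos hu0 m
  · refine (integrableOn_Ioi_rpow_of_lt ha one_pos).mono' hm.aestronglyMeasurable
      ((ae_restrict_mem measurableSet_Ioi).mono fun u hu => ?_)
    have hu0 : 0 < u := one_pos.trans hu
    rw [Real.norm_of_nonneg (by positivity)]
    refine mul_le_of_le_one_right (by positivity) (Real.exp_le_one_iff.2 ?_)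
    have : 0 < 1 / u := by positivity
    linarith

lemma integral_comp_mul_Ioi_zero (f : ℝ → ℝ) {q : ℝ} (hq : 0 < q) :
    ∫ s in Ioi (0 : ℝ), f s = q * ∫ u in Ioi (0 : ℝ), f (q * u) := by
  rw [integral_comp_mul_left_Ioi f 0 hq, mul_zero, smul_eq_mul, mul_inv_cancel_left₀ hq.ne']

lemma exists_besselInt_bound {a : ℝ} (ha : a < -1) :
    ∃ D : ℝ, 0 ≤ D ∧ ∀ q, 0 < q → besselInt a q ≤ D * q ^ (a + 1) := by
  refine ⟨∫ u in Ioi (0 : ℝ), u ^ a * Real.exp (-(1 / u)),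
    setIntegral_nonneg measurableSet_Ioi fun u hu => ?_, fun q hq => ?_⟩
  · have hu : 0 < u := hu
    positivity
  rw [besselInt, integral_comp_mul_Ioi_zero _ hq, Real.rpow_add_one hq.ne']
  have hle : ∫ u in Ioi (0 : ℝ), (q * u) ^ a * Real.exp (-(q * u) - q / (q * u))
      ≤ ∫ u in Ioi (0 : ℝ), q ^ a * (u ^ a * Real.exp (-(1 / u))) := by
    have hle : ∀ u ∈ Ioi (0 : ℝ), (q * u) ^ a * Real.exp (-(q * u) - q / (q * u))
        ≤ q ^ a * (u ^ a * Real.exp (-(1 / u))) := by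
      intro u hu
      have hu : 0 < u := hu
      rw [Real.mul_rpow hq.le hu.le, mul_assoc]
      gcongr
      rw [div_mul_eq_div_div, div_self hq.ne']
      have : 0 < q * u := by positivity
      linarith
    have h_int : IntegrableOn (fun u : ℝ => q ^ a * (u ^ a * Real.exp (-(1 / u)))) (Ioi 0) :=
      (integrableOn_rpow_mul_exp_neg_inv ha).const_mul _
    refine setIntegral_mono_on (h_int.mono' (by fun_prop)
      ((ae_restrict_mem measurableSet_Ioi).mono fun u hu => ?_)) h_int measurableSet_Ioi hle
    have hu' : 0 < u := hu
    rw [Real.norm_of_nonneg (by positivity)]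
    exact hle u hu
  rw [integral_const_mul] at hle
  calc _ ≤ q * _ := mul_le_mul_of_nonneg_left hle hq.le
    _ = _ := by ring

/-- Integration by parts. -/
lemma besselInt_recurrence {a q : ℝ} (ha : a ≠ 0) (hq : 0 < q) :
    a * besselInt (a - 1) q - besselInt a q + q * besselInt (a - 2) q = 0 := by
  have hd : ∀ s ∈ Ioi (0 : ℝ), HasDerivAt (fun s => s ^ a * Real.exp (-s - q / s))
      (a * (s ^ (a - 1) * Real.exp (-s - q / s)) - s ^ a * Real.exp (-s - q / s)
        + q * (s ^ (a - 2) * Real.exp (-s - q / s))) s := by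
    intro s hs
    have hs : 0 < s := hs
    have h1 : HasDerivAt (fun s => -s - q / s) (-1 - (-q / s ^ 2)) s := by
      refine ((hasDerivAt_id s).neg.sub ((hasDerivAt_inv hs.ne').const_mul q)).congr_deriv ?_
      ring
    refine ((Real.hasDerivAt_rpow_const (p := a) (Or.inl hs.ne')).mul h1.exp).congr_deriv ?_
    have : s ^ (a - 2) = s ^ a / s ^ 2 := by
      rw [show a - 2 = a - (2 : ℕ) by norm_num, Real.rpow_sub_natCast hs.ne']
    rw [this]; ring
  have hi := integrableOn_besselIntegrand a hq
  have hi1 := (integrableOn_besselIntegrand (a - 1) hq).const_mul a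
  have hi2 := (integrableOn_besselIntegrand (a - 2) hq).const_mul q
  have h := integral_Ioi_of_hasDerivAt_of_tendsto (m := 0) ?_ hd ((hi1.sub hi).add hi2) ?_
  · rw [Real.zero_rpow ha, zero_mul, sub_zero] at h
    have e := integral_add (hi1.sub hi) hi2
    simp only [Pi.sub_apply] at e
    rw [← h, e, integral_sub hi1 hi, integral_const_mul, integral_const_mul]
    rfl
  · rw [ContinuousWithinAt, Real.zero_rpow ha, zero_mul, ← Ioi_insert, nhdsWithin_insert]
    refine tendsto_sup.2 ⟨?_, ?_⟩
    · rw [tendsto_pure_left]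
      intro s hs
      simpa [Real.zero_rpow ha] using mem_of_mem_nhds hs
    obtain ⟨m, hma⟩ := exists_nat_gt (-a)
    have h0 : Tendsto (fun s : ℝ => m.factorial * q⁻¹ ^ m * s ^ (a + m)) (𝓝[>] 0) (𝓝 0) := by
      have : Tendsto (fun s : ℝ => s ^ (a + m)) (𝓝[>] 0) (𝓝 0) := by
        have h2 := (Real.continuousAt_rpow_const (0 : ℝ) (a + m) (Or.inr (by linarith))).tendsto
        rw [Real.zero_rpow (by linarith)] at h2
        exact h2.mono_left nhdsWithin_le_nhds
      simpa using this.const_mul (m.factorial * q⁻¹ ^ m)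
    refine tendsto_of_tendsto_of_tendsto_of_le_of_le' tendsto_const_nhds h0 ?_ ?_
    · filter_upwards [self_mem_nhdsWithin] with s hs
      have hs : 0 < s := hs
      positivity
    · filter_upwards [self_mem_nhdsWithin] with s hs
      have hs : 0 < s := hs
      refine le_trans ?_ (rpow_mul_exp_neg_div_le hq hs m)
      gcongr
      linarith
  · refine tendsto_of_tendsto_of_tendsto_of_le_of_le' tendsto_const_nhds
      (tendsto_rpow_mul_exp_neg_mul_atTop_nhds_zero a 1 one_pos) ?_ ?_
    · filter_upwards [eventually_gt_atTop 0] with s hs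
      positivity
    · filter_upwards [eventually_gt_atTop 0] with s hs
      gcongr
      have : 0 < q / s := by positivity
      linarith

section

variable {b : ℝ}

lemma besselInt_zero (hb0 : 0 < b) : besselInt (b - 1) 0 = Real.Gamma b := by
  rw [Real.Gamma_eq_integral hb0, besselInt]
  refine setIntegral_congr_fun measurableSet_Ioi fun s _ => ?_
  simp [mul_comm]

lemma integrableOn_besselIntegrand_of_nonneg (hb0 : 0 < b) {q : ℝ} (hq : 0 ≤ q) :
    IntegrableOn (fun s : ℝ => s ^ (b - 1) * Real.exp (-s - q / s)) (Ioi 0) := by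
  refine (integrableOn_rpow_mul_exp_neg (a := b - 1) (by linarith)).mono'
    (measurable_besselIntegrand _ _).aestronglyMeasurable
    ((ae_restrict_mem measurableSet_Ioi).mono fun s hs => ?_)
  have hs : 0 < s := hs
  rw [Real.norm_of_nonneg (by positivity)]
  gcongr
  have : 0 ≤ q / s := by positivity
  linarith

lemma continuousOn_besselInt (hb0 : 0 < b) : ContinuousOn (besselInt (b - 1)) (Ici 0) := by
  refine continuousOn_of_dominated (bound := fun s => s ^ (b - 1) * Real.exp (-s))
    (fun q _ => (measurable_besselIntegrand _ _).aestronglyMeasurable)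
    (fun q hq => (ae_restrict_mem measurableSet_Ioi).mono fun s hs => ?_)
    (integrableOn_rpow_mul_exp_neg (by linarith))
    (ae_of_all _ fun s => Continuous.continuousOn (by fun_prop))
  have hs : 0 < s := hs
  have hq : 0 ≤ q := hq
  rw [Real.norm_of_nonneg (by positivity)]
  gcongr
  have : 0 ≤ q / s := by positivity
  linarith

lemma besselInt_le (hb0 : 0 < b) {q : ℝ} (hq : 0 ≤ q) : besselInt (b - 1) q ≤ Real.Gamma b := by
  rw [← besselInt_zero hb0]
  refine setIntegral_mono_on (integrableOn_besselIntegrand_of_nonneg hb0 hq)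
    (integrableOn_besselIntegrand_of_nonneg hb0 le_rfl) measurableSet_Ioi fun s hs => ?_
  have hs : 0 < s := hs
  gcongr

lemma besselInt_le_div (hb0 : 0 < b) {q : ℝ} (hq : 0 < q) :
    besselInt (b - 1) q ≤ Real.Gamma (b + 1) * q⁻¹ := by
  rw [← besselInt_zero (by linarith : 0 < b + 1), mul_comm, besselInt, besselInt,
    ← integral_const_mul]
  refine setIntegral_mono_on (integrableOn_besselIntegrand_of_nonneg hb0 hq.le)
    ((integrableOn_besselIntegrand_of_nonneg (by linarith) le_rfl).const_mul _)
    measurableSet_Ioi fun s hs => ?_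
  have hs : 0 < s := hs
  have h := mul_le_mul_of_nonneg_right (rpow_mul_exp_neg_div_le (a := b - 1) hq hs 1)
    (Real.exp_pos (-s)).le
  rw [sub_eq_add_neg (-s), Real.exp_add, zero_div, sub_zero]
  have e : b - 1 + ((1 : ℕ) : ℝ) = b + 1 - 1 := by push_cast; ring
  rw [e, Nat.factorial_one, Nat.cast_one, one_mul, pow_one] at h
  linarith

lemma integrableOn_rpow_mul_one_sub_exp (hb0 : 0 < b) (hb1 : b < 1) :
    IntegrableOn (fun u : ℝ => u ^ (b - 1) * (1 - Real.exp (-(1 / u)))) (Ioi 0) := by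
  have hm : Measurable fun u : ℝ => u ^ (b - 1) * (1 - Real.exp (-(1 / u))) := by fun_prop
  rw [← Ioc_union_Ioi_eq_Ioi (zero_le_one (α := ℝ))]
  have hnn : ∀ u : ℝ, 0 < u → 0 ≤ 1 - Real.exp (-(1 / u)) := fun u hu => by
    have : 0 < 1 / u := by positivity
    have : Real.exp (-(1 / u)) ≤ 1 := Real.exp_le_one_iff.2 (by linarith)
    linarith
  refine IntegrableOn.union ?_ ?_
  · have h1 : IntegrableOn (fun u : ℝ => u ^ (b - 1)) (Ioc 0 1) :=
      (intervalIntegral.intervalIntegrable_rpow' (a := 0) (b := 1) (by linarith)).1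
    refine h1.mono' hm.aestronglyMeasurable
      ((ae_restrict_mem measurableSet_Ioc).mono fun u hu => ?_)
    have hu0 : 0 < u := hu.1
    rw [Real.norm_of_nonneg (mul_nonneg (by positivity) (hnn u hu0))]
    exact mul_le_of_le_one_right (by positivity) (by linarith [Real.exp_pos (-(1 / u))])
  · refine (integrableOn_Ioi_rpow_of_lt (a := b - 2) (by linarith) one_pos).mono'
      hm.aestronglyMeasurable ((ae_restrict_mem measurableSet_Ioi).mono fun u hu => ?_)
    have hu0 : 0 < u := one_pos.trans hu
    rw [Real.norm_of_nonneg (mul_nonneg (by positivity) (hnn u hu0))]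
    have h2 : 1 - Real.exp (-(1 / u)) ≤ 1 / u := by linarith [Real.one_sub_le_exp_neg (1 / u)]
    calc _ ≤ u ^ (b - 1) * (1 / u) := by gcongr
      _ = u ^ (b - 2) := by
        rw [show b - 2 = b - 1 - 1 by ring, Real.rpow_sub_one hu0.ne' (b - 1)]; ring

lemma Gamma_sub_besselInt (hb0 : 0 < b) {q : ℝ} (hq : 0 < q) :
    Real.Gamma b - besselInt (b - 1) q
      = q ^ b * ∫ u in Ioi (0 : ℝ),
          Real.exp (-(q * u)) * (u ^ (b - 1) * (1 - Real.exp (-(1 / u)))) := by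
  rw [← besselInt_zero hb0, besselInt, besselInt,
    ← integral_sub (integrableOn_besselIntegrand_of_nonneg hb0 le_rfl)
      (integrableOn_besselIntegrand_of_nonneg hb0 hq.le),
    integral_comp_mul_Ioi_zero _ hq, ← integral_const_mul, ← integral_const_mul]
  refine setIntegral_congr_fun measurableSet_Ioi fun u hu => ?_
  have hu : 0 < u := hu
  have e : q ^ b = q ^ (b - 1) * q := by rw [← Real.rpow_add_one hq.ne']; congr 1; ring
  rw [Real.mul_rpow hq.le hu.le, div_mul_eq_div_div q q u, div_self hq.ne', e, zero_div, sub_zero,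
    sub_eq_add_neg (-(q * u)), Real.exp_add]
  ring

lemma tendsto_Gamma_sub_besselInt (hb0 : 0 < b) (hb1 : b < 1) :
    Tendsto (fun q => ∫ u in Ioi (0 : ℝ),
        Real.exp (-(q * u)) * (u ^ (b - 1) * (1 - Real.exp (-(1 / u)))))
      (𝓝[>] 0) (𝓝 (∫ u in Ioi (0 : ℝ), u ^ (b - 1) * (1 - Real.exp (-(1 / u))))) := by
  refine tendsto_integral_filter_of_dominated_convergence
    (fun u => |u ^ (b - 1) * (1 - Real.exp (-(1 / u)))|)
    (Eventually.of_forall fun q => (by fun_prop : Measurable _).aestronglyMeasurable) ?_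
    (integrableOn_rpow_mul_one_sub_exp hb0 hb1).abs (ae_of_all _ fun u => ?_)
  · filter_upwards [self_mem_nhdsWithin] with q hq
    have hq : 0 < q := hq
    refine (ae_restrict_mem measurableSet_Ioi).mono fun u hu => ?_
    have hu : 0 < u := hu
    rw [norm_mul, Real.norm_of_nonneg (Real.exp_pos _).le, Real.norm_eq_abs]
    refine mul_le_of_le_one_left (abs_nonneg _) (Real.exp_le_one_iff.2 ?_)
    have : 0 < q * u := by positivity
    linarith
  · have : Continuous fun q : ℝ =>
        Real.exp (-(q * u)) * (u ^ (b - 1) * (1 - Real.exp (-(1 / u)))) := by fun_prop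
    have := (this.tendsto 0).mono_left (nhdsWithin_le_nhds (s := Ioi 0))
    simpa using this

lemma integral_rpow_mul_one_sub_exp_pos (hb0 : 0 < b) (hb1 : b < 1) :
    0 < ∫ u in Ioi (0 : ℝ), u ^ (b - 1) * (1 - Real.exp (-(1 / u))) := by
  have hpos : ∀ u ∈ Ioi (0 : ℝ), 0 < u ^ (b - 1) * (1 - Real.exp (-(1 / u))) := fun u hu => by
    have hu : 0 < u := hu
    have : 0 < 1 / u := by positivity
    have : Real.exp (-(1 / u)) < 1 := Real.exp_lt_one_iff.2 (by linarith)
    have : 0 < 1 - Real.exp (-(1 / u)) := by linarith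
    positivity
  rw [setIntegral_pos_iff_support_of_nonneg_ae
    ((ae_restrict_mem measurableSet_Ioi).mono fun u hu => (hpos u hu).le)
    (integrableOn_rpow_mul_one_sub_exp hb0 hb1)]
  have : Function.support (fun u : ℝ => u ^ (b - 1) * (1 - Real.exp (-(1 / u)))) ∩ Ioi 0 = Ioi 0 :=
    inter_eq_right.2 fun u hu => (hpos u hu).ne'
  rw [this, Real.volume_Ioi]
  exact ENNReal.zero_lt_top

lemma Gamma_sub_besselInt_le (hb0 : 0 < b) (hb1 : b < 1) {q : ℝ} (hq : 0 < q) :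
    Real.Gamma b - besselInt (b - 1) q
      ≤ (∫ u in Ioi (0 : ℝ), u ^ (b - 1) * (1 - Real.exp (-(1 / u)))) * q ^ b := by
  rw [Gamma_sub_besselInt hb0 hq, mul_comm]
  refine mul_le_mul_of_nonneg_right ?_ (by positivity)
  have hi := integrableOn_rpow_mul_one_sub_exp hb0 hb1
  have hle : ∀ u ∈ Ioi (0 : ℝ), Real.exp (-(q * u)) * (u ^ (b - 1) * (1 - Real.exp (-(1 / u))))
      ≤ u ^ (b - 1) * (1 - Real.exp (-(1 / u))) := fun u hu => by
    have hu : 0 < u := hu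
    have : 0 < 1 / u := by positivity
    have : Real.exp (-(1 / u)) ≤ 1 := Real.exp_le_one_iff.2 (by linarith)
    have : 0 ≤ 1 - Real.exp (-(1 / u)) := by linarith
    refine mul_le_of_le_one_left (by positivity) (Real.exp_le_one_iff.2 ?_)
    have : 0 < q * u := by positivity
    linarith
  refine setIntegral_mono_on (hi.mono' (by fun_prop : Measurable _).aestronglyMeasurable
    ((ae_restrict_mem measurableSet_Ioi).mono fun u hu => ?_)) hi measurableSet_Ioi hle
  have hu' : 0 < u := hu
  have : 0 < 1 / u := by positivity
  have : Real.exp (-(1 / u)) ≤ 1 := Real.exp_le_one_iff.2 (by linarith)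
  have : 0 ≤ 1 - Real.exp (-(1 / u)) := by linarith
  rw [Real.norm_of_nonneg (by positivity)]
  exact hle u hu

end

/-- A decaying solution of `x φ'' - α φ' = x φ` with `φ 0 = 1`. -/
structure IsDecayingProfile (α D c : ℝ) (φ φ₁ φ₂ φ₃ : ℝ → ℝ) : Prop where
  power : PowerType α D φ φ₁ φ₂ φ₃
  pos_const : 0 < c
  zero : φ 0 = 1
  nonneg : ∀ x, 0 ≤ x → 0 ≤ φ x
  le_one : ∀ x, 0 ≤ x → φ x ≤ 1
  ode : ∀ x, 0 < x → x * φ₂ x - α * φ₁ x = x * φ x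
  decay : ∀ x, 0 < x → φ x ≤ D * x⁻¹ ^ 2
  one_sub_le : ∀ x, 0 ≤ x → 1 - φ x ≤ D * x ^ (1 + α)
  tendsto : Tendsto (fun x => (1 - φ x) / x ^ (1 + α)) (𝓝[>] 0) (𝓝 c)

lemma exists_besselInt_sq_bound {a : ℝ} (ha : a < -1) :
    ∃ D : ℝ, 0 ≤ D ∧ ∀ x, 0 < x → besselInt a (x ^ 2 / 4) ≤ D * x ^ (2 * a + 2) := by
  obtain ⟨D, hD0, hD⟩ := exists_besselInt_bound ha
  refine ⟨D * (1 / 4 : ℝ) ^ (a + 1), by positivity, fun x hx => ?_⟩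
  refine (hD _ (by positivity)).trans (le_of_eq ?_)
  rw [show x ^ 2 / 4 = (1 / 4) * x ^ 2 by ring, Real.mul_rpow (by norm_num) (by positivity),
    ← Real.rpow_natCast_mul hx.le]
  rw [show ((2 : ℕ) : ℝ) * (a + 1) = 2 * a + 2 by push_cast; ring]
  ring

lemma exists_isDecayingProfile {α : ℝ} (hα0 : 0 < α) (hα1 : α < 1) :
    ∃ (D c : ℝ) (φ φ₁ φ₂ φ₃ : ℝ → ℝ), IsDecayingProfile α D c φ φ₁ φ₂ φ₃ := by
  obtain ⟨b, hb⟩ : ∃ b, b = (1 + α) / 2 := ⟨_, rfl⟩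
  have hb0 : 0 < b := by linarith
  have hb1 : b < 1 := by linarith
  obtain ⟨D₂, hD₂0, hD₂⟩ := exists_besselInt_sq_bound (a := b - 1 - 1) (by linarith)
  obtain ⟨D₃, hD₃0, hD₃⟩ := exists_besselInt_sq_bound (a := b - 1 - 1 - 1) (by linarith)
  obtain ⟨D₄, hD₄0, hD₄⟩ := exists_besselInt_sq_bound (a := b - 1 - 1 - 1 - 1) (by linarith)
  set G := Real.Gamma b with hG
  have hG0 : 0 < G := Real.Gamma_pos_of_pos hb0
  have hG1 : 0 < Real.Gamma (b + 1) := Real.Gamma_pos_of_pos (by linarith)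
  set I := ∫ u in Ioi (0 : ℝ), u ^ (b - 1) * (1 - Real.exp (-(1 / u))) with hI
  have hI0 : 0 < I := integral_rpow_mul_one_sub_exp_pos hb0 hb1
  set E := D₂ + D₃ + D₄ + 4 * Real.Gamma (b + 1) + I with hE
  have hder : ∀ (a x : ℝ), 0 < x → HasDerivAt (fun x => besselInt a (x ^ 2 / 4))
      (-(x / 2) * besselInt (a - 1) (x ^ 2 / 4)) x := by
    intro a x hx
    have h1 : HasDerivAt (fun x : ℝ => x ^ 2 / 4) (x / 2) x := by
      refine ((hasDerivAt_pow 2 x).div_const 4).congr_deriv ?_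
      push_cast; ring
    refine ((hasDerivAt_besselInt a (by positivity : 0 < x ^ 2 / 4)).comp x h1).congr_deriv ?_
    ring
  have e₂ : ∀ x : ℝ, 0 < x → x * x ^ (2 * (b - 1 - 1) + 2) = x ^ α := fun x hx => by
    rw [mul_comm, ← Real.rpow_add_one hx.ne']; congr 1; rw [hb]; ring
  have e₂' : ∀ x : ℝ, x ^ (2 * (b - 1 - 1) + 2) = x ^ (α - 1) := fun x => by
    congr 1; rw [hb]; ring
  have e₃ : ∀ x : ℝ, 0 < x → x ^ 2 * x ^ (2 * (b - 1 - 1 - 1) + 2) = x ^ (α - 1) := fun x hx => by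
    rw [mul_comm, ← Real.rpow_add_natCast hx.ne']; congr 1; rw [hb]; push_cast; ring
  have e₃' : ∀ x : ℝ, 0 < x → x * x ^ (2 * (b - 1 - 1 - 1) + 2) = x ^ (α - 2) := fun x hx => by
    rw [mul_comm, ← Real.rpow_add_one hx.ne']; congr 1; rw [hb]; ring
  have e₄ : ∀ x : ℝ, 0 < x → x ^ 3 * x ^ (2 * (b - 1 - 1 - 1 - 1) + 2) = x ^ (α - 2) :=
    fun x hx => by
      rw [mul_comm, ← Real.rpow_add_natCast hx.ne']; congr 1; rw [hb]; push_cast; ring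
  have eq : ∀ x : ℝ, 0 ≤ x → (x ^ 2 / 4) ^ b = (1 / 4 : ℝ) ^ b * x ^ (1 + α) := fun x hx => by
    rw [show x ^ 2 / 4 = (1 / 4) * x ^ 2 by ring, Real.mul_rpow (by norm_num) (by positivity),
      ← Real.rpow_natCast_mul hx]
    congr 2; rw [hb]; push_cast; ring
  have hquarter : (1 / 4 : ℝ) ^ b ≤ 1 := Real.rpow_le_one (by norm_num) (by norm_num) hb0.le
  have hnn := besselInt_nonneg
  refine ⟨E / G, (1 / 4 : ℝ) ^ b * I / G, fun x => besselInt (b - 1) (x ^ 2 / 4) / G,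
    fun x => -(x / 2) * besselInt (b - 1 - 1) (x ^ 2 / 4) / G,
    fun x => (-(1 / 2) * besselInt (b - 1 - 1) (x ^ 2 / 4)
      + x ^ 2 / 4 * besselInt (b - 1 - 1 - 1) (x ^ 2 / 4)) / G,
    fun x => (3 * x / 4 * besselInt (b - 1 - 1 - 1) (x ^ 2 / 4)
      - x ^ 3 / 8 * besselInt (b - 1 - 1 - 1 - 1) (x ^ 2 / 4)) / G, ?_⟩
  refine ⟨⟨?_, ?_, ?_, ?_, ?_, ?_, ?_⟩, ?_, ?_, ?_, ?_, ?_, ?_, ?_, ?_⟩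
  · refine ContinuousOn.div_const ?_ G
    exact (continuousOn_besselInt hb0).comp (by fun_prop) fun x _ => by
      rw [mem_Ici]; positivity
  · exact fun x hx => (hder _ x hx).div_const G
  · intro x hx
    refine ((((hasDerivAt_id x).div_const 2).neg.mul (hder _ x hx)).div_const G).congr_deriv ?_
    simp only [Pi.neg_apply, id]
    ring
  · intro x hx
    refine ((((hder (b - 1 - 1) x hx).const_mul (-(1 / 2))).add
      (((hasDerivAt_pow 2 x).div_const 4).mul (hder (b - 1 - 1 - 1) x hx))).div_const G).congr_deriv
      ?_
    push_cast
    ring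
  · intro x hx
    have h2 := mul_le_mul_of_nonneg_left (hD₂ x hx) hx.le
    have h2' := mul_nonneg hx.le (hnn (b - 1 - 1) (x ^ 2 / 4))
    have hp : 0 ≤ x ^ α := by positivity
    rw [← mul_assoc, mul_comm x D₂, mul_assoc, e₂ x hx] at h2
    rw [abs_div, abs_of_pos hG0, div_mul_eq_mul_div]
    gcongr
    rw [abs_le]
    constructor <;> nlinarith [mul_nonneg hD₂0 hp, mul_nonneg hD₃0 hp, mul_nonneg hD₄0 hp,
      mul_nonneg hG1.le hp, mul_nonneg hI0.le hp]
  · intro x hx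
    have h2 := hD₂ x hx
    have h2' := hnn (b - 1 - 1) (x ^ 2 / 4)
    have h3 := mul_le_mul_of_nonneg_left (hD₃ x hx) (by positivity : 0 ≤ x ^ 2)
    have h3' := mul_nonneg (by positivity : 0 ≤ x ^ 2) (hnn (b - 1 - 1 - 1) (x ^ 2 / 4))
    have hp : 0 ≤ x ^ (α - 1) := by positivity
    rw [e₂' x] at h2
    rw [← mul_assoc, mul_comm (x ^ 2) D₃, mul_assoc, e₃ x hx] at h3
    rw [abs_div, abs_of_pos hG0, div_mul_eq_mul_div E]
    refine div_le_div_of_nonneg_right ?_ hG0.le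
    rw [abs_le]
    constructor <;> nlinarith [mul_nonneg hD₂0 hp, mul_nonneg hD₃0 hp, mul_nonneg hD₄0 hp,
      mul_nonneg hG1.le hp, mul_nonneg hI0.le hp]
  · intro x hx
    have h3 := mul_le_mul_of_nonneg_left (hD₃ x hx) hx.le
    have h3' := mul_nonneg hx.le (hnn (b - 1 - 1 - 1) (x ^ 2 / 4))
    have h4 := mul_le_mul_of_nonneg_left (hD₄ x hx) (by positivity : 0 ≤ x ^ 3)
    have h4' := mul_nonneg (by positivity : 0 ≤ x ^ 3) (hnn (b - 1 - 1 - 1 - 1) (x ^ 2 / 4))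
    have hp : 0 ≤ x ^ (α - 2) := by positivity
    rw [← mul_assoc, mul_comm x D₃, mul_assoc, e₃' x hx] at h3
    rw [← mul_assoc, mul_comm (x ^ 3) D₄, mul_assoc, e₄ x hx] at h4
    rw [abs_div, abs_of_pos hG0, div_mul_eq_mul_div E]
    refine div_le_div_of_nonneg_right ?_ hG0.le
    rw [abs_le]
    constructor <;> nlinarith [mul_nonneg hD₂0 hp, mul_nonneg hD₃0 hp, mul_nonneg hD₄0 hp,
      mul_nonneg hG1.le hp, mul_nonneg hI0.le hp]
  · positivity
  · simp [besselInt_zero hb0, ← hG, hG0.ne']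
  · exact fun x _ => div_nonneg (hnn _ _) hG0.le
  · exact fun x _ => (div_le_one hG0).2 (besselInt_le hb0 (by positivity))
  · intro x hx
    have h := besselInt_recurrence (a := b - 1) (q := x ^ 2 / 4) (by linarith) (by positivity)
    rw [show b - 1 - 2 = b - 1 - 1 - 1 by ring] at h
    rw [mul_div_assoc', mul_div_assoc', mul_div_assoc', ← sub_div]
    congr 1
    rw [hb] at h ⊢
    linear_combination x * h
  · intro x hx
    have h := besselInt_le_div hb0 (by positivity : 0 < x ^ 2 / 4)
    rw [div_mul_eq_mul_div]
    gcongr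
    have e : (x ^ 2 / 4)⁻¹ = 4 * x⁻¹ ^ 2 := by rw [inv_div, inv_pow]; ring
    rw [e] at h
    have hp : 0 ≤ x⁻¹ ^ 2 := by positivity
    nlinarith [mul_nonneg hD₂0 hp, mul_nonneg hD₃0 hp, mul_nonneg hD₄0 hp, mul_nonneg hI0.le hp]
  · intro x hx
    rcases hx.eq_or_lt with rfl | hx
    · simp [besselInt_zero hb0, ← hG, hG0.ne', Real.zero_rpow (by linarith : 1 + α ≠ 0)]
    have h := Gamma_sub_besselInt_le hb0 hb1 (by positivity : 0 < x ^ 2 / 4)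
    rw [← hG, ← hI, eq x hx.le] at h
    rw [div_mul_eq_mul_div, one_sub_div hG0.ne']
    gcongr
    have hp : 0 ≤ x ^ (1 + α) := by positivity
    have h5 := mul_le_mul_of_nonneg_right hquarter hp
    have h6 := mul_le_mul_of_nonneg_left h5 hI0.le
    nlinarith [mul_nonneg hD₂0 hp, mul_nonneg hD₃0 hp, mul_nonneg hD₄0 hp, mul_nonneg hG1.le hp]
  · have hq : Tendsto (fun x : ℝ => x ^ 2 / 4) (𝓝[>] 0) (𝓝[>] 0) := by
      refine tendsto_nhdsWithin_iff.2 ⟨?_, ?_⟩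
      · have : Continuous fun x : ℝ => x ^ 2 / 4 := by fun_prop
        have := (this.tendsto 0).mono_left (nhdsWithin_le_nhds (s := Ioi 0))
        simpa using this
      · filter_upwards [self_mem_nhdsWithin] with x hx
        have hx : 0 < x := hx
        rw [mem_Ioi]; positivity
    have h := ((tendsto_Gamma_sub_besselInt hb0 hb1).comp hq).const_mul ((1 / 4 : ℝ) ^ b / G)
    rw [div_mul_eq_mul_div] at h
    refine h.congr' ?_
    filter_upwards [self_mem_nhdsWithin] with x hx
    have hx : 0 < x := hx
    have h1 := Gamma_sub_besselInt hb0 (by positivity : 0 < x ^ 2 / 4)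
    rw [eq x hx.le, ← hG] at h1
    have hp : 0 < x ^ (1 + α) := by positivity
    simp only [Function.comp]
    rw [one_sub_div hG0.ne', h1]
    field_simp

lemma one_sub_one_add_mul_exp_neg_nonneg (y : ℝ) : 0 ≤ 1 - (1 + y) * Real.exp (-y) := by
  have h := mul_le_mul_of_nonneg_right (Real.add_one_le_exp y) (Real.exp_pos (-y)).le
  rw [← Real.exp_add, add_neg_cancel, Real.exp_zero] at h
  linarith

lemma one_sub_one_add_mul_exp_neg_le {y : ℝ} (hy : 0 < y) :
    1 - (1 + y) * Real.exp (-y) ≤ y ^ (3 / 2 : ℝ) := by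
  rcases le_or_gt y 1 with h1 | h1
  · have h := Real.one_sub_le_exp_neg y
    have h2 : y ^ (2 : ℝ) ≤ y ^ (3 / 2 : ℝ) :=
      Real.rpow_le_rpow_of_exponent_ge hy h1 (by norm_num)
    rw [Real.rpow_two] at h2
    nlinarith
  · have h2 : 1 ≤ y ^ (3 / 2 : ℝ) := Real.one_le_rpow h1.le (by norm_num)
    have : 0 ≤ (1 + y) * Real.exp (-y) := by positivity
    linarith

namespace IsDecayingProfile

variable {α D c : ℝ} {φ φ₁ φ₂ φ₃ : ℝ → ℝ}

lemma le_rpow (hφ : IsDecayingProfile α D c φ φ₁ φ₂ φ₃) (hα0 : 0 < α) (hα1 : α < 1) {x : ℝ}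
    (hx : 0 < x) : φ x ≤ (1 + D) * x ^ (α - 2) := by
  have hD := hφ.power.const_nonneg
  have hp : 0 ≤ x ^ (α - 2) := by positivity
  rcases le_or_gt x 1 with h1 | h1
  · have : 1 ≤ x ^ (α - 2) := Real.one_le_rpow_of_pos_of_le_one_of_nonpos hx h1 (by linarith)
    nlinarith [hφ.le_one x hx.le, mul_nonneg hD hp]
  · have h2 : x ^ (-2 : ℝ) ≤ x ^ (α - 2) := Real.rpow_le_rpow_of_exponent_le h1.le (by linarith)
    rw [Real.rpow_neg hx.le, Real.rpow_two, ← inv_pow] at h2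
    nlinarith [hφ.decay x hx, mul_le_mul_of_nonneg_left h2 hD]

end IsDecayingProfile

/-- The rescaled defect of the approximate eigenfunction `φ (s j)`. -/
def profileDefect (κ : ℕ → Measure ℕ) (α : ℝ) (φ : ℝ → ℝ) (s : ℝ) (j : ℕ) : ℝ :=
  (s ^ (1 + α))⁻¹ * (φ (s * j) - killOp κ (s ^ 2) (fun k => φ (s * k)) j)

namespace MigrationKernel

variable {α C : ℝ} {J : ℕ} {κ : ℕ → Measure ℕ} {D c : ℝ} {φ φ₁ φ₂ φ₃ : ℝ → ℝ}

lemma abs_profile_le_one (hφ : IsDecayingProfile α D c φ φ₁ φ₂ φ₃) {s : ℝ} (hs : 0 ≤ s) (j : ℕ) :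
    |φ (s * j)| ≤ 1 := by
  rw [abs_of_nonneg (hφ.nonneg _ (by positivity))]
  exact hφ.le_one _ (by positivity)

lemma exists_profileDefect_bound_large (h : MigrationKernel α C J κ) (hα0 : 0 < α) (hα1 : α < 1)
    (hφ : IsDecayingProfile α D c φ φ₁ φ₂ φ₃) :
    ∃ A : ℝ, 0 ≤ A ∧ ∀ s, 0 < s → ∀ j : ℕ, J ≤ j → 1 ≤ j →
      |profileDefect κ α φ s j| ≤ A * (j : ℝ) ^ (α - 1 / 2) := by
  obtain ⟨K, hK0, hK⟩ := h.exists_generator_bound hφ.power hα0.le hα1.le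
  have hD := hφ.power.const_nonneg
  refine ⟨1 + D + K, by positivity, fun s hs j hJ hj1 => ?_⟩
  have hj0 : (0 : ℝ) < j := by exact_mod_cast hj1
  have hx : 0 < s * j := by positivity
  have hy : 0 < s ^ 2 * j := by positivity
  have hp : 0 < s ^ (1 + α) := by positivity
  have h1 := hK s hs j hJ hj1
  have hode := hφ.ode _ hx
  have e1 : φ (s * j) - α * (s * φ₁ (s * j)) + s ^ 2 * j * φ₂ (s * j)
      = φ (s * j) * (1 + s ^ 2 * j) := by
    linear_combination s * hode
  rw [e1] at h1
  set R := ∫ k : ℕ, φ (s * k) ∂κ j - φ (s * j) * (1 + s ^ 2 * j) with hR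
  have e2 : φ (s * j) - killOp κ (s ^ 2) (fun k => φ (s * k)) j
      = φ (s * j) * (1 - (1 + s ^ 2 * j) * Real.exp (-(s ^ 2 * j)))
        - Real.exp (-(s ^ 2 * j)) * R := by
    rw [killOp, hR, neg_mul]; ring
  have e3 : (s * j) ^ (α - 2) * (s ^ 2 * j) ^ (3 / 2 : ℝ)
      = s ^ (1 + α) * (j : ℝ) ^ (α - 1 / 2) := by
    have t1 : (s ^ 2) ^ (3 / 2 : ℝ) = s ^ (3 : ℝ) := by
      rw [← Real.rpow_natCast_mul hs.le]; norm_num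
    rw [Real.mul_rpow hs.le hj0.le, Real.mul_rpow (by positivity) hj0.le, t1,
      show 1 + α = α - 2 + 3 by ring, Real.rpow_add hs,
      show α - 1 / 2 = α - 2 + 3 / 2 by ring, Real.rpow_add hj0]
    ring
  have h2 : |φ (s * j) * (1 - (1 + s ^ 2 * j) * Real.exp (-(s ^ 2 * j)))|
      ≤ (1 + D) * (s ^ (1 + α) * (j : ℝ) ^ (α - 1 / 2)) := by
    rw [abs_of_nonneg (mul_nonneg (hφ.nonneg _ hx.le) (one_sub_one_add_mul_exp_neg_nonneg _)),
      ← e3, ← mul_assoc]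
    exact mul_le_mul (hφ.le_rpow hα0 hα1 hx) (one_sub_one_add_mul_exp_neg_le hy)
      (one_sub_one_add_mul_exp_neg_nonneg _) (by positivity)
  have h3 : |Real.exp (-(s ^ 2 * j)) * R| ≤ K * s ^ (1 + α) * (j : ℝ) ^ (α - 1 / 2) := by
    rw [abs_mul, abs_of_pos (Real.exp_pos _)]
    refine (mul_le_of_le_one_left (abs_nonneg _) (Real.exp_le_one_iff.2 (by linarith))).trans h1
  rw [profileDefect, e2, abs_mul, abs_of_pos (inv_pos.2 hp), inv_mul_le_iff₀ hp]
  refine (abs_sub _ _).trans ?_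
  linarith

lemma integrable_profile (h : MigrationKernel α C J κ) (hφ : IsDecayingProfile α D c φ φ₁ φ₂ φ₃)
    {s : ℝ} (hs : 0 ≤ s) (j : ℕ) : Integrable (fun k : ℕ => φ (s * k)) (κ j) :=
  h.integrable (QuadGrowth.of_bounded (abs_profile_le_one hφ hs)) j

lemma profileDefect_eq (h : MigrationKernel α C J κ) (hφ : IsDecayingProfile α D c φ φ₁ φ₂ φ₃)
    {s : ℝ} (hs : 0 < s) (j : ℕ) :
    profileDefect κ α φ s j = -((1 - φ (s * j)) / s ^ (1 + α))
      + (1 - Real.exp (-(s ^ 2 * j))) / s ^ (1 + α)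
      + Real.exp (-(s ^ 2 * j)) * ∫ k : ℕ, (1 - φ (s * k)) / s ^ (1 + α) ∂κ j := by
  have hp : 0 < s ^ (1 + α) := by positivity
  have := h.prob j
  rw [integral_div, integral_sub (integrable_const _) (h.integrable_profile hφ hs.le j),
    profileDefect, killOp, neg_mul]
  simp only [integral_const, probReal_univ, smul_eq_mul, mul_one]
  field_simp
  ring

lemma one_sub_profile_div_le (hφ : IsDecayingProfile α D c φ φ₁ φ₂ φ₃) {s : ℝ} (hs : 0 < s)
    (j : ℕ) : (1 - φ (s * j)) / s ^ (1 + α) ≤ D * (j : ℝ) ^ (1 + α) := by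
  have hp : 0 < s ^ (1 + α) := by positivity
  rw [div_le_iff₀ hp]
  refine (hφ.one_sub_le _ (by positivity)).trans (le_of_eq ?_)
  rw [Real.mul_rpow hs.le (by positivity)]; ring

lemma one_sub_profile_div_nonneg (hφ : IsDecayingProfile α D c φ φ₁ φ₂ φ₃) {s : ℝ} (hs : 0 < s)
    (j : ℕ) : 0 ≤ (1 - φ (s * j)) / s ^ (1 + α) :=
  div_nonneg (sub_nonneg.2 (hφ.le_one _ (by positivity))) (by positivity)

lemma one_sub_exp_div_le {s : ℝ} (hs : 0 < s) (j : ℕ) :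
    (1 - Real.exp (-(s ^ 2 * j))) / s ^ (1 + α) ≤ s ^ (1 - α) * j := by
  have hp : 0 < s ^ (1 + α) := by positivity
  have h1 := Real.one_sub_le_exp_neg (s ^ 2 * j)
  have e : s ^ 2 = s ^ (1 - α) * s ^ (1 + α) := by
    rw [← Real.rpow_add hs]; norm_num
  rw [div_le_iff₀ hp]
  have : s ^ 2 * j = s ^ (1 - α) * j * s ^ (1 + α) := by rw [e]; ring
  linarith

lemma one_sub_exp_div_nonneg {s : ℝ} (hs : 0 < s) (j : ℕ) :
    0 ≤ (1 - Real.exp (-(s ^ 2 * j))) / s ^ (1 + α) := by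
  have : 0 ≤ s ^ 2 * j := by positivity
  have : Real.exp (-(s ^ 2 * j)) ≤ 1 := Real.exp_le_one_iff.2 (by linarith)
  exact div_nonneg (by linarith) (by positivity)

lemma abs_profileDefect_le (h : MigrationKernel α C J κ) (hα0 : 0 < α) (hα1 : α < 1)
    (hφ : IsDecayingProfile α D c φ φ₁ φ₂ φ₃) {s : ℝ} (hs : 0 < s) (hs1 : s ≤ 1) (j : ℕ) :
    |profileDefect κ α φ s j|
      ≤ D * (j : ℝ) ^ (1 + α) + j + ∫ k : ℕ, D * (k : ℝ) ^ (1 + α) ∂κ j := by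
  rw [h.profileDefect_eq hφ hs]
  have h1 := one_sub_profile_div_le hφ hs j
  have h1' := one_sub_profile_div_nonneg hφ hs j
  have h2 : (1 - Real.exp (-(s ^ 2 * j))) / s ^ (1 + α) ≤ j :=
    (one_sub_exp_div_le hs j).trans
      (mul_le_of_le_one_left (by positivity) (Real.rpow_le_one hs.le hs1 (by linarith)))
  have h2' := one_sub_exp_div_nonneg (α := α) hs j
  have hpow : Integrable (fun k : ℕ => D * (k : ℝ) ^ (1 + α)) (κ j) :=
    h.integrable ((QuadGrowth.rpow (by linarith) (by linarith)).const_mul D) j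
  have h3' : 0 ≤ ∫ k : ℕ, (1 - φ (s * k)) / s ^ (1 + α) ∂κ j :=
    integral_nonneg fun k => one_sub_profile_div_nonneg hφ hs k
  have h3 : ∫ k : ℕ, (1 - φ (s * k)) / s ^ (1 + α) ∂κ j ≤ ∫ k : ℕ, D * (k : ℝ) ^ (1 + α) ∂κ j :=
    integral_mono_of_nonneg (ae_of_all _ fun k => one_sub_profile_div_nonneg hφ hs k) hpow
      (ae_of_all _ fun k => one_sub_profile_div_le hφ hs k)
  have h4 : Real.exp (-(s ^ 2 * j)) ≤ 1 := by
    have : 0 ≤ s ^ 2 * j := by positivity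
    exact Real.exp_le_one_iff.2 (by linarith)
  have h5 := mul_le_of_le_one_left h3' h4
  have h5' := mul_nonneg (Real.exp_pos (-(s ^ 2 * j))).le h3'
  rw [abs_le]
  constructor <;> linarith

lemma exists_profileDefect_bound (h : MigrationKernel α C J κ) (hα0 : 0 < α) (hα1 : α < 1)
    (hφ : IsDecayingProfile α D c φ φ₁ φ₂ φ₃) :
    ∃ A : ℝ, 0 ≤ A ∧ ∀ s, 0 < s → s ≤ 1 → ∀ j : ℕ,
      |profileDefect κ α φ s j| ≤ A * (1 + (j : ℝ) ^ max (α - 1 / 2) 0) := by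
  obtain ⟨A, hA0, hA⟩ := h.exists_profileDefect_bound_large hα0 hα1 hφ
  set b : ℕ → ℝ := fun j => D * (j : ℝ) ^ (1 + α) + j + ∫ k : ℕ, D * (k : ℝ) ^ (1 + α) ∂κ j
    with hb
  have hD := hφ.power.const_nonneg
  have hb0 : ∀ j, 0 ≤ b j := fun j => (abs_nonneg _).trans
    (h.abs_profileDefect_le hα0 hα1 hφ one_pos le_rfl j)
  refine ⟨A + ∑ j ∈ Finset.range (J + 1), b j,
    add_nonneg hA0 (Finset.sum_nonneg fun j _ => hb0 j), fun s hs hs1 j => ?_⟩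
  have hp : 0 ≤ (j : ℝ) ^ max (α - 1 / 2) 0 := by positivity
  have hB : 0 ≤ ∑ j ∈ Finset.range (J + 1), b j := Finset.sum_nonneg fun j _ => hb0 j
  rcases lt_or_ge j (J + 1) with hj | hj
  · have h1 := h.abs_profileDefect_le hα0 hα1 hφ hs hs1 j
    have h2 := Finset.single_le_sum (f := b) (fun j _ => hb0 j) (Finset.mem_range.2 hj)
    have h3 : |profileDefect κ α φ s j| ≤ ∑ j ∈ Finset.range (J + 1), b j := h1.trans h2
    nlinarith [mul_nonneg hA0 hp, mul_nonneg hB hp]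
  · have h1 := hA s hs j (by omega) (by omega)
    have h2 : (j : ℝ) ^ (α - 1 / 2) ≤ (j : ℝ) ^ max (α - 1 / 2) 0 :=
      Real.rpow_le_rpow_of_exponent_le (by exact_mod_cast (by omega : 1 ≤ j)) (le_max_left _ _)
    nlinarith [mul_le_mul_of_nonneg_left h2 hA0, mul_nonneg hB hp]

lemma tendsto_one_sub_profile_div (hα0 : 0 < α) (hφ : IsDecayingProfile α D c φ φ₁ φ₂ φ₃)
    (j : ℕ) : Tendsto (fun s => (1 - φ (s * j)) / s ^ (1 + α)) (𝓝[>] 0)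
      (𝓝 (c * (j : ℝ) ^ (1 + α))) := by
  rcases Nat.eq_zero_or_pos j with rfl | hj
  · simp [hφ.zero, Real.zero_rpow (by linarith : 1 + α ≠ 0)]
  have hj0 : (0 : ℝ) < j := by exact_mod_cast hj
  have hq : Tendsto (fun s : ℝ => s * j) (𝓝[>] 0) (𝓝[>] 0) := by
    refine tendsto_nhdsWithin_iff.2 ⟨?_, ?_⟩
    · have : Continuous fun x : ℝ => x * j := by fun_prop
      have := (this.tendsto 0).mono_left (nhdsWithin_le_nhds (s := Ioi 0))
      simpa using this
    · filter_upwards [self_mem_nhdsWithin] with x hx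
      exact mul_pos hx hj0
  refine ((hφ.tendsto.comp hq).mul_const ((j : ℝ) ^ (1 + α))).congr' ?_
  filter_upwards [self_mem_nhdsWithin] with s hs
  have hs : 0 < s := hs
  simp only [Function.comp]
  rw [Real.mul_rpow hs.le hj0.le]
  field_simp

lemma tendsto_profileDefect (h : MigrationKernel α C J κ) (hα0 : 0 < α) (hα1 : α < 1)
    (hφ : IsDecayingProfile α D c φ φ₁ φ₂ φ₃) (j : ℕ) :
    Tendsto (fun s => profileDefect κ α φ s j) (𝓝[>] 0) (𝓝 (c * harmonicDefect κ α j)) := by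
  have h1 := tendsto_one_sub_profile_div hα0 hφ j
  have h2 : Tendsto (fun s : ℝ => (1 - Real.exp (-(s ^ 2 * j))) / s ^ (1 + α)) (𝓝[>] 0) (𝓝 0) := by
    have h3 : Tendsto (fun s : ℝ => s ^ (1 - α) * j) (𝓝[>] 0) (𝓝 0) := by
      have := (Real.continuousAt_rpow_const (0 : ℝ) (1 - α)
        (Or.inr (by linarith))).tendsto.mul_const
        (j : ℝ)
      rw [Real.zero_rpow (by linarith), zero_mul] at this
      exact this.mono_left nhdsWithin_le_nhds
    refine tendsto_of_tendsto_of_tendsto_of_le_of_le' tendsto_const_nhds h3 ?_ ?_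
    · filter_upwards [self_mem_nhdsWithin] with s hs using one_sub_exp_div_nonneg hs j
    · filter_upwards [self_mem_nhdsWithin] with s hs using one_sub_exp_div_le hs j
  have h4 : Tendsto (fun s : ℝ => Real.exp (-(s ^ 2 * j))) (𝓝[>] 0) (𝓝 1) := by
    have : Continuous fun s : ℝ => Real.exp (-(s ^ 2 * j)) := by fun_prop
    have := (this.tendsto 0).mono_left (nhdsWithin_le_nhds (s := Ioi 0))
    simpa using this
  have h5 : Tendsto (fun s => ∫ k : ℕ, (1 - φ (s * k)) / s ^ (1 + α) ∂κ j) (𝓝[>] 0)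
      (𝓝 (∫ k : ℕ, c * (k : ℝ) ^ (1 + α) ∂κ j)) := by
    refine tendsto_integral_filter_of_dominated_convergence (fun k => D * (k : ℝ) ^ (1 + α))
      (Eventually.of_forall fun s => Measurable.of_discrete.aestronglyMeasurable) ?_
      (h.integrable ((QuadGrowth.rpow (by linarith) (by linarith)).const_mul D) j)
      (ae_of_all _ fun k => tendsto_one_sub_profile_div hα0 hφ k)
    filter_upwards [self_mem_nhdsWithin] with s hs
    refine ae_of_all _ fun k => ?_
    rw [Real.norm_of_nonneg (one_sub_profile_div_nonneg hφ hs k)]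
    exact one_sub_profile_div_le hφ hs k
  have h6 := (h1.neg.add h2).add (h4.mul h5)
  rw [integral_const_mul] at h6
  rw [show -(c * (j : ℝ) ^ (1 + α)) + 0 + 1 * (c * ∫ k : ℕ, (k : ℝ) ^ (1 + α) ∂κ j)
    = c * harmonicDefect κ α j by rw [harmonicDefect]; ring] at h6
  refine h6.congr' ?_
  filter_upwards [self_mem_nhdsWithin] with s hs using (h.profileDefect_eq hφ hs j).symm

/-- Along the chain killed at rate `s ^ 2`, the profile is multiplied by roughly
`1 - a * s ^ (1 + α)` in each step. -/
lemma exists_profile_decay (h : MigrationKernel α C J κ) (hα0 : 0 < α) (hα1 : α < 1)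
    (hφ : IsDecayingProfile α D c φ φ₁ φ₂ φ₃) :
    ∃ a : ℝ, 0 < a ∧ ∀ ε, 0 < ε → ∃ m, ∀ᶠ s in 𝓝[>] (0 : ℝ), ∀ k, m ≤ k →
      |(killOp κ (s ^ 2))^[k + 1] (fun j : ℕ => φ (s * j)) 0
        - (1 - a * s ^ (1 + α)) * (killOp κ (s ^ 2))^[k] (fun j : ℕ => φ (s * j)) 0|
      ≤ s ^ (1 + α) * ε := by
  obtain ⟨a, ha0, ha⟩ := h.exists_mixes_harmonicDefect hα0 hα1
  obtain ⟨A, hA0, hA⟩ := h.exists_profileDefect_bound hα0 hα1 hφ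
  obtain ⟨A', hA'0, hA'⟩ := h.exists_harmonicDefect_bound hα0 hα1
  have hγα : max (α - 1 / 2) 0 < α := max_lt (by linarith) hα0
  have hγ0 : 0 ≤ max (α - 1 / 2) 0 := le_max_right _ _
  have hc := hφ.pos_const
  refine ⟨c * a, by positivity, fun ε hε => ?_⟩
  set ε' := ε / (1 + c + c * a) with hε'
  have hε'0 : 0 < ε' := by positivity
  obtain ⟨m, hm⟩ := ha ε' hε'0
  refine ⟨m, ?_⟩
  have hsq : Tendsto (fun s : ℝ => s ^ 2) (𝓝[>] 0) (𝓝[≥] 0) := by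
    refine tendsto_nhdsWithin_iff.2 ⟨?_, Eventually.of_forall fun x => sq_nonneg x⟩
    have := ((continuous_pow (M := ℝ) 2).tendsto 0).mono_left (nhdsWithin_le_nhds (s := Ioi 0))
    simpa using this
  have hle1 : ∀ᶠ s in 𝓝[>] (0 : ℝ), s ≤ 1 :=
    mem_nhdsWithin_of_mem_nhds (Iic_mem_nhds one_pos)
  have hw := h.eventually_iterate_le_of_tendsto (l := 𝓝[>] (0 : ℝ)) hγ0 hγα hα1
    (w := fun s j => profileDefect κ α φ s j - c * harmonicDefect κ α j) (A := A + c * A')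
    (by positivity)
    (by
      filter_upwards [hle1, self_mem_nhdsWithin] with s hs1 hs j
      have e1 := hA s hs hs1 j
      have e2 := mul_le_mul_of_nonneg_left (hA' j) hc.le
      refine (abs_sub _ _).trans ?_
      rw [abs_mul, abs_of_pos hc]
      linarith)
    (fun j => by
      have := (h.tendsto_profileDefect hα0 hα1 hφ j).sub_const (c * harmonicDefect κ α j)
      rwa [sub_self] at this) hε'0
  have hv := h.eventually_iterate_le_of_tendsto (l := 𝓝[>] (0 : ℝ)) le_rfl hα0 hα1
    (w := fun s j => 1 - φ (s * j)) (A := 1) zero_le_one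
    (by
      filter_upwards [self_mem_nhdsWithin] with s hs j
      have hs : 0 < s := hs
      rw [abs_of_nonneg (sub_nonneg.2 (hφ.le_one _ (by positivity))), Real.rpow_zero]
      linarith [hφ.nonneg (s * j) (by positivity)])
    (fun j => by
      have h1 := tendsto_one_sub_profile_div hα0 hφ j
      have h2 := (Real.continuousAt_rpow_const (0 : ℝ) (1 + α) (Or.inr (by linarith))).tendsto
      rw [Real.zero_rpow (by linarith)] at h2
      have h3 := h1.mul (h2.mono_left (nhdsWithin_le_nhds (s := Ioi 0)))
      rw [mul_zero] at h3
      refine h3.congr' ?_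
      filter_upwards [self_mem_nhdsWithin] with s hs
      have hs : 0 < s := hs
      have hp : 0 < s ^ (1 + α) := by positivity
      field_simp) hε'0
  filter_upwards [hw, hv, hsq.eventually hm, hle1, self_mem_nhdsWithin] with s e₁ e₂ e₃ hs1 hs k hk
  have hs : 0 < s := hs
  have hp : 0 < s ^ (1 + α) := by positivity
  have hμ : 0 ≤ s ^ 2 := sq_nonneg s
  have qf : QuadGrowth (fun j : ℕ => φ (s * j)) :=
    QuadGrowth.of_bounded (abs_profile_le_one hφ hs.le)
  have qg : QuadGrowth (profileDefect κ α φ s) :=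
    quadGrowth_of_le_rpow hγ0 (by linarith) (hA s hs hs1)
  have qh : QuadGrowth (harmonicDefect κ α) := quadGrowth_of_le_rpow hγ0 (by linarith) hA'
  have e₁ := e₁ (s ^ 2) k hμ
  have e₂ := e₂ (s ^ 2) k hμ
  have e₃ := e₃ k hk
  rw [h.iterate_sub hμ k qg (qh.const_mul c), iterate_const_mul] at e₁
  rw [h.iterate_sub hμ k (QuadGrowth.const 1) qf] at e₂
  have hstep : killOp κ (s ^ 2) (fun j : ℕ => φ (s * j))
      = fun j : ℕ => φ (s * j) - s ^ (1 + α) * profileDefect κ α φ s j := by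
    funext j
    rw [profileDefect, mul_inv_cancel_left₀ hp.ne']; ring
  rw [Function.iterate_succ, Function.comp, hstep, h.iterate_sub hμ k qf (qg.const_mul _),
    iterate_const_mul]
  set u := (killOp κ (s ^ 2))^[k] (fun j : ℕ => φ (s * j)) 0
  set w := (killOp κ (s ^ 2))^[k] (profileDefect κ α φ s) 0
  set d := (killOp κ (s ^ 2))^[k] (harmonicDefect κ α) 0
  set o := (killOp κ (s ^ 2))^[k] (fun _ => (1 : ℝ)) 0
  have e4 : u - s ^ (1 + α) * w - (1 - c * a * s ^ (1 + α)) * u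
      = -(s ^ (1 + α) * ((w - c * d) + c * (d - a * o) + c * a * (o - u))) := by ring
  rw [e4, abs_neg, abs_mul, abs_of_pos hp]
  refine mul_le_mul_of_nonneg_left ?_ hp.le
  have e5 : |c * (d - a * o)| ≤ c * ε' := by
    rw [abs_mul, abs_of_pos hc]; exact mul_le_mul_of_nonneg_left e₃ hc.le
  have e6 : |c * a * (o - u)| ≤ c * a * ε' := by
    rw [abs_mul, abs_of_pos (by positivity : 0 < c * a)]
    exact mul_le_mul_of_nonneg_left e₂ (by positivity)
  have e7 : ε = ε' + c * ε' + c * a * ε' := by rw [hε']; field_simp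
  rw [e7]
  exact (abs_add_three _ _ _).trans (by linarith)

/-- Laplace transform of the total progeny of the chain. -/
theorem exists_tendsto_iterate_one (h : MigrationKernel α C J κ) (hα0 : 0 < α) (hα1 : α < 1) :
    ∃ a : ℝ, 0 < a ∧ ∀ lam : ℝ, 0 < lam →
      Tendsto (fun n : ℕ => (killOp κ (lam / (n : ℝ) ^ (1 / ((α + 1) / 2))))^[n] (fun _ => 1) 0)
        atTop (𝓝 (Real.exp (-a * lam ^ ((α + 1) / 2)))) := by
  obtain ⟨D, c, φ, φ₁, φ₂, φ₃, hφ⟩ := exists_isDecayingProfile hα0 hα1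
  obtain ⟨a, ha0, ha⟩ := h.exists_profile_decay hα0 hα1 hφ
  refine ⟨a, ha0, fun lam hlam => ?_⟩
  set ν := (α + 1) / 2 with hν
  have hν0 : 0 < ν := by positivity
  set τ := lam ^ ν with hτ
  have hτ0 : 0 < τ := by positivity
  set s : ℕ → ℝ := fun n => √(lam / (n : ℝ) ^ (1 / ν)) with hs
  have hsq : ∀ n, s n ^ 2 = lam / (n : ℝ) ^ (1 / ν) := fun n => Real.sq_sqrt (by positivity)
  have hspow : ∀ n : ℕ, 1 ≤ n → s n ^ (1 + α) = τ / n := by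
    intro n hn
    have hn0 : (0 : ℝ) < n := by exact_mod_cast hn
    have e : 1 + α = (2 : ℕ) * ν := by rw [hν]; push_cast; ring
    rw [e, Real.rpow_natCast_mul (Real.sqrt_nonneg _), hsq, Real.div_rpow hlam.le (by positivity),
      ← Real.rpow_mul hn0.le, one_div_mul_cancel hν0.ne', Real.rpow_one]
  have hslim : Tendsto s atTop (𝓝[>] 0) := by
    refine tendsto_nhdsWithin_iff.2 ⟨?_, ?_⟩
    · have h1 : Tendsto (fun n : ℕ => lam / (n : ℝ) ^ (1 / ν)) atTop (𝓝 0) :=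
        ((tendsto_rpow_atTop (by positivity)).comp tendsto_natCast_atTop_atTop).const_div_atTop lam
      have := h1.sqrt
      rwa [Real.sqrt_zero] at this
    · filter_upwards [eventually_ge_atTop 1] with n hn
      have hn0 : (0 : ℝ) < n := by exact_mod_cast hn
      exact Real.sqrt_pos.2 (by positivity)
  have hexp : Tendsto (fun n : ℕ => (1 + -(a * τ) / (n : ℝ)) ^ n) atTop
      (𝓝 (Real.exp (-(a * τ)))) := Real.tendsto_one_add_div_pow_exp _
  simp only [← hsq]
  rw [neg_mul]
  suffices H : ∀ ε, 0 < ε → ∀ᶠ n : ℕ in atTop, |(killOp κ (s n ^ 2))^[n] (fun _ => 1) 0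
      - (1 + -(a * τ) / (n : ℝ)) ^ n| ≤ ε by
    have hz : Tendsto (fun n : ℕ => (killOp κ (s n ^ 2))^[n] (fun _ => 1) 0
        - (1 + -(a * τ) / (n : ℝ)) ^ n) atTop (𝓝 0) := by
      rw [Metric.tendsto_nhds]
      intro ε hε
      filter_upwards [H (ε / 2) (half_pos hε)] with n hn
      rw [Real.dist_eq, sub_zero]; linarith
    simpa using hz.add hexp
  intro ε hε
  obtain ⟨m, hm⟩ := ha (ε / (4 * τ)) (by positivity)
  have hv := h.eventually_iterate_le_of_tendsto (l := 𝓝[>] (0 : ℝ)) le_rfl hα0 hα1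
    (w := fun s j => 1 - φ (s * j)) (A := 1) zero_le_one
    (by
      filter_upwards [self_mem_nhdsWithin] with s hs j
      have hs : 0 < s := hs
      rw [abs_of_nonneg (sub_nonneg.2 (hφ.le_one _ (by positivity))), Real.rpow_zero]
      linarith [hφ.nonneg (s * j) (by positivity)])
    (fun j => by
      have h1 := tendsto_one_sub_profile_div hα0 hφ j
      have h2 := (Real.continuousAt_rpow_const (0 : ℝ) (1 + α) (Or.inr (by linarith))).tendsto
      rw [Real.zero_rpow (by linarith)] at h2
      have h3 := h1.mul (h2.mono_left (nhdsWithin_le_nhds (s := Ioi 0)))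
      rw [mul_zero] at h3
      refine h3.congr' ?_
      filter_upwards [self_mem_nhdsWithin] with s hs
      have hs : 0 < s := hs
      have hp : 0 < s ^ (1 + α) := by positivity
      field_simp) (show 0 < ε / 8 by positivity)
  have hone : Tendsto (fun n => (killOp κ (s n ^ 2))^[m] (fun _ => (1 : ℝ)) 0) atTop (𝓝 1) := by
    have h1 := h.tendsto_iterate_killOp (G := fun _ => 1) (B := 1) (by simp) m 0
    rw [h.iterate_zero_const] at h1
    refine h1.comp (tendsto_nhdsWithin_iff.2 ⟨?_, Eventually.of_forall fun x => sq_nonneg (s x)⟩)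
    have := (hslim.mono_right nhdsWithin_le_nhds).pow 2
    simpa using this
  have hbase : Tendsto (fun n : ℕ => (1 + -(a * τ) / (n : ℝ)) ^ m) atTop (𝓝 1) := by
    have : Tendsto (fun n : ℕ => -(a * τ) / (n : ℝ)) atTop (𝓝 0) :=
      tendsto_const_div_atTop_nhds_zero_nat _
    simpa using (this.const_add 1).pow m
  have hdiff := (hone.sub hbase).abs
  rw [sub_self, abs_zero] at hdiff
  filter_upwards [hslim.eventually hm, hslim.eventually hv,
    hdiff.eventually_le_const (show 0 < ε / 4 by positivity), eventually_ge_atTop 1,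
    eventually_ge_atTop m, eventually_ge_atTop ⌈a * τ⌉₊, hslim.eventually self_mem_nhdsWithin]
    with n e₁ e₂ e₃ hn1 hnm hna hsn
  have hsn : 0 < s n := hsn
  have hn0 : (0 : ℝ) < n := by exact_mod_cast hn1
  have hna : a * τ ≤ n := Nat.ceil_le.1 hna
  have hμ : 0 ≤ s n ^ 2 := sq_nonneg _
  have qf : QuadGrowth (fun j : ℕ => φ (s n * j)) :=
    QuadGrowth.of_bounded (abs_profile_le_one hφ hsn.le)
  have hd : ∀ k, |(killOp κ (s n ^ 2))^[k] (fun _ => (1 : ℝ)) 0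
      - (killOp κ (s n ^ 2))^[k] (fun j => φ (s n * j)) 0| ≤ ε / 8 := by
    intro k
    have := e₂ (s n ^ 2) k hμ
    rwa [h.iterate_sub hμ k (QuadGrowth.const 1) qf] at this
  set r := 1 + -(a * τ) / (n : ℝ) with hr
  have hr1 : r ≤ 1 := by
    have : 0 ≤ a * τ / n := by positivity
    rw [hr, neg_div]; linarith
  have hr0 : 0 ≤ r := by
    have : a * τ / n ≤ 1 := (div_le_one hn0).2 hna
    rw [hr, neg_div]; linarith
  have hra : 1 - a * s n ^ (1 + α) = r := by rw [hspow n hn1, hr]; ring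
  set u : ℕ → ℝ := fun k => (killOp κ (s n ^ 2))^[k] (fun j => φ (s n * j)) 0 with hu
  have hstep : ∀ i, |u (m + i) - r ^ (m + i)| ≤ |u m - r ^ m| + i * (ε / (4 * n)) := by
    intro i
    induction i with
    | zero => simp
    | succ i ih =>
      have h1 := e₁ (m + i) (by omega)
      rw [hra, hspow n hn1] at h1
      have e : τ / n * (ε / (4 * τ)) = ε / (4 * n) := by field_simp
      rw [e] at h1
      have h2 : |r * (u (m + i) - r ^ (m + i))| ≤ |u (m + i) - r ^ (m + i)| := by
        rw [abs_mul, abs_of_nonneg hr0]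
        exact mul_le_of_le_one_left (abs_nonneg _) hr1
      have e2 : u (m + (i + 1)) - r ^ (m + (i + 1))
          = (u (m + i + 1) - r * u (m + i)) + r * (u (m + i) - r ^ (m + i)) := by
        rw [← add_assoc, pow_succ]; ring
      rw [e2]
      refine (abs_add_le _ _).trans ?_
      push_cast
      have h1' : |u (m + i + 1) - r * u (m + i)| ≤ ε / (4 * n) := h1
      linarith
  have h3 := hstep (n - m)
  rw [Nat.add_sub_cancel' hnm] at h3
  have h4 : ((n - m : ℕ) : ℝ) * (ε / (4 * n)) ≤ ε / 4 := by
    have : ((n - m : ℕ) : ℝ) ≤ n := by exact_mod_cast Nat.sub_le n m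
    calc _ ≤ (n : ℝ) * (ε / (4 * n)) := by gcongr
      _ = ε / 4 := by field_simp
  have h5 := abs_le.1 (hd m)
  have h6 := abs_le.1 (hd n)
  have h7 := abs_le.1 e₃
  have h8 : |u m - r ^ m| ≤ ε / 8 + ε / 4 := by
    rw [abs_le]; constructor <;> linarith
  have h9 := abs_le.1 (h3.trans (add_le_add h8 h4))
  rw [abs_le]
  constructor <;> linarith

end MigrationKernel

/-- Index of the first natural number satisfying a measurable predicate is measurable. -/
lemma measurable_sInf_setOf {Ω : Type*} [MeasurableSpace Ω] {Q : ℕ → Ω → Prop}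
    (hQ : ∀ k, MeasurableSet {ω | Q k ω}) : Measurable fun ω => sInf {k | Q k ω} := by
  refine measurable_to_countable' fun k => ?_
  have : (fun ω => sInf {k | Q k ω}) ⁻¹' {k}
      = ({ω | Q k ω} ∩ ⋂ i ∈ Finset.range k, {ω | Q i ω}ᶜ)
        ∪ ({_ω : Ω | k = 0} ∩ ⋂ i, {ω | Q i ω}ᶜ) := by
    ext ω
    simp only [mem_preimage, mem_singleton_iff, mem_union, mem_inter_iff, mem_ofPred_eq, mem_iInter,
      mem_compl_iff, Finset.mem_range]
    constructor
    · rintro h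
      rcases Set.eq_empty_or_nonempty {k | Q k ω} with he | hne
      · right
        rw [he, Nat.sInf_empty] at h
        exact ⟨h.symm, fun i hi => (he.le hi : i ∈ (∅ : Set ℕ))⟩
      · left
        rw [← h]
        exact ⟨Nat.sInf_mem hne, fun i hi => Nat.notMem_of_lt_sInf hi⟩
    · rintro (⟨h1, h2⟩ | ⟨h1, h2⟩)
      · refine le_antisymm (Nat.sInf_le h1) ?_
        by_contra! hlt
        exact h2 _ hlt (Nat.sInf_mem (s := {k | Q k ω}) ⟨k, h1⟩)
      · have : {k | Q k ω} = ∅ := by ext i; simpa using h2 i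
        rw [this, Nat.sInf_empty, h1]
  rw [this]
  exact ((hQ k).inter (Finset.measurableSet_biInter _ fun i _ => (hQ i).compl)).union
    ((MeasurableSet.const _).inter (MeasurableSet.iInter fun i => (hQ i).compl))

/-- Number of failures before the `(j+1)`-st success in a sequence of trials. -/
def failures (b : ℕ → Bool) (j : ℕ) : ℕ :=
  sInf {k | b (j + k) = true ∧ Nat.count (fun i => b i = true) (j + k) = j}

lemma failures_eq {b : ℕ → Bool} {j k : ℕ} (h : b (j + k) = true)
    (hc : Nat.count (fun i => b i = true) (j + k) = j) : failures b j = k := by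
  have hmem : k ∈ {k | b (j + k) = true ∧ Nat.count (fun i => b i = true) (j + k) = j} := ⟨h, hc⟩
  obtain ⟨h1, h2⟩ := Nat.sInf_mem ⟨k, hmem⟩
  have := Nat.count_injective (p := fun i => b i = true) h1 h (h2.trans hc.symm)
  unfold failures
  omega

lemma exists_failures {b : ℕ → Bool} (hb : {i | b i = true}.Infinite) (j : ℕ) :
    b (j + failures b j) = true ∧ Nat.count (fun i => b i = true) (j + failures b j) = j := by
  have hle : j ≤ Nat.nth (fun i => b i = true) j := Nat.le_nth fun hf => absurd hf hb
  have h1 : b (j + (Nat.nth (fun i => b i = true) j - j)) = true := by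
    rw [Nat.add_sub_cancel' hle]; exact Nat.nth_mem_of_infinite hb j
  have h2 : Nat.count (fun i => b i = true) (j + (Nat.nth (fun i => b i = true) j - j)) = j := by
    rw [Nat.add_sub_cancel' hle]; exact Nat.count_nth_of_infinite hb j
  rw [failures_eq h1 h2]
  exact ⟨h1, h2⟩

lemma failures_mono {b : ℕ → Bool} (hb : {i | b i = true}.Infinite) : Monotone (failures b) := by
  refine monotone_nat_of_le_succ fun j => ?_
  obtain ⟨-, h1⟩ := exists_failures hb j
  obtain ⟨-, h2⟩ := exists_failures hb (j + 1)
  have : j + failures b j < j + 1 + failures b (j + 1) :=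
    Nat.lt_of_count_lt_count (p := fun i => b i = true) (by rw [h1, h2]; omega)
  omega

lemma infinite_tail {b : ℕ → Bool} (hb : {i | b i = true}.Infinite) :
    {i | b (i + 1) = true}.Infinite := by
  intro hf
  refine hb (((hf.image (· + 1)).union (finite_singleton 0)).subset ?_)
  rintro (_ | i) hi
  · exact Or.inr rfl
  · exact Or.inl ⟨i, hi, rfl⟩

lemma failures_of_head_false {b : ℕ → Bool} (hb : {i | b i = true}.Infinite) (h0 : b 0 = false)
    (j : ℕ) : failures b j = failures (fun i => b (i + 1)) j + 1 := by
  obtain ⟨h1, h2⟩ := exists_failures (infinite_tail hb) j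
  refine failures_eq h1 ?_
  rw [← add_assoc, Nat.count_succ', h2]; simp [h0]

lemma failures_succ_of_head_true {b : ℕ → Bool} (hb : {i | b i = true}.Infinite) (h0 : b 0 = true)
    (j : ℕ) : failures b (j + 1) = failures (fun i => b (i + 1)) j := by
  obtain ⟨h1, h2⟩ := exists_failures (infinite_tail hb) j
  refine failures_eq (by rw [add_right_comm]; exact h1) ?_
  rw [add_right_comm, Nat.count_succ', h2]; simp [h0]

lemma failures_zero_of_head_true {b : ℕ → Bool} (h0 : b 0 = true) : failures b 0 = 0 :=
  failures_eq (by simpa using h0) (by simp)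

lemma measurable_failures (j : ℕ) : Measurable fun b => failures b j := by
  refine measurable_sInf_setOf fun k => ?_
  have hm : ∀ i, MeasurableSet {b : ℕ → Bool | b i = true} := fun i =>
    (measurable_pi_apply (X := fun _ => Bool) i) (measurableSet_singleton true)
  have hc : ∀ n, Measurable fun b : ℕ → Bool => Nat.count (fun i => b i = true) n := by
    intro n
    induction n with
    | zero => simp
    | succ n ih =>
      simp only [Nat.count_succ]
      exact ih.add (Measurable.ite (hm n) measurable_const measurable_const)
  exact (hm _).inter (hc _ (measurableSet_singleton j))

/-- Families of independent variables over disjoint index sets are independent. -/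
lemma iIndepFun.indepFun_restrict {Ω ι β : Type*} [MeasurableSpace Ω] [MeasurableSpace β]
    {P : Measure Ω} {ξ : ι → Ω → β} (h : iIndepFun ξ P) (hm : ∀ i, Measurable (ξ i))
    {S T : Set ι} (hST : Disjoint S T) :
    IndepFun (fun ω (i : S) => ξ i ω) (fun ω (i : T) => ξ i ω) P := by
  have h1 := indep_iSup_of_disjoint (fun i => (hm i).comap_le) h.iIndep hST
  rw [IndepFun_iff_Indep]
  have key : ∀ U : Set ι, MeasurableSpace.comap (fun ω (i : U) => ξ i ω) MeasurableSpace.pi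
      ≤ ⨆ i ∈ U, MeasurableSpace.comap (ξ i) inferInstance := by
    intro U
    rw [← measurable_iff_comap_le]
    refine @measurable_pi_lambda _ _ _ (_) _ _ fun i => ?_
    rw [measurable_iff_comap_le]
    exact le_iSup₂_of_le i.1 i.2 le_rfl
  exact indep_of_indep_of_le_left (indep_of_indep_of_le_right h1 (key T)) (key S)

/-- Independent coins: the `v`-th one shows `true` with probability `q v`, which is at least
`1/2`, and exactly `1/2` once `M ≤ v`. -/
structure IsCoinSeq (M : ℕ) (q : ℕ → ℝ) {Ω : Type*} [MeasurableSpace Ω] (P : Measure Ω)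
    (ξ : ℕ → Ω → Bool) : Prop where
  indep : iIndepFun ξ P
  meas : ∀ v, Measurable (ξ v)
  law : ∀ v, P {ω | ξ v ω = true} = ENNReal.ofReal (q v)
  half_le : ∀ v, 1 / 2 ≤ q v
  lt_one : ∀ v, q v < 1
  half : ∀ v, M ≤ v → q v = 1 / 2

namespace IsCoinSeq

variable {M : ℕ} {q : ℕ → ℝ} {Ω : Type*} [MeasurableSpace Ω] {P : Measure Ω} {ξ : ℕ → Ω → Bool}

lemma isProb (h : IsCoinSeq M q P ξ) : IsProbabilityMeasure P := h.indep.isProbabilityMeasure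

lemma tail (h : IsCoinSeq M q P ξ) :
    IsCoinSeq (M - 1) (fun v => q (v + 1)) P (fun v => ξ (v + 1)) where
  indep := h.indep.precomp (add_left_injective 1)
  meas v := h.meas _
  law v := h.law _
  half_le v := h.half_le _
  lt_one v := h.lt_one _
  half v hv := h.half _ (by omega)

lemma measurableSet_true (h : IsCoinSeq M q P ξ) (v : ℕ) : MeasurableSet {ω | ξ v ω = true} :=
  h.meas v (measurableSet_singleton true)

lemma law_false (h : IsCoinSeq M q P ξ) (v : ℕ) :
    P {ω | ξ v ω = false} = ENNReal.ofReal (1 - q v) := by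
  have := h.isProb
  have e : {ω | ξ v ω = false} = {ω | ξ v ω = true}ᶜ := by ext; simp
  rw [e, prob_compl_eq_one_sub (h.measurableSet_true v), h.law,
    ENNReal.ofReal_sub _ (by linarith [h.half_le v]), ENNReal.ofReal_one]

lemma ae_infinite (h : IsCoinSeq M q P ξ) : ∀ᵐ ω ∂P, {i | ξ i ω = true}.Infinite := by
  have := h.isProb
  have hs : iIndepSet (fun v => {ω | ξ v ω = true}) P :=
    (iIndepSet_iff_meas_biInter h.measurableSet_true).2 fun s =>
      h.indep.meas_biInter fun i _ => ⟨{true}, measurableSet_singleton _, rfl⟩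
  have h1 := measure_limsup_eq_one h.measurableSet_true hs (by
    refine top_unique ?_
    rw [← ENNReal.tsum_const_eq_top_of_ne_zero (α := ℕ) (c := ENNReal.ofReal (1 / 2)) (by simp)]
    exact ENNReal.tsum_le_tsum fun v => by
      rw [h.law]; exact ENNReal.ofReal_le_ofReal (h.half_le v))
  have h2 := (prob_compl_eq_zero_iff (MeasurableSet.measurableSet_limsup h.measurableSet_true)).2 h1
  filter_upwards [compl_mem_ae_iff.2 h2] with ω hω
  rw [compl_compl, mem_limsup_iff_frequently_mem] at hω
  exact Nat.frequently_atTop_iff_infinite.1 hω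

/-- Conditioning on the first coin. -/
lemma map_eq_of_head (h : IsCoinSeq M q P ξ) {F G H : (ℕ → Bool) → ℕ}
    (hF : Measurable F) (hG : Measurable G) (hH : Measurable H)
    (ht : ∀ b : ℕ → Bool, {i | b i = true}.Infinite → b 0 = true → F b = G fun i => b (i + 1))
    (hf : ∀ b : ℕ → Bool, {i | b i = true}.Infinite → b 0 = false → F b = H fun i => b (i + 1)) :
    P.map (fun ω => F fun i => ξ i ω)
      = ENNReal.ofReal (q 0) • P.map (fun ω => G fun i => ξ (i + 1) ω)
        + ENNReal.ofReal (1 - q 0) • P.map (fun ω => H fun i => ξ (i + 1) ω) := by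
  have hξ : Measurable fun ω i => ξ i ω := measurable_pi_iff.2 h.meas
  have hξ' : Measurable fun ω i => ξ (i + 1) ω := measurable_pi_iff.2 h.tail.meas
  have hind : IndepFun (ξ 0) (fun ω i => ξ (i + 1) ω) P := by
    have := iIndepFun.indepFun_restrict h.indep h.meas (S := {0}) (T := {0}ᶜ) disjoint_compl_right
    exact this.comp (φ := fun x : ({0} : Set ℕ) → Bool => x ⟨0, rfl⟩)
      (ψ := fun x i => x ⟨i + 1, by simp⟩) (measurable_pi_apply (X := fun _ => Bool) _)
      (measurable_pi_iff.2 fun i => measurable_pi_apply _)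
  refine Measure.ext_of_singleton fun k => ?_
  have hk := measurableSet_singleton k
  have split : P {ω | F (fun i => ξ i ω) = k}
      = P (ξ 0 ⁻¹' {true} ∩ (fun ω i => ξ (i + 1) ω) ⁻¹' (G ⁻¹' {k}))
        + P (ξ 0 ⁻¹' {false} ∩ (fun ω i => ξ (i + 1) ω) ⁻¹' (H ⁻¹' {k})) := by
    rw [← measure_union]
    · refine measure_congr ?_
      filter_upwards [h.ae_infinite] with ω hω
      refine propext ?_
      show F (fun i => ξ i ω) = k ↔ (ξ 0 ω = true ∧ G (fun i => ξ (i + 1) ω) = k)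
        ∨ (ξ 0 ω = false ∧ H (fun i => ξ (i + 1) ω) = k)
      rcases hb : ξ 0 ω with _ | _
      · simp [hf _ hω hb]
      · simp [ht _ hω hb]
    · refine disjoint_left.2 fun ω h1 h2 => ?_
      have e1 : ξ 0 ω = true := h1.1
      have e2 : ξ 0 ω = false := h2.1
      simp [e1] at e2
    · exact (h.meas 0 (measurableSet_singleton _)).inter (hξ' (hH hk))
  rw [hind.measure_inter_preimage_eq_mul _ _ (measurableSet_singleton _) (hG hk),
    hind.measure_inter_preimage_eq_mul _ _ (measurableSet_singleton _) (hH hk)] at split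
  simp only [← Function.comp_def F, ← Function.comp_def G, ← Function.comp_def H]
  rw [Measure.map_apply (hF.comp hξ) hk, Measure.add_apply, Measure.smul_apply, Measure.smul_apply,
    Measure.map_apply (hG.comp hξ') hk, Measure.map_apply (hH.comp hξ') hk, smul_eq_mul,
    smul_eq_mul, ← h.law, ← h.law_false]
  exact split

end IsCoinSeq

/-- Law of the number of failures before the `(j+1)`-st success. -/
def failureLaw {Ω : Type*} [MeasurableSpace Ω] (P : Measure Ω) (ξ : ℕ → Ω → Bool) (j : ℕ) :
    Measure ℕ :=
  P.map fun ω => failures (fun i => ξ i ω) j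

namespace IsCoinSeq

variable {M : ℕ} {q : ℕ → ℝ} {Ω : Type*} [MeasurableSpace Ω] {P : Measure Ω} {ξ : ℕ → Ω → Bool}

lemma measurable_failures (h : IsCoinSeq M q P ξ) (j : ℕ) :
    Measurable fun ω => failures (fun i => ξ i ω) j :=
  (_root_.measurable_failures j).comp (measurable_pi_iff.2 h.meas)

lemma isProb_failureLaw (h : IsCoinSeq M q P ξ) (j : ℕ) :
    IsProbabilityMeasure (failureLaw P ξ j) := by
  have := h.isProb
  exact Measure.isProbabilityMeasure_map (h.measurable_failures j).aemeasurable

lemma failureLaw_zero (h : IsCoinSeq M q P ξ) :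
    failureLaw P ξ 0 = ENNReal.ofReal (q 0) • Measure.dirac 0
      + ENNReal.ofReal (1 - q 0) • (failureLaw P (fun v => ξ (v + 1)) 0).map (· + 1) := by
  have := h.isProb
  have hm := h.tail.measurable_failures 0
  have := h.map_eq_of_head (F := fun b => failures b 0) (G := fun _ => 0)
    (H := fun b => failures b 0 + 1) (_root_.measurable_failures 0) measurable_const
    ((_root_.measurable_failures 0).add_const 1) (fun b _ => failures_zero_of_head_true)
    (fun b hb h0 => failures_of_head_false hb h0 0)
  rw [failureLaw, this, failureLaw, Measure.map_map (by fun_prop) hm, Measure.map_const,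
    measure_univ, one_smul]
  rfl

lemma failureLaw_succ (h : IsCoinSeq M q P ξ) (j : ℕ) :
    failureLaw P ξ (j + 1) = ENNReal.ofReal (q 0) • failureLaw P (fun v => ξ (v + 1)) j
      + ENNReal.ofReal (1 - q 0) • (failureLaw P (fun v => ξ (v + 1)) (j + 1)).map (· + 1) := by
  have hm := h.tail.measurable_failures (j + 1)
  have := h.map_eq_of_head (F := fun b => failures b (j + 1)) (G := fun b => failures b j)
    (H := fun b => failures b (j + 1) + 1) (_root_.measurable_failures _)
    (_root_.measurable_failures _) ((_root_.measurable_failures _).add_const 1)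
    (fun b hb h0 => failures_succ_of_head_true hb h0 j)
    (fun b hb h0 => failures_of_head_false hb h0 (j + 1))
  rw [failureLaw, this, failureLaw, failureLaw, Measure.map_map (by fun_prop) hm]
  rfl

lemma map_succ_zero (μ : Measure ℕ) : μ.map (· + 1) {0} = 0 := by
  rw [Measure.map_apply (by fun_prop) (measurableSet_singleton _)]
  convert measure_empty (μ := μ)
  ext; simp

lemma map_succ_succ (μ : Measure ℕ) (k : ℕ) : μ.map (· + 1) {k + 1} = μ {k} := by
  rw [Measure.map_apply (by fun_prop) (measurableSet_singleton _)]
  congr 1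
  ext; simp

lemma failureLaw_singleton_pos (h : IsCoinSeq M q P ξ) (j k : ℕ) : 0 < failureLaw P ξ j {k} := by
  have hq : ENNReal.ofReal (q 0) ≠ 0 :=
    (ENNReal.ofReal_pos.2 (by linarith [h.half_le 0])).ne'
  have hq' : ENNReal.ofReal (1 - q 0) ≠ 0 :=
    (ENNReal.ofReal_pos.2 (by linarith [h.lt_one 0])).ne'
  induction k generalizing M q ξ j with
  | zero =>
    induction j generalizing M q ξ with
    | zero => rw [h.failureLaw_zero]; simp [map_succ_zero]; linarith [h.half_le 0]
    | succ j ih =>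
      have := ih h.tail (ENNReal.ofReal_pos.2 (by linarith [h.half_le 1])).ne'
        (ENNReal.ofReal_pos.2 (by linarith [h.lt_one 1])).ne'
      rw [h.failureLaw_succ]
      simp only [Measure.add_apply, Measure.smul_apply, smul_eq_mul]
      exact (ENNReal.mul_pos hq this.ne').trans_le le_self_add
  | succ k ih =>
    have := fun j => ih h.tail j (ENNReal.ofReal_pos.2 (by linarith [h.half_le 1])).ne'
      (ENNReal.ofReal_pos.2 (by linarith [h.lt_one 1])).ne'
    cases j with
    | zero =>
      rw [h.failureLaw_zero]
      simp only [Measure.add_apply, Measure.smul_apply, smul_eq_mul, map_succ_succ]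
      exact (ENNReal.mul_pos hq' (this 0).ne').trans_le le_add_self
    | succ j =>
      rw [h.failureLaw_succ]
      simp only [Measure.add_apply, Measure.smul_apply, smul_eq_mul, map_succ_succ]
      exact (ENNReal.mul_pos hq' (this (j + 1)).ne').trans_le le_add_self

/-- For fair coins the number of failures is negative binomial. -/
lemma failureLaw_singleton_of_fair (h : IsCoinSeq 0 q P ξ) (j k : ℕ) :
    failureLaw P ξ j {k} = ((j + k).choose k : ℝ≥0∞) * 2⁻¹ ^ (j + k + 1) := by
  have half : ENNReal.ofReal (1 / 2) = 2⁻¹ := by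
    rw [one_div, ENNReal.ofReal_inv_of_pos two_pos, ENNReal.ofReal_ofNat]
  have half' : ENNReal.ofReal (1 - 1 / 2) = 2⁻¹ := by rw [← half]; norm_num
  induction k generalizing q ξ j with
  | zero =>
    induction j generalizing q ξ with
    | zero =>
      rw [h.failureLaw_zero, h.half 0 le_rfl, half, half']; simp [map_succ_zero]
    | succ j ih =>
      rw [h.failureLaw_succ, h.half 0 le_rfl, half, half']
      simp only [Measure.add_apply, Measure.smul_apply, smul_eq_mul, map_succ_zero, ih h.tail]
      simp [pow_succ']
  | succ k ih =>
    induction j generalizing q ξ with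
    | zero =>
      rw [h.failureLaw_zero, h.half 0 le_rfl, half, half']
      simp only [Measure.add_apply, Measure.smul_apply, smul_eq_mul, map_succ_succ, ih h.tail]
      simp [pow_succ']
    | succ j ihj =>
      rw [h.failureLaw_succ, h.half 0 le_rfl, half, half']
      simp only [Measure.add_apply, Measure.smul_apply, smul_eq_mul, map_succ_succ, ih h.tail,
        ihj h.tail]
      rw [show j + 1 + (k + 1) = (j + 1 + k) + 1 by ring, Nat.choose_succ_succ,
        show j + (k + 1) = j + 1 + k by ring, pow_succ']
      push_cast
      ring

lemma withDensity_failureLaw_of_fair (h : IsCoinSeq 0 q P ξ) (j : ℕ) :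
    (failureLaw P ξ j).withDensity (fun k => (k : ℝ≥0∞))
      = ((j + 1 : ℕ) : ℝ≥0∞) • (failureLaw P ξ (j + 1)).map (· + 1) := by
  refine Measure.ext_of_singleton fun k => ?_
  rw [withDensity_apply _ (measurableSet_singleton k), lintegral_singleton, Measure.smul_apply,
    smul_eq_mul]
  cases k with
  | zero => simp [map_succ_zero]
  | succ k =>
    rw [map_succ_succ, h.failureLaw_singleton_of_fair, h.failureLaw_singleton_of_fair, ← mul_assoc,
      ← mul_assoc, show j + (k + 1) + 1 = j + 1 + k + 1 by ring]
    congr 1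
    have e1 := Nat.add_one_mul_choose_eq (j + k) k
    have e2 := Nat.choose_mul_succ_eq (j + k) k
    rw [show j + k + 1 - k = j + 1 by omega] at e2
    have : (k + 1) * (j + (k + 1)).choose (k + 1) = (j + 1) * (j + 1 + k).choose k := by
      rw [show j + 1 + k = j + k + 1 by ring, show j + (k + 1) = j + k + 1 by ring]
      linarith
    exact_mod_cast this

lemma integral_mul_failureLaw_of_fair (h : IsCoinSeq 0 q P ξ) (j : ℕ) {F : ℕ → ℝ}
    (hF : Integrable (fun k => F (k + 1)) (failureLaw P ξ (j + 1))) :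
    Integrable (fun k : ℕ => k * F k) (failureLaw P ξ j) ∧
      ∫ k : ℕ, k * F k ∂failureLaw P ξ j = (j + 1) * ∫ k, F (k + 1) ∂failureLaw P ξ (j + 1) := by
  have e := h.withDensity_failureLaw_of_fair j
  have e' : (fun k : ℕ => (k : ℝ≥0∞)) = fun k : ℕ => ((k : ℝ≥0) : ℝ≥0∞) := by ext; simp
  rw [e'] at e
  have hmeas : Measurable fun k : ℕ => (k : ℝ≥0) := measurable_from_top
  have hmap : Integrable F ((failureLaw P ξ (j + 1)).map (· + 1)) :=
    (integrable_map_measure measurable_from_top.aestronglyMeasurable (by fun_prop)).2 hF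
  constructor
  · have h1 : Integrable F ((failureLaw P ξ j).withDensity fun k : ℕ => ((k : ℝ≥0) : ℝ≥0∞)) := by
      rw [e]; exact hmap.smul_measure (by simp)
    rw [integrable_withDensity_iff_integrable_smul hmeas] at h1
    refine h1.congr (Eventually.of_forall fun k => ?_)
    simp [NNReal.smul_def]
  · have h2 := integral_withDensity_eq_integral_smul (μ := failureLaw P ξ j) hmeas F
    rw [e, integral_smul_measure, integral_map (by fun_prop)
      measurable_from_top.aestronglyMeasurable] at h2
    simp only [NNReal.smul_def, NNReal.coe_natCast, smul_eq_mul] at h2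
    rw [← h2, ENNReal.toReal_natCast]; push_cast; rfl

/-- Moments of the negative binomial law. -/
lemma moments_of_fair (h : IsCoinSeq 0 q P ξ) (j : ℕ) :
    Integrable (fun k : ℕ => (k : ℝ) ^ 4) (failureLaw P ξ j) ∧
    ∫ k, ((k : ℝ) - j) ∂failureLaw P ξ j = 1 ∧
    ∫ k, ((k : ℝ) - j) ^ 2 ∂failureLaw P ξ j = 2 * j + 3 ∧
    ∫ k, ((k : ℝ) - j) ^ 4 ∂failureLaw P ξ j = 12 * (j : ℝ) ^ 2 + 86 * j + 75 := by
  have hp := fun j => h.isProb_failureLaw j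
  have m1 : ∀ j : ℕ, Integrable (fun k : ℕ => (k : ℝ)) (failureLaw P ξ j) ∧
      ∫ k : ℕ, (k : ℝ) ∂failureLaw P ξ j = j + 1 := fun j => by
    have := h.integral_mul_failureLaw_of_fair j (F := fun _ => 1) (integrable_const _)
    simpa using this
  have m2 : ∀ j : ℕ, Integrable (fun k : ℕ => (k : ℝ) ^ 2) (failureLaw P ξ j) ∧
      ∫ k : ℕ, (k : ℝ) ^ 2 ∂failureLaw P ξ j = (j + 1) * (j + 3) := fun j => by
    have i1 := (m1 (j + 1)).1
    have := h.integral_mul_failureLaw_of_fair j (F := fun k => (k : ℝ))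
      (by push_cast; exact i1.add (integrable_const _))
    simp only [← pow_two] at this
    refine ⟨this.1, this.2.trans ?_⟩
    push_cast
    rw [integral_add i1 (integrable_const _), (m1 (j + 1)).2]
    simp; ring_nf; simp
  have m3 : ∀ j : ℕ, Integrable (fun k : ℕ => (k : ℝ) ^ 3) (failureLaw P ξ j) ∧
      ∫ k : ℕ, (k : ℝ) ^ 3 ∂failureLaw P ξ j = (j + 1) * ((j : ℝ) ^ 2 + 8 * j + 13) := fun j => by
    have i1 := (m1 (j + 1)).1
    have i2 := (m2 (j + 1)).1
    have e : (fun k : ℕ => ((k + 1 : ℕ) : ℝ) ^ 2) = fun k : ℕ => (k : ℝ) ^ 2 + (2 * k + 1) := by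
      ext; push_cast; ring
    have ia : Integrable (fun k : ℕ => 2 * (k : ℝ) + 1) (failureLaw P ξ (j + 1)) :=
      (i1.const_mul 2).add (integrable_const 1)
    have := h.integral_mul_failureLaw_of_fair j (F := fun k => (k : ℝ) ^ 2)
      (by rw [e]; exact i2.add ia)
    simp only [← pow_succ'] at this
    refine ⟨this.1, this.2.trans ?_⟩
    rw [e, integral_add i2 ia,
      integral_add (i1.const_mul 2) (integrable_const 1), integral_const_mul, (m1 (j + 1)).2,
      (m2 (j + 1)).2]
    simp; ring_nf; simp
  have m4 : ∀ j : ℕ, Integrable (fun k : ℕ => (k : ℝ) ^ 4) (failureLaw P ξ j) ∧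
      ∫ k : ℕ, (k : ℝ) ^ 4 ∂failureLaw P ξ j
        = (j + 1) * ((j : ℝ) ^ 3 + 15 * (j : ℝ) ^ 2 + 63 * j + 75) := fun j => by
    have i1 := (m1 (j + 1)).1
    have i2 := (m2 (j + 1)).1
    have i3 := (m3 (j + 1)).1
    have e : (fun k : ℕ => ((k + 1 : ℕ) : ℝ) ^ 3)
        = fun k : ℕ => (k : ℝ) ^ 3 + (3 * (k : ℝ) ^ 2 + (3 * k + 1)) := by
      ext; push_cast; ring
    have ia : Integrable (fun k : ℕ => 3 * (k : ℝ) + 1) (failureLaw P ξ (j + 1)) :=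
      (i1.const_mul 3).add (integrable_const 1)
    have ib : Integrable (fun k : ℕ => 3 * (k : ℝ) ^ 2 + (3 * k + 1)) (failureLaw P ξ (j + 1)) :=
      (i2.const_mul 3).add ia
    have := h.integral_mul_failureLaw_of_fair j (F := fun k => (k : ℝ) ^ 3)
      (by rw [e]; exact i3.add ib)
    simp only [← pow_succ'] at this
    refine ⟨this.1, this.2.trans ?_⟩
    rw [e, integral_add i3 ib, integral_add (i2.const_mul 3) ia,
      integral_add (i1.const_mul 3) (integrable_const 1), integral_const_mul, integral_const_mul,
      (m1 (j + 1)).2, (m2 (j + 1)).2, (m3 (j + 1)).2]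
    simp; ring_nf; simp
  have i1 := (m1 j).1
  have i2 := (m2 j).1
  have i3 := (m3 j).1
  have i4 := (m4 j).1
  refine ⟨i4, ?_, ?_, ?_⟩
  · rw [integral_sub i1 (integrable_const _), (m1 j).2]; simp
  · have e : (fun k : ℕ => ((k : ℝ) - j) ^ 2)
        = fun k : ℕ => (k : ℝ) ^ 2 + (-(2 * j) * (k : ℝ) + (j : ℝ) ^ 2) := by ext; ring
    have ia : Integrable (fun k : ℕ => -(2 * j) * (k : ℝ) + (j : ℝ) ^ 2) (failureLaw P ξ j) :=
      (i1.const_mul _).add (integrable_const _)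
    rw [e, integral_add i2 ia,
      integral_add (i1.const_mul _) (integrable_const _), integral_const_mul, (m1 j).2, (m2 j).2]
    simp; ring
  · have e : (fun k : ℕ => ((k : ℝ) - j) ^ 4) = fun k : ℕ => (k : ℝ) ^ 4 + (-(4 * j) * (k : ℝ) ^ 3
        + (6 * (j : ℝ) ^ 2 * (k : ℝ) ^ 2 + (-(4 * (j : ℝ) ^ 3) * (k : ℝ) + (j : ℝ) ^ 4))) := by
      ext; ring
    have ia : Integrable (fun k : ℕ => -(4 * (j : ℝ) ^ 3) * (k : ℝ) + (j : ℝ) ^ 4)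
        (failureLaw P ξ j) := (i1.const_mul _).add (integrable_const _)
    have ib : Integrable (fun k : ℕ => 6 * (j : ℝ) ^ 2 * (k : ℝ) ^ 2
        + (-(4 * (j : ℝ) ^ 3) * (k : ℝ) + (j : ℝ) ^ 4)) (failureLaw P ξ j) :=
      (i2.const_mul _).add ia
    have ic : Integrable (fun k : ℕ => -(4 * j) * (k : ℝ) ^ 3 + (6 * (j : ℝ) ^ 2 * (k : ℝ) ^ 2
        + (-(4 * (j : ℝ) ^ 3) * (k : ℝ) + (j : ℝ) ^ 4))) (failureLaw P ξ j) :=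
      (i3.const_mul _).add ib
    rw [e, integral_add i4 ic, integral_add (i3.const_mul _) ib, integral_add (i2.const_mul _) ia,
      integral_add (i1.const_mul _) (integrable_const _), integral_const_mul, integral_const_mul,
      integral_const_mul, (m1 j).2, (m2 j).2, (m3 j).2, (m4 j).2]
    simp; ring

end IsCoinSeq

lemma integrable_sub_pow {μ : Measure ℕ} [IsFiniteMeasure μ]
    (h : Integrable (fun k : ℕ => (k : ℝ) ^ 4) μ) (c : ℝ) {p : ℕ} (hp : p ≤ 4) :
    Integrable (fun k : ℕ => ((k : ℝ) - c) ^ p) μ := by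
  have hi : Integrable (fun k : ℕ => 8 * ((1 + |c|) ^ 4 + (k : ℝ) ^ 4)) μ :=
    ((integrable_const _).add h).const_mul 8
  refine hi.mono' measurable_from_top.aestronglyMeasurable (Eventually.of_forall fun k => ?_)
  have h0 : (0 : ℝ) ≤ k := k.cast_nonneg
  have h1 : |(k : ℝ) - c| ≤ 1 + |c| + k := by
    have := abs_sub (k : ℝ) c
    rw [abs_of_nonneg h0] at this; linarith
  rw [Real.norm_eq_abs, abs_pow]
  calc |(k : ℝ) - c| ^ p ≤ (1 + |c| + k) ^ p := pow_le_pow_left₀ (abs_nonneg _) h1 p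
    _ ≤ (1 + |c| + k) ^ 4 := pow_le_pow_right₀ (by linarith [abs_nonneg c]) hp
    _ ≤ _ := by nlinarith [sq_nonneg ((1 + |c|) ^ 2 - (k : ℝ) ^ 2), sq_nonneg (1 + |c| - (k : ℝ)),
        sq_nonneg ((1 + |c| - (k : ℝ)) ^ 2),
        sq_nonneg ((1 + |c|) ^ 2 + (k : ℝ) ^ 2 - 2 * ((1 + |c|) * k)),
        mul_nonneg (sq_nonneg (1 + |c| - (k : ℝ))) (sq_nonneg (1 + |c| + k))]

lemma integrable_add_smul_map {μ ν : Measure ℕ} (a b : ℝ) {F : ℕ → ℝ}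
    (hμ : Integrable F μ) (hν : Integrable (fun k => F (k + 1)) ν) :
    Integrable F (ENNReal.ofReal a • μ + ENNReal.ofReal b • ν.map (· + 1)) :=
  (hμ.smul_measure (by simp)).add_measure <| Integrable.smul_measure
    ((integrable_map_measure measurable_from_top.aestronglyMeasurable (by fun_prop)).2 hν)
    (by simp)

lemma integral_add_smul_map {μ ν : Measure ℕ} {a b : ℝ} (ha : 0 ≤ a) (hb : 0 ≤ b) {F : ℕ → ℝ}
    (hμ : Integrable F μ) (hν : Integrable (fun k => F (k + 1)) ν) :
    ∫ k, F k ∂(ENNReal.ofReal a • μ + ENNReal.ofReal b • ν.map (· + 1))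
      = a * ∫ k, F k ∂μ + b * ∫ k, F (k + 1) ∂ν := by
  rw [integral_add_measure (hμ.smul_measure (by simp)) (Integrable.smul_measure
    ((integrable_map_measure measurable_from_top.aestronglyMeasurable (by fun_prop)).2 hν)
    (by simp)), integral_smul_measure, integral_smul_measure,
    integral_map (by fun_prop) measurable_from_top.aestronglyMeasurable,
    ENNReal.toReal_ofReal ha, ENNReal.toReal_ofReal hb, smul_eq_mul, smul_eq_mul]

namespace IsCoinSeq

variable {M : ℕ} {q : ℕ → ℝ} {Ω : Type*} [MeasurableSpace Ω] {P : Measure Ω} {ξ : ℕ → Ω → Bool}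

lemma integrable_pow_four (h : IsCoinSeq M q P ξ) (j : ℕ) :
    Integrable (fun k : ℕ => (k : ℝ) ^ 4) (failureLaw P ξ j) := by
  induction M generalizing q ξ j with
  | zero => exact (h.moments_of_fair j).1
  | succ M ih =>
    have hs : ∀ j, Integrable (fun k : ℕ => ((k + 1 : ℕ) : ℝ) ^ 4)
        (failureLaw P (fun v => ξ (v + 1)) j) := fun j => by
      have := h.tail.isProb_failureLaw j
      simpa using integrable_sub_pow (ih h.tail j) (-1) (p := 4) le_rfl
    cases j with
    | zero =>
      rw [h.failureLaw_zero]
      exact integrable_add_smul_map _ _ (integrable_dirac (by simp)) (hs 0)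
    | succ j =>
      rw [h.failureLaw_succ]
      exact integrable_add_smul_map _ _ (ih h.tail j) (hs (j + 1))

/-- Mean, variance and fourth moment of the number of failures. -/
lemma exists_moments (h : IsCoinSeq M q P ξ) : ∃ C : ℝ, 0 ≤ C ∧ ∀ j, M ≤ j →
    ∫ k, ((k : ℝ) - j) ∂failureLaw P ξ j = 1 - ∑ v ∈ Finset.range M, (2 * q v - 1) ∧
    |∫ k, ((k : ℝ) - j) ^ 2 ∂failureLaw P ξ j - 2 * j| ≤ C ∧
    ∫ k, ((k : ℝ) - j) ^ 4 ∂failureLaw P ξ j ≤ C * ((j : ℝ) + 1) ^ 2 := by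
  induction M generalizing q ξ with
  | zero =>
    refine ⟨75, by norm_num, fun j _ => ?_⟩
    obtain ⟨-, h1, h2, h4⟩ := h.moments_of_fair j
    have : (0 : ℝ) ≤ j := j.cast_nonneg
    refine ⟨by simpa using h1, ?_, ?_⟩
    · rw [h2, abs_le]; constructor <;> linarith
    · rw [h4]; nlinarith
  | succ M ih =>
    obtain ⟨C, hC, hC'⟩ := ih h.tail
    set m : ℝ := 1 - ∑ v ∈ Finset.range M, (2 * q (v + 1) - 1) with hm
    have hq := h.half_le 0
    have hq' := h.lt_one 0
    refine ⟨C * 40 + 2 * |m| + 8, by positivity, fun j hj => ?_⟩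
    obtain ⟨i, rfl⟩ : ∃ i, j = i + 1 := ⟨j - 1, by omega⟩
    obtain ⟨a1, a2, a4⟩ := hC' i (by omega)
    obtain ⟨b1, b2, b4⟩ := hC' (i + 1) (by omega)
    have pA := h.tail.isProb_failureLaw i
    have pB := h.tail.isProb_failureLaw (i + 1)
    have iA := fun c p hp => integrable_sub_pow (h.tail.integrable_pow_four i) c (p := p) hp
    have iB := fun c p hp => integrable_sub_pow (h.tail.integrable_pow_four (i + 1)) c (p := p) hp
    have iA1 := fun c => iA c 1 (by norm_num)
    have iB1 := fun c => iB c 1 (by norm_num)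
    simp only [pow_one] at iA1 iB1
    have i0 : (0 : ℝ) ≤ i := i.cast_nonneg
    have mix := fun (F : ℕ → ℝ) hA hB => integral_add_smul_map (F := F)
      (by linarith : (0 : ℝ) ≤ q 0) (by linarith : (0 : ℝ) ≤ 1 - q 0)
      (μ := failureLaw P (fun v => ξ (v + 1)) i) (ν := failureLaw P (fun v => ξ (v + 1)) (i + 1))
      hA hB
    have eA : ∀ k : ℕ, ((k : ℝ) - ((i + 1 : ℕ) : ℝ)) = ((k : ℝ) - i) - 1 := fun k => by
      push_cast; ring
    have eB : ∀ k : ℕ, (((k + 1 : ℕ) : ℝ) - ((i + 1 : ℕ) : ℝ))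
        = ((k : ℝ) - ((i + 1 : ℕ) : ℝ)) + 1 := fun k => by
      push_cast; ring
    have jB : ∀ p ≤ 4, Integrable (fun k : ℕ => (((k + 1 : ℕ) : ℝ) - ((i + 1 : ℕ) : ℝ)) ^ p)
        (failureLaw P (fun v => ξ (v + 1)) (i + 1)) := fun p hp => by
      have := iB i p hp
      simpa using this
    rw [h.failureLaw_succ]
    refine ⟨?_, ?_, ?_⟩
    · rw [mix _ (iA1 _) (by simpa using jB 1 (by norm_num))]
      simp only [eB]
      simp only [eA]
      rw [integral_sub (iA1 _) (integrable_const _), a1]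
      have : ∀ k : ℕ, (k : ℝ) - i - 1 + 1 = ((k : ℝ) - ((i + 1 : ℕ) : ℝ)) + 1 := fun k => by
        push_cast; ring
      simp only [this]
      rw [integral_add (iB1 _) (integrable_const _), b1, Finset.sum_range_succ']
      simp only [integral_const, probReal_univ, smul_eq_mul]
      simp only [hm]
      ring
    · rw [mix _ (iA _ 2 (by norm_num)) (jB 2 (by norm_num))]
      have e1 : ∫ k : ℕ, ((k : ℝ) - ((i + 1 : ℕ) : ℝ)) ^ 2 ∂failureLaw P (fun v => ξ (v + 1)) i
          = ∫ k : ℕ, ((k : ℝ) - i) ^ 2 ∂failureLaw P (fun v => ξ (v + 1)) i - 2 * m + 1 := by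
        have : ∀ k : ℕ, ((k : ℝ) - ((i + 1 : ℕ) : ℝ)) ^ 2
            = ((k : ℝ) - i) ^ 2 + (-2 * ((k : ℝ) - i) + 1) := fun k => by push_cast; ring
        simp only [this]
        have ia : Integrable (fun k : ℕ => -2 * ((k : ℝ) - i) + 1)
            (failureLaw P (fun v => ξ (v + 1)) i) :=
          ((iA1 _).const_mul _).add (integrable_const _)
        rw [integral_add (iA _ 2 (by norm_num)) ia,
          integral_add ((iA1 _).const_mul _) (integrable_const _), integral_const_mul, a1]
        simp only [integral_const, probReal_univ, smul_eq_mul]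
        ring
      have e2 : ∫ k : ℕ, (((k + 1 : ℕ) : ℝ) - ((i + 1 : ℕ) : ℝ)) ^ 2
            ∂failureLaw P (fun v => ξ (v + 1)) (i + 1)
          = ∫ k : ℕ, ((k : ℝ) - ((i + 1 : ℕ) : ℝ)) ^ 2 ∂failureLaw P (fun v => ξ (v + 1)) (i + 1)
            + 2 * m + 1 := by
        have : ∀ k : ℕ, (((k + 1 : ℕ) : ℝ) - ((i + 1 : ℕ) : ℝ)) ^ 2
            = ((k : ℝ) - ((i + 1 : ℕ) : ℝ)) ^ 2 + (2 * ((k : ℝ) - ((i + 1 : ℕ) : ℝ)) + 1) :=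
          fun k => by push_cast; ring
        simp only [this]
        have ia : Integrable (fun k : ℕ => 2 * ((k : ℝ) - ((i + 1 : ℕ) : ℝ)) + 1)
            (failureLaw P (fun v => ξ (v + 1)) (i + 1)) :=
          ((iB1 _).const_mul _).add (integrable_const _)
        rw [integral_add (iB _ 2 (by norm_num)) ia,
          integral_add ((iB1 _).const_mul _) (integrable_const _), integral_const_mul, b1]
        simp only [integral_const, probReal_univ, smul_eq_mul]
        ring
      rw [e1, e2]
      rw [abs_le] at a2 b2 ⊢
      push_cast at a2 b2 ⊢
      have hm1 := le_abs_self m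
      have hm2 := neg_abs_le m
      generalize (∫ k : ℕ, ((k : ℝ) - i) ^ 2 ∂failureLaw P (fun v => ξ (v + 1)) i) = s at *
      generalize (∫ k : ℕ, ((k : ℝ) - (i + 1)) ^ 2 ∂failureLaw P (fun v => ξ (v + 1)) (i + 1)) = t
        at *
      generalize q 0 = r at *
      constructor <;> nlinarith [abs_nonneg m]
    · rw [mix _ (iA _ 4 le_rfl) (jB 4 le_rfl)]
      have bd : ∀ x : ℝ, (x - 1) ^ 4 ≤ 8 * x ^ 4 + 8 ∧ (x + 1) ^ 4 ≤ 8 * x ^ 4 + 8 := fun x => by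
        constructor <;> nlinarith [sq_nonneg (x ^ 2 - 1), sq_nonneg (x - 1), sq_nonneg (x + 1),
          sq_nonneg ((x - 1) ^ 2), sq_nonneg ((x + 1) ^ 2),
          mul_nonneg (sq_nonneg (x - 1)) (sq_nonneg (x + 1))]
      have e1 : ∫ k : ℕ, ((k : ℝ) - ((i + 1 : ℕ) : ℝ)) ^ 4 ∂failureLaw P (fun v => ξ (v + 1)) i
          ≤ 8 * ∫ k : ℕ, ((k : ℝ) - i) ^ 4 ∂failureLaw P (fun v => ξ (v + 1)) i + 8 := by
        have := integral_mono (iA ((i + 1 : ℕ) : ℝ) 4 le_rfl)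
          (((iA i 4 le_rfl).const_mul 8).add (integrable_const 8))
          (fun k => by simp only [eA]; exact (bd _).1)
        refine this.trans_eq ?_
        simp only [Pi.add_apply]
        rw [integral_add ((iA i 4 le_rfl).const_mul 8) (integrable_const 8), integral_const_mul]
        simp
      have e2 : ∫ k : ℕ, (((k + 1 : ℕ) : ℝ) - ((i + 1 : ℕ) : ℝ)) ^ 4
            ∂failureLaw P (fun v => ξ (v + 1)) (i + 1)
          ≤ 8 * ∫ k : ℕ, ((k : ℝ) - ((i + 1 : ℕ) : ℝ)) ^ 4
            ∂failureLaw P (fun v => ξ (v + 1)) (i + 1) + 8 := by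
        have := integral_mono (jB 4 le_rfl)
          (((iB ((i + 1 : ℕ) : ℝ) 4 le_rfl).const_mul 8).add (integrable_const 8))
          (fun k => by simp only [eB]; exact (bd _).2)
        refine this.trans_eq ?_
        simp only [Pi.add_apply]
        rw [integral_add ((iB _ 4 le_rfl).const_mul 8) (integrable_const 8), integral_const_mul]
        simp
      have f1 := e1.trans (by linarith : _ ≤ 8 * (C * ((i : ℝ) + 1) ^ 2) + 8)
      have f2 := e2.trans (by linarith : _ ≤ 8 * (C * (((i + 1 : ℕ) : ℝ) + 1) ^ 2) + 8)
      have g1 := mul_le_mul_of_nonneg_left f1 (by linarith : 0 ≤ q 0)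
      have g2 := mul_le_mul_of_nonneg_left f2 (by linarith : 0 ≤ 1 - q 0)
      refine (add_le_add g1 g2).trans ?_
      push_cast
      have hmn := abs_nonneg m
      generalize q 0 = r at *
      generalize |m| = a at *
      have k1 : C * ((i : ℝ) + 1) ^ 2 ≤ C * ((i : ℝ) + 1 + 1) ^ 2 := by gcongr; linarith
      have k2 : 1 ≤ ((i : ℝ) + 1 + 1) ^ 2 := by nlinarith
      have k3 : 0 ≤ a * ((i : ℝ) + 1 + 1) ^ 2 := by positivity
      have k4 : 0 ≤ C * ((i : ℝ) + 1 + 1) ^ 2 := by positivity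
      have k5 := mul_le_mul_of_nonneg_left k1 (by linarith : 0 ≤ r)
      linarith

/-- The failure counts form a migration kernel. -/
lemma exists_migrationKernel (h : IsCoinSeq M q P ξ) :
    ∃ C J, MigrationKernel ((∑ v ∈ Finset.range M, (2 * q v - 1)) - 1) C J (failureLaw P ξ) := by
  obtain ⟨C, hC, hC'⟩ := h.exists_moments
  have hP := h.isProb
  refine ⟨4 * C, max M 1, h.isProb_failureLaw, ?_, h.failureLaw_singleton_pos,
    h.integrable_pow_four, ?_, ?_, ?_⟩
  · intro f hf hi i j hij
    have e : ∀ j, ∫ k, f k ∂failureLaw P ξ j = ∫ ω, f (failures (fun v => ξ v ω) j) ∂P := fun j =>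
      integral_map (h.measurable_failures j).aemeasurable measurable_from_top.aestronglyMeasurable
    have e' : ∀ j, Integrable (fun ω => f (failures (fun v => ξ v ω) j)) P := fun j =>
      (integrable_map_measure measurable_from_top.aestronglyMeasurable
        (h.measurable_failures j).aemeasurable).1 (hi j)
    simp only [e]
    refine integral_mono_ae (e' i) (e' j) ?_
    filter_upwards [h.ae_infinite] with ω hω
    exact hf (failures_mono hω hij)
  · intro j hj
    rw [(hC' j (le_of_max_le_left hj)).1]; ring
  · intro j hj
    exact (hC' j (le_of_max_le_left hj)).2.1.trans (by linarith)
  · intro j hj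
    refine (hC' j (le_of_max_le_left hj)).2.2.trans ?_
    have : (1 : ℝ) ≤ j := by exact_mod_cast le_of_max_le_right hj
    have h2 : ((j : ℝ) + 1) ^ 2 ≤ 4 * (j : ℝ) ^ 2 := by nlinarith
    calc C * ((j : ℝ) + 1) ^ 2 ≤ C * (4 * (j : ℝ) ^ 2) := by gcongr
      _ = _ := by ring

end IsCoinSeq

/-- Number of visits to `i` strictly before time `t`. -/
def visits (x : ℕ → ℤ) (t : ℕ) (i : ℤ) : ℕ := Nat.count (fun s => x s = i) t

/-- Number of steps from `i` to `i - 1` before time `t`. -/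
def leftSteps (x : ℕ → ℤ) (t : ℕ) (i : ℤ) : ℕ := Nat.count (fun s => x s = i ∧ x (s + 1) = i - 1) t

/-- The path `x` starts at `0` and on its `(v+1)`-st visit to `i` steps according to `b i v`. -/
structure FollowsCoins (b : ℤ → ℕ → Bool) (x : ℕ → ℤ) : Prop where
  zero : x 0 = 0
  step : ∀ t, x (t + 1) = if b (x t) (visits x t (x t)) = true then x t + 1 else x t - 1

lemma visits_succ (x : ℕ → ℤ) (t : ℕ) (i : ℤ) :
    visits x (t + 1) i = visits x t i + if x t = i then 1 else 0 := Nat.count_succ ..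

lemma leftSteps_succ (x : ℕ → ℤ) (t : ℕ) (i : ℤ) :
    leftSteps x (t + 1) i = leftSteps x t i + if x t = i ∧ x (t + 1) = i - 1 then 1 else 0 :=
  Nat.count_succ ..

lemma visits_mono (x : ℕ → ℤ) (i : ℤ) : Monotone fun t => visits x t i := Nat.count_monotone _

lemma leftSteps_mono (x : ℕ → ℤ) (i : ℤ) : Monotone fun t => leftSteps x t i :=
  Nat.count_monotone _

lemma leftSteps_le_visits (x : ℕ → ℤ) (t : ℕ) (i : ℤ) : leftSteps x t i ≤ visits x t i :=
  Nat.count_mono_left (by tauto)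

namespace FollowsCoins

variable {b : ℤ → ℕ → Bool} {x : ℕ → ℤ}

lemma step_cases (h : FollowsCoins b x) (t : ℕ) : x (t + 1) = x t + 1 ∨ x (t + 1) = x t - 1 := by
  rw [h.step t]; split_ifs <;> simp

lemma count_add_leftSteps (h : FollowsCoins b x) (t : ℕ) (i : ℤ) :
    Nat.count (fun v => b i v = true) (visits x t i) + leftSteps x t i = visits x t i := by
  induction t with
  | zero => simp [visits, leftSteps]
  | succ t ih =>
    rw [visits_succ, leftSteps_succ]
    by_cases hx : x t = i
    · have hs := h.step t
      rw [hx] at hs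
      simp only [hx, if_true, true_and, Nat.count_succ]
      by_cases hb : b i (visits x t i) = true
      · rw [if_pos hb] at hs
        have : ¬ x (t + 1) = i - 1 := by omega
        simp only [hb, this, if_true, if_false]; omega
      · rw [if_neg hb] at hs
        simp only [hb, hs, if_true]; simp only [Bool.false_eq_true, if_false]; omega
    · simp only [hx, false_and, if_false, add_zero]; exact ih

lemma count_sub_leftSteps (h : FollowsCoins b x) (t : ℕ) (i : ℤ) :
    (Nat.count (fun v => b i v = true) (visits x t i) : ℤ) - leftSteps x t (i + 1)
      = (if i < x t then 1 else 0) - if i < 0 then 1 else 0 := by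
  induction t with
  | zero => simp [visits, leftSteps, h.zero]
  | succ t ih =>
    rw [visits_succ, leftSteps_succ]
    have hs := h.step t
    by_cases hx : x t = i
    · rw [hx] at hs ih
      have : ¬ i = i + 1 := by omega
      simp only [hx, this, if_true, false_and, if_false, Nat.count_succ]
      by_cases hb : b i (visits x t i) = true
      · rw [if_pos hb] at hs
        simp only [hb, hs, if_true]
        simp only [lt_irrefl, if_false] at ih
        push_cast
        rw [if_pos (by omega)]; linarith
      · rw [if_neg hb] at hs
        simp only [hb, hs]
        simp only [lt_irrefl, if_false] at ih
        rw [if_neg (by omega : ¬ i < i - 1)]; simpa using ih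
    · simp only [hx, if_false, add_zero]
      rcases h.step_cases t with hs | hs
      · have : ¬ (x t = i + 1 ∧ x (t + 1) = i + 1 - 1) := by omega
        rw [if_neg this, add_zero, ih]
        congr 2
        simp only [eq_iff_iff]; omega
      · by_cases hx' : x t = i + 1
        · rw [if_pos ⟨hx', by omega⟩, if_neg (by omega)]
          rw [if_pos (by omega)] at ih
          push_cast; linarith
        · rw [if_neg (by tauto), add_zero, ih]
          congr 2
          simp only [eq_iff_iff]; omega

lemma last_coin (h : FollowsCoins b x) {i : ℤ} (hi : 0 ≤ i) {t : ℕ} (ht : i < x t) :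
    0 < visits x t i ∧ b i (visits x t i - 1) = true := by
  induction t with
  | zero => rw [h.zero] at ht; omega
  | succ t ih =>
    rw [visits_succ]
    have hs := h.step t
    by_cases hx : x t = i
    · rw [if_pos hx]
      rw [hx] at hs
      refine ⟨by omega, ?_⟩
      by_contra hb
      rw [Nat.add_sub_cancel] at hb
      rw [if_neg hb] at hs; omega
    · rw [if_neg hx, add_zero]
      refine ih ?_
      rcases h.step_cases t with hs | hs <;> omega

lemma lt_of_forall_ne (h : FollowsCoins b x) {n : ℤ} (hn : 0 ≤ n) {t : ℕ}
    (ht : ∀ s ≤ t, x s ≠ n) : x t < n := by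
  induction t with
  | zero =>
    have := ht 0 le_rfl
    rw [h.zero] at *; omega
  | succ t ih =>
    have h1 := ih fun s hs => ht s (by omega)
    have h2 := ht (t + 1) le_rfl
    rcases h.step_cases t with hs | hs <;> omega

/-- Before the first visit to `n`, the numbers of left steps from adjacent sites are linked by
the failure counts. -/
lemma leftSteps_eq_failures (h : FollowsCoins b x) {i : ℤ} (hi : 0 ≤ i) {t : ℕ} (ht : i < x t) :
    visits x t i = leftSteps x t i + leftSteps x t (i + 1) + 1 ∧
      leftSteps x t i = failures (b i) (leftSteps x t (i + 1)) := by
  have h1 := h.count_sub_leftSteps t i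
  rw [if_pos ht, if_neg (by omega)] at h1
  have h2 := h.count_add_leftSteps t i
  obtain ⟨h3, h4⟩ := h.last_coin hi ht
  have h5 : visits x t i = leftSteps x t i + leftSteps x t (i + 1) + 1 := by omega
  refine ⟨h5, ?_⟩
  have h6 : visits x t i - 1 = leftSteps x t (i + 1) + leftSteps x t i := by omega
  rw [h6] at h4
  refine (failures_eq h4 ?_).symm
  have h7 : visits x t i = leftSteps x t (i + 1) + leftSteps x t i + 1 := by omega
  have h8 := Nat.count_succ (fun v => b i v = true) (leftSteps x t (i + 1) + leftSteps x t i)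
  rw [← h7, if_pos h4] at h8
  omega

lemma leftSteps_eq_zero {n : ℤ} {t : ℕ} (ht : ∀ s < t, x s ≠ n) : leftSteps x t n = 0 := by
  unfold leftSteps
  rw [Nat.count_iff_forall_not]
  exact fun s hs hx => ht s hs hx.1

lemma time_eq (h : FollowsCoins b x) {n t : ℕ} (ht : ∀ s < t, x s ≠ n) :
    t = Nat.count (fun s => x s < 0) t + ∑ i ∈ Finset.range n, visits x t i := by
  induction t with
  | zero => simp [visits]
  | succ t ih =>
    have h1 := ih fun s hs => ht s (by omega)
    have h2 := h.lt_of_forall_ne (n := n) (by omega) (t := t) fun s hs => ht s (by omega)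
    simp only [visits_succ, Finset.sum_add_distrib, Nat.count_succ]
    by_cases hx : x t < 0
    · have : ∑ i ∈ Finset.range n, (if x t = (i : ℤ) then 1 else 0) = 0 :=
        Finset.sum_eq_zero fun i _ => if_neg (by omega)
      rw [this, if_pos hx]; omega
    · have : ∑ i ∈ Finset.range n, (if x t = (i : ℤ) then 1 else 0) = 1 := by
        rw [Finset.sum_eq_single (x t).toNat]
        · exact if_pos (by omega)
        · intro i _ hi; exact if_neg (by omega)
        · intro hi; exact absurd (Finset.mem_range.2 (by omega)) hi
      rw [this, if_neg hx]; omega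

/-- The hitting time expressed through the left steps. -/
lemma hitting_time_eq (h : FollowsCoins b x) {n t : ℕ} (ht : ∀ s < t, x s ≠ n)
    (hxt : x t = n) :
    t = Nat.count (fun s => x s < 0) t + n + leftSteps x t 0
      + 2 * ∑ i ∈ Finset.range n, leftSteps x t (i + 1) := by
  have h1 := h.time_eq ht
  have h2 : ∑ i ∈ Finset.range n, visits x t i
      = ∑ i ∈ Finset.range n, (leftSteps x t i + leftSteps x t (i + 1) + 1) :=
    Finset.sum_congr rfl fun i hi =>
      (h.leftSteps_eq_failures (by omega) (by have := Finset.mem_range.1 hi; omega)).1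
  have h3 := Finset.sum_range_succ' (fun i : ℕ => leftSteps x t i) n
  have h4 := Finset.sum_range_succ (fun i : ℕ => leftSteps x t i) n
  rw [leftSteps_eq_zero ht] at h4
  simp only [Finset.sum_add_distrib, Finset.sum_const, Finset.card_range, smul_eq_mul] at h2
  push_cast at h3
  omega

lemma count_neg_eq (h : FollowsCoins b x) {s t : ℕ} (hst : s ≤ t) (hs : 0 ≤ x s)
    (hl : leftSteps x t 0 = leftSteps x s 0) :
    0 ≤ x t ∧ Nat.count (fun u => x u < 0) t = Nat.count (fun u => x u < 0) s := by
  induction t, hst using Nat.le_induction with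
  | base => exact ⟨hs, rfl⟩
  | succ t hst ih =>
    have h1 := leftSteps_mono x 0 hst
    have h2 := leftSteps_succ x t 0
    simp only at h1
    split_ifs at h2 with hc
    · omega
    · obtain ⟨h3, h4⟩ := ih (by omega)
      refine ⟨?_, ?_⟩
      · rcases h.step_cases t with hs | hs <;> omega
      · rw [Nat.count_succ, h4, if_neg (by omega)]; omega

/-- If every site has infinitely many successful coins, a site visited infinitely often has its
right neighbour visited infinitely often. -/
lemma visits_unbounded_succ (h : FollowsCoins b x) {i : ℤ} (hb : {v | b i v = true}.Infinite)
    (hi : ∀ K, ∃ t, K ≤ visits x t i) (K : ℕ) : ∃ t, K ≤ visits x t (i + 1) := by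
  obtain ⟨t, ht⟩ := hi (Nat.nth (fun v => b i v = true) (K + 1))
  refine ⟨t, ?_⟩
  have h1 : K + 1 ≤ Nat.count (fun v => b i v = true) (visits x t i) := by
    rw [← Nat.count_nth_of_infinite hb (K + 1)]
    exact Nat.count_monotone _ ht
  have h2 := h.count_sub_leftSteps t i
  have h3 := leftSteps_le_visits x t (i + 1)
  split_ifs at h2 <;> omega

/-- A path which never hits `n` and has infinitely many successful coins drifts to `-∞`. -/
lemma eventually_le_of_forall_ne (h : FollowsCoins b x)
    (hb : ∀ i, {v | b i v = true}.Infinite) {n : ℕ} (hn : ∀ s, x s ≠ n) (m : ℕ) :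
    ∀ᶠ t in atTop, x t ≤ -(m : ℤ) := by
  have hbd : ∀ i : ℕ, ∃ K, ∀ t, visits x t ((n : ℤ) - i) < K := by
    intro i
    induction i with
    | zero =>
      refine ⟨1, fun t => Nat.lt_one_iff.2 ?_⟩
      unfold visits
      rw [Nat.count_iff_forall_not]
      simpa using fun s _ => hn s
    | succ i ih =>
      by_contra! hc
      obtain ⟨K, hK⟩ := ih
      obtain ⟨t, ht⟩ := h.visits_unbounded_succ (hb _) hc K
      have := hK t
      rw [show (n : ℤ) - (i + 1 : ℕ) + 1 = n - i by push_cast; ring] at ht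
      omega
  have hev : ∀ i : ℕ, ∀ᶠ t in atTop, x t ≠ (n : ℤ) - i := by
    intro i
    by_contra hc
    rw [not_eventually] at hc
    simp only [not_not] at hc
    have hinf := Nat.frequently_atTop_iff_infinite.1 hc
    obtain ⟨K, hK⟩ := hbd i
    have h1 := Nat.count_nth_of_infinite hinf K
    have h2 := hK (Nat.nth (fun s => x s = (n : ℤ) - i) K)
    exact absurd h2 (by unfold visits; rw [h1]; omega)
  have := (eventually_all_finset (Finset.range (n + m))).2 fun i _ => hev i
  filter_upwards [this] with t ht
  have hlt := h.lt_of_forall_ne (n := n) (by omega) (t := t) fun s _ => hn s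
  by_contra! hc
  refine ht ((n : ℤ) - x t).toNat (Finset.mem_range.2 (by omega)) (by omega)

end FollowsCoins

/-- Position and local times of the walk driven by the coins `b`. -/
def coinState (b : ℤ → ℕ → Bool) : ℕ → ℤ × (ℤ → ℕ)
  | 0 => (0, 0)
  | t + 1 =>
    (if b (coinState b t).1 ((coinState b t).2 (coinState b t).1) = true
      then (coinState b t).1 + 1 else (coinState b t).1 - 1,
    fun i => (coinState b t).2 i + if (coinState b t).1 = i then 1 else 0)

/-- The walk driven by the coins `b`. -/
def coinWalk (b : ℤ → ℕ → Bool) (t : ℕ) : ℤ := (coinState b t).1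

lemma coinState_snd (b : ℤ → ℕ → Bool) (t : ℕ) : (coinState b t).2 = visits (coinWalk b) t := by
  induction t with
  | zero => ext; simp [coinState, visits]
  | succ t ih => ext i; rw [visits_succ, ← ih]; rfl

lemma followsCoins_coinWalk (b : ℤ → ℕ → Bool) : FollowsCoins b (coinWalk b) where
  zero := rfl
  step t := by rw [← coinState_snd]; rfl

/-- Independent coins attached to the sites of `ℤ`: the `v`-th coin of each site shows `true` with
probability `q v`, which is at least `1/2`, and exactly `1/2` once `M ≤ v`. -/
structure IsCoinField (M : ℕ) (q : ℕ → ℝ) {Ω : Type*} [MeasurableSpace Ω] (P : Measure Ω)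
    (ξ : Ω → ℤ → ℕ → Bool) : Prop where
  indep : iIndepFun (fun (s : ℤ × ℕ) ω => ξ ω s.1 s.2) P
  meas : ∀ i v, Measurable fun ω => ξ ω i v
  law : ∀ i v, P {ω | ξ ω i v = true} = ENNReal.ofReal (q v)
  half_le : ∀ v, 1 / 2 ≤ q v
  lt_one : ∀ v, q v < 1
  half : ∀ v, M ≤ v → q v = 1 / 2

/-- The functional of the coins at the sites `n-1, …, 0` whose expectation is an iterate of
`killOp`. -/
def failureChain (μ : ℝ) (g : ℕ → ℝ) (b : ℤ → ℕ → Bool) : ℕ → ℕ → ℝ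
  | 0, j => g j
  | n + 1, j => Real.exp (-μ * j) * failureChain μ g b n (failures (b n) j)

lemma failureChain_eq (μ : ℝ) (g : ℕ → ℝ) (b : ℤ → ℕ → Bool) {l : ℤ → ℕ} {n : ℕ}
    (hl : ∀ i : ℕ, i < n → l i = failures (b i) (l (i + 1))) :
    failureChain μ g b n (l n)
      = Real.exp (-μ * (∑ i ∈ Finset.range n, l (i + 1) : ℕ)) * g (l 0) := by
  induction n with
  | zero => simp [failureChain]
  | succ n ih =>
    have h1 := hl n (by omega)
    have h2 := ih fun i hi => hl i (by omega)
    rw [failureChain, Finset.sum_range_succ]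
    push_cast at h2 ⊢
    rw [← h1, h2, ← mul_assoc, ← Real.exp_add]
    congr 2
    ring

lemma failureChain_congr (μ : ℝ) (g : ℕ → ℝ) {b b' : ℤ → ℕ → Bool} {n : ℕ}
    (h : ∀ i : ℤ, i < n → b i = b' i) (j : ℕ) :
    failureChain μ g b n j = failureChain μ g b' n j := by
  induction n generalizing j with
  | zero => rfl
  | succ n ih =>
    rw [failureChain, failureChain, h n (by push_cast; omega),
      ih fun i hi => h i (by push_cast; omega)]

lemma abs_failureChain_le {μ : ℝ} (hμ : 0 ≤ μ) {g : ℕ → ℝ} (hg : ∀ j, |g j| ≤ 1)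
    (b : ℤ → ℕ → Bool) (n j : ℕ) : |failureChain μ g b n j| ≤ 1 := by
  induction n generalizing j with
  | zero => exact hg j
  | succ n ih =>
    rw [failureChain, abs_mul, Real.abs_exp]
    refine mul_le_one₀ (Real.exp_le_one_iff.2 ?_) (abs_nonneg _) (ih _)
    have : (0 : ℝ) ≤ j := j.cast_nonneg
    nlinarith

lemma measurable_failureChain (μ : ℝ) (g : ℕ → ℝ) (n j : ℕ) :
    Measurable fun b => failureChain μ g b n j := by
  induction n generalizing j with
  | zero => exact measurable_const
  | succ n ih =>
    refine Measurable.const_mul ?_ _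
    have h1 : Measurable fun s : ℕ × (ℤ → ℕ → Bool) => failureChain μ g s.2 n s.1 :=
      measurable_from_prod_countable_right fun k => ih k
    exact h1.comp (((measurable_failures j).comp (measurable_pi_apply (n : ℤ))).prodMk
      measurable_id)

/-- Integrating out a countably valued variable independent of the rest. -/
lemma IndepFun.integral_eq_integral_map {Ω E : Type*} [MeasurableSpace Ω] [MeasurableSpace E]
    {P : Measure Ω} [IsProbabilityMeasure P] {Y : Ω → ℕ} {Z : Ω → E} (h : IndepFun Y Z P)
    (hY : Measurable Y) (hZ : Measurable Z) {F : ℕ → E → ℝ} (hF : ∀ k, Measurable (F k))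
    (hb : ∀ k z, |F k z| ≤ 1) :
    ∫ ω, F (Y ω) (Z ω) ∂P = ∫ k, ∫ ω, F k (Z ω) ∂P ∂(P.map Y) := by
  have hF' : Measurable fun s : ℕ × E => F s.1 s.2 := measurable_from_prod_countable_right hF
  have h1 := (indepFun_iff_map_prod_eq_prod_map_map hY.aemeasurable hZ.aemeasurable).1 h
  have p1 := Measure.isProbabilityMeasure_map hY.aemeasurable (μ := P)
  have p2 := Measure.isProbabilityMeasure_map hZ.aemeasurable (μ := P)
  have h2 := integral_map (μ := P) (hY.prodMk hZ).aemeasurable hF'.aestronglyMeasurable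
  rw [h1, integral_prod _ (Integrable.of_bound hF'.aestronglyMeasurable 1
    (Eventually.of_forall fun s => hb _ _))] at h2
  rw [← h2]
  refine integral_congr_ae (Eventually.of_forall fun k => ?_)
  exact integral_map hZ.aemeasurable (hF k).aestronglyMeasurable

namespace IsCoinField

variable {M : ℕ} {q : ℕ → ℝ} {Ω : Type*} [MeasurableSpace Ω] {P : Measure Ω}
  {ξ : Ω → ℤ → ℕ → Bool}

lemma isProb (h : IsCoinField M q P ξ) : IsProbabilityMeasure P := h.indep.isProbabilityMeasure

lemma measurable (h : IsCoinField M q P ξ) : Measurable ξ :=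
  measurable_pi_iff.2 fun i => measurable_pi_iff.2 (h.meas i)

lemma isCoinSeq (h : IsCoinField M q P ξ) (i : ℤ) : IsCoinSeq M q P fun v ω => ξ ω i v where
  indep := h.indep.precomp (g := fun v => ((i, v) : ℤ × ℕ)) (Prod.mk_right_injective i)
  meas := h.meas i
  law := h.law i
  half_le := h.half_le
  lt_one := h.lt_one
  half := h.half

lemma ae_infinite (h : IsCoinField M q P ξ) : ∀ᵐ ω ∂P, ∀ i, {v | ξ ω i v = true}.Infinite :=
  ae_all_iff.2 fun i => (h.isCoinSeq i).ae_infinite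

lemma map_site_eq (h : IsCoinField M q P ξ) (i : ℤ) :
    P.map (fun ω => ξ ω i) = P.map (fun ω => ξ ω 0) := by
  have := h.isProb
  have e : ∀ i, P.map (fun ω => ξ ω i)
      = Measure.infinitePi fun v => P.map (fun ω => ξ ω i v) := fun i =>
    (iIndepFun_iff_map_fun_eq_infinitePi_map (h.meas i)).1 (h.isCoinSeq i).indep
  rw [e, e]
  congr 1
  ext1 v
  refine Measure.ext_of_singleton fun c => ?_
  rw [Measure.map_apply (h.meas _ _) (measurableSet_singleton _),
    Measure.map_apply (h.meas _ _) (measurableSet_singleton _)]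
  cases c with
  | false => exact ((h.isCoinSeq i).law_false v).trans ((h.isCoinSeq 0).law_false v).symm
  | true => exact (h.law i v).trans (h.law 0 v).symm

lemma failureLaw_eq (h : IsCoinField M q P ξ) (i : ℤ) (j : ℕ) :
    failureLaw P (fun v ω => ξ ω i v) j = failureLaw P (fun v ω => ξ ω 0 v) j := by
  have e : ∀ i, failureLaw P (fun v ω => ξ ω i v) j
      = (P.map fun ω => ξ ω i).map fun b => failures b j := fun i => by
    rw [Measure.map_map (measurable_failures j) (measurable_pi_iff.2 (h.meas i))]; rfl
  rw [e, e, h.map_site_eq]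

lemma integral_failureChain (h : IsCoinField M q P ξ) {μ : ℝ} (hμ : 0 ≤ μ) {g : ℕ → ℝ}
    (hg : ∀ j, |g j| ≤ 1) (n j : ℕ) :
    ∫ ω, failureChain μ g (ξ ω) n j ∂P
      = (killOp (failureLaw P fun v ω => ξ ω 0 v) μ)^[n] g j := by
  have := h.isProb
  induction n generalizing j with
  | zero => simp [failureChain]
  | succ n ih =>
    rw [Function.iterate_succ_apply', killOp, ← h.failureLaw_eq n j]
    simp only [← ih]
    simp only [failureChain]
    rw [integral_const_mul]
    congr 1
    classical
    let S : Set (ℤ × ℕ) := {s | s.1 < n}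
    let ext : (S → Bool) → ℤ → ℕ → Bool := fun c i v =>
      if hs : (i, v) ∈ S then c ⟨(i, v), hs⟩ else false
    have hext : Measurable ext := by
      refine measurable_pi_iff.2 fun i => measurable_pi_iff.2 fun v => ?_
      by_cases hs : (i, v) ∈ S
      · simp only [ext, hs, dite_true]; exact measurable_pi_apply (X := fun _ => Bool) _
      · simp only [ext, hs, dite_false]; exact measurable_const
    have hind : IndepFun (fun ω => failures (ξ ω n) j) (fun ω => ext fun s : S => ξ ω s.1.1 s.1.2)
        P := by
      have h1 := iIndepFun.indepFun_restrict h.indep (fun s => h.meas s.1 s.2)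
        (S := Sᶜ) (T := S) disjoint_compl_left
      have hmem : ∀ v, ((n : ℤ), v) ∈ Sᶜ := fun v => by simp [S]
      have hφ : Measurable fun c : (Sᶜ : Set (ℤ × ℕ)) → Bool =>
          failures (fun v => c ⟨((n : ℤ), v), hmem v⟩) j :=
        (measurable_failures j).comp (measurable_pi_iff.2 fun v =>
          measurable_pi_apply (X := fun _ : (Sᶜ : Set (ℤ × ℕ)) => Bool) ⟨((n : ℤ), v), hmem v⟩)
      exact h1.comp hφ hext
    have hcong : ∀ ω k, failureChain μ g (ξ ω) n k
        = failureChain μ g (ext fun s : S => ξ ω s.1.1 s.1.2) n k := fun ω k => by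
      refine failureChain_congr μ g (fun i hi => ?_) k
      ext v
      have hs : (i, v) ∈ S := hi
      simp [ext, hs]
    simp only [hcong]
    exact IndepFun.integral_eq_integral_map hind ((h.isCoinSeq n).measurable_failures j)
      (hext.comp (measurable_pi_iff.2 fun s : S => h.meas s.1.1 s.1.2))
      (F := fun k b => failureChain μ g b n k) (fun k => measurable_failureChain μ g n k)
      (fun k b => abs_failureChain_le hμ hg b n k)

end IsCoinField

lemma visits_congr {x y : ℕ → ℤ} {t : ℕ} (h : ∀ s < t, x s = y s) (i : ℤ) :
    visits x t i = visits y t i :=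
  le_antisymm (Nat.count_mono_left fun s hs hx => (h s hs).symm.trans hx)
    (Nat.count_mono_left fun s hs hx => (h s hs).trans hx)

lemma visits_lt {x : ℕ → ℤ} {s t : ℕ} (h : s < t) : visits x s (x s) < visits x t (x s) := by
  have h1 := visits_succ x s (x s)
  rw [if_pos rfl] at h1
  have h2 : visits x (s + 1) (x s) ≤ visits x t (x s) := visits_mono x (x s) h
  omega

lemma card_filter_range_eq_visits (x : ℕ → ℤ) (t : ℕ) :
    ((Finset.range (t + 1)).filter fun s => x s = x t).card = visits x t (x t) + 1 := by
  have := visits_succ x t (x t)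
  rw [if_pos rfl] at this
  rw [← this, visits, Nat.count_eq_card_filter_range]

/-- Two walks agree up to time `t` iff their coins agree along the second walk. -/
lemma coinWalk_eq_iff (b b' : ℤ → ℕ → Bool) (t : ℕ) :
    (∀ s ≤ t, coinWalk b s = coinWalk b' s) ↔
      ∀ s < t, b (coinWalk b' s) (visits (coinWalk b') s (coinWalk b' s))
        = b' (coinWalk b' s) (visits (coinWalk b') s (coinWalk b' s)) := by
  have h := followsCoins_coinWalk b
  have h' := followsCoins_coinWalk b'
  induction t with
  | zero => simp [h.zero, h'.zero]
  | succ t ih =>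
    have e1 : (∀ s ≤ t + 1, coinWalk b s = coinWalk b' s)
        ↔ (∀ s ≤ t, coinWalk b s = coinWalk b' s) ∧ coinWalk b (t + 1) = coinWalk b' (t + 1) := by
      constructor
      · exact fun H => ⟨fun s hs => H s (by omega), H _ le_rfl⟩
      · rintro ⟨H1, H2⟩ s hs
        rcases Nat.le_succ_iff.1 hs with hs | rfl
        · exact H1 s hs
        · exact H2
    refine e1.trans (Iff.trans ?_ Nat.forall_lt_succ_right.symm)
    refine Iff.trans (and_congr_right fun H => ?_) (and_congr_left' ih)
    rw [h.step, h'.step, H t le_rfl, visits_congr fun s hs => H s hs.le]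
    cases b (coinWalk b' t) (visits (coinWalk b') t (coinWalk b' t)) <;>
      cases b' (coinWalk b' t) (visits (coinWalk b') t (coinWalk b' t)) <;> simp <;> omega

lemma measurable_coinState (t : ℕ) : Measurable fun b => coinState b t := by
  induction t with
  | zero => exact measurable_const
  | succ t ih =>
    have h1 : Measurable fun b => (coinState b t).1 := ih.fst
    have h2 : ∀ i, Measurable fun b => (coinState b t).2 i := fun i =>
      (measurable_pi_apply i).comp ih.snd
    have h3 : Measurable fun s : ℤ × (ℤ → ℕ → Bool) => (coinState s.2 t).2 s.1 :=
      measurable_from_prod_countable_right h2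
    have h4 : Measurable fun s : (ℤ × ℕ) × (ℤ → ℕ → Bool) => s.2 s.1.1 s.1.2 :=
      measurable_from_prod_countable_right fun s =>
        (measurable_pi_apply (X := fun _ => Bool) s.2).comp
          (measurable_pi_apply (X := fun _ => ℕ → Bool) s.1)
    have h5 : Measurable fun b : ℤ → ℕ → Bool =>
        b (coinState b t).1 ((coinState b t).2 (coinState b t).1) :=
      h4.comp ((h1.prodMk (h3.comp (h1.prodMk measurable_id))).prodMk measurable_id)
    refine Measurable.prodMk ?_ (measurable_pi_iff.2 fun i => ?_)
    · exact Measurable.ite (h5 (measurableSet_singleton true)) (h1.add_const 1) (h1.sub_const 1)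
    · exact (h2 i).add (Measurable.ite (h1 (measurableSet_singleton i)) measurable_const
        measurable_const)

lemma measurable_coinWalk (t : ℕ) : Measurable fun b => coinWalk b t := (measurable_coinState t).fst

/-- The walk driven by a field of coins is a cookie random walk. -/
lemma IsCoinField.isCookieRW {M : ℕ} {p : ℕ → ℝ} {Ω : Type*} [MeasurableSpace Ω] {P : Measure Ω}
    {ξ : Ω → ℤ → ℕ → Bool} (h : IsCoinField M (fun v => cookieP M p (v + 1)) P ξ) :
    IsCookieRW M p P fun t ω => coinWalk (ξ ω) t where
  isProb := h.isProb
  meas t := (measurable_coinWalk t).comp h.measurable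
  init := by
    have := h.isProb
    simp [(followsCoins_coinWalk _).zero]
  steps t := by
    have := h.isProb
    have : {ω | |coinWalk (ξ ω) (t + 1) - coinWalk (ξ ω) t| = 1} = univ := by
      ext ω
      rcases (followsCoins_coinWalk (ξ ω)).step_cases t with hs | hs <;> simp [hs]
    rw [this, measure_univ]
  cond t x _ hpos := by
    obtain ⟨ω₀, hω₀⟩ := nonempty_of_measure_ne_zero hpos.ne'
    rw [card_filter_range_eq_visits]
    set y := coinWalk (ξ ω₀) with hy
    have hxy : ∀ s ≤ t, y s = x s := hω₀
    have e1 : {ω | ∀ s ≤ t, coinWalk (ξ ω) s = x s}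
        = {ω | ∀ s < t, ξ ω (y s) (visits y s (y s)) = ξ ω₀ (y s) (visits y s (y s))} := by
      ext ω
      refine Iff.trans ?_ (coinWalk_eq_iff (ξ ω) (ξ ω₀) t)
      exact forall₂_congr fun s hs => by rw [← hxy s hs]
    have e2 : {ω | coinWalk (ξ ω) (t + 1) = x t + 1} ∩ {ω | ∀ s ≤ t, coinWalk (ξ ω) s = x s}
        = {ω | ξ ω (x t) (visits x t (x t)) = true}
          ∩ {ω | ∀ s ≤ t, coinWalk (ξ ω) s = x s} := by
      ext ω
      refine and_congr_left fun H => ?_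
      have H' : ∀ s ≤ t, coinWalk (ξ ω) s = x s := H
      have hs := (followsCoins_coinWalk (ξ ω)).step t
      rw [H' t le_rfl, visits_congr fun s hs => H' s hs.le] at hs
      show coinWalk (ξ ω) (t + 1) = x t + 1 ↔ _ = true
      rw [hs]
      cases ξ ω (x t) (visits x t (x t)) <;> simp
      omega
    have hvis : visits x t (x t) = visits y t (y t) := by
      rw [hxy t le_rfl]
      exact visits_congr (fun s hs => (hxy s hs.le).symm) _
    rw [e2, e1, ← hxy t le_rfl]
    rw [hxy t le_rfl, hvis, ← hxy t le_rfl, ← h.law (y t) (visits y t (y t))]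
    let S : Set (ℤ × ℕ) := {s | ∃ u < t, s = (y u, visits y u (y u))}
    have hS : (y t, visits y t (y t)) ∉ S := by
      rintro ⟨u, hu, he⟩
      obtain ⟨h1, h2⟩ := Prod.mk.inj he
      have := visits_lt (x := y) hu
      rw [← h2, ← h1] at this
      exact lt_irrefl _ this
    have hind := iIndepFun.indepFun_restrict h.indep (fun s => h.meas s.1 s.2)
      (S := Sᶜ) (T := S) disjoint_compl_left
    refine hind.measure_inter_preimage_eq_mul
      ({c | c ⟨(y t, visits y t (y t)), hS⟩ = true})
      ({c | ∀ u, (hu : u < t) →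
        c ⟨(y u, visits y u (y u)), ⟨u, hu, rfl⟩⟩ = ξ ω₀ (y u) (visits y u (y u))}) ?_ ?_
    · exact (measurable_pi_apply (X := fun _ : (Sᶜ : Set (ℤ × ℕ)) => Bool) _)
        (measurableSet_singleton true)
    · simp only [Set.ofPred_forall]
      exact MeasurableSet.iInter fun u => MeasurableSet.iInter fun hu =>
        (measurable_pi_apply (X := fun _ : S => Bool) _) (measurableSet_singleton _)

/-- Coin fields exist. -/
lemma exists_isCoinField {M : ℕ} {q : ℕ → ℝ} (h1 : ∀ v, 1 / 2 ≤ q v) (h2 : ∀ v, q v < 1)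
    (h3 : ∀ v, M ≤ v → q v = 1 / 2) :
    ∃ (P : Measure (ℤ × ℕ → Bool)), IsCoinField M q P fun ω i v => ω (i, v) := by
  let r : ℕ → unitInterval := fun v => ⟨q v, by linarith [h1 v], (h2 v).le⟩
  let P : Measure (ℤ × ℕ → Bool) :=
    Measure.infinitePi fun s : ℤ × ℕ => bernoulliMeasure true false (r s.2)
  refine ⟨P, ?_, fun i v => measurable_pi_apply (X := fun _ => Bool) (i, v), fun i v => ?_,
    h1, h2, h3⟩
  · exact iIndepFun_infinitePi (X := fun _ c => c) fun _ => measurable_id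
  · have := Measure.infinitePi_map_eval (μ := fun s : ℤ × ℕ => bernoulliMeasure true false (r s.2))
      (i, v)
    have h5 := Measure.map_apply (μ := P) (measurable_pi_apply (X := fun _ => Bool) (i, v))
      (measurableSet_singleton true)
    have h6 : P {ω | ω (i, v) = true} = bernoulliMeasure true false (r v) {true} := by
      rw [← this]; exact h5.symm
    rw [h6, bernoulliMeasure_apply_of_mem_of_notMem (r v) (measurableSet_singleton true)
      (mem_singleton true) (by simp)]
    rw [ENNReal.ofReal_eq_coe_nnreal (by linarith [h1 v])]
    rfl

namespace IsCookieRW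

lemma setOf_path_succ {Ω : Type*} (X : ℕ → Ω → ℤ) (n : ℕ) (x : ℕ → ℤ) :
    {ω | ∀ i ≤ n + 1, X i ω = x i}
      = {ω | X (n + 1) ω = x (n + 1)} ∩ {ω | ∀ i ≤ n, X i ω = x i} := by
  ext ω
  refine ⟨fun H => ⟨H _ le_rfl, fun i hi => H i (by omega)⟩, fun H i hi => ?_⟩
  rcases Nat.le_succ_iff.1 hi with hi | rfl
  · exact H.2 i hi
  · exact H.1

variable {M : ℕ} {p : ℕ → ℝ} {Ω Ω' : Type*} [MeasurableSpace Ω] [MeasurableSpace Ω']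
  {P : Measure Ω} {P' : Measure Ω'} {X : ℕ → Ω → ℤ} {X' : ℕ → Ω' → ℤ}

lemma measurableSet_path (h : IsCookieRW M p P X) (n : ℕ) (x : ℕ → ℤ) :
    MeasurableSet {ω | ∀ i ≤ n, X i ω = x i} := by
  simp only [Set.ofPred_forall]
  exact MeasurableSet.iInter fun i => MeasurableSet.iInter fun _ =>
    h.meas i (measurableSet_singleton _)

lemma ae_start (h : IsCookieRW M p P X) : ∀ᵐ ω ∂P, X 0 ω = 0 := by
  have := h.isProb
  exact (mem_ae_iff_prob_eq_one (h.meas 0 (measurableSet_singleton 0))).2 h.init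

lemma ae_steps (h : IsCookieRW M p P X) :
    ∀ᵐ ω ∂P, ∀ n, X (n + 1) ω = X n ω + 1 ∨ X (n + 1) ω = X n ω - 1 := by
  have := h.isProb
  refine ae_all_iff.2 fun n => ?_
  have hm : MeasurableSet {ω | |X (n + 1) ω - X n ω| = 1} :=
    (measurable_from_top (f := fun z : ℤ => |z|)).comp ((h.meas (n + 1)).sub (h.meas n))
      (measurableSet_singleton (1 : ℤ))
  filter_upwards [(mem_ae_iff_prob_eq_one hm).2 (h.steps n)] with ω hω
  have hω' : |X (n + 1) ω - X n ω| = 1 := hω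
  rcases abs_eq_abs.1 (hω'.trans abs_one.symm) with h | h <;> omega

lemma measure_path_eq_zero (h : IsCookieRW M p P X) (n : ℕ) {x : ℕ → ℤ} (hx : x 0 ≠ 0) :
    P {ω | ∀ i ≤ n, X i ω = x i} = 0 :=
  measure_mono_null (fun _ hω h0 => hx ((hω 0 (Nat.zero_le n)).symm.trans h0)) h.ae_start

/-- The probabilities of finite paths are determined by the cookies. -/
lemma measure_path_eq (h : IsCookieRW M p P X) (h' : IsCookieRW M p P' X') (n : ℕ) (x : ℕ → ℤ) :
    P {ω | ∀ i ≤ n, X i ω = x i} = P' {ω | ∀ i ≤ n, X' i ω = x i} := by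
  have hP := h.isProb
  have hP' := h'.isProb
  by_cases hx0 : x 0 = 0
  swap
  · rw [h.measure_path_eq_zero n hx0, h'.measure_path_eq_zero n hx0]
  induction n with
  | zero =>
    have e : {ω | ∀ i ≤ 0, X i ω = x i} = {ω | X 0 ω = 0} := by ext; simp [hx0]
    have e' : {ω | ∀ i ≤ 0, X' i ω = x i} = {ω | X' 0 ω = 0} := by ext; simp [hx0]
    rw [e, e', h.init, h'.init]
  | succ n ih =>
    rw [setOf_path_succ, setOf_path_succ]
    rcases eq_zero_or_pos (P {ω | ∀ i ≤ n, X i ω = x i}) with h0 | h0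
    · rw [measure_inter_null_of_null_right _ h0, measure_inter_null_of_null_right _ (ih ▸ h0)]
    have hup := h.cond n x hx0 h0
    have hup' := h'.cond n x hx0 (ih ▸ h0)
    rw [← ih, ← hup] at hup'
    by_cases c1 : x (n + 1) = x n + 1
    · rw [c1, hup']
    have ms := h.ae_steps
    have ms' := h'.ae_steps
    by_cases c2 : x (n + 1) = x n - 1
    · have e : ({ω | X (n + 1) ω = x (n + 1)} ∩ {ω | ∀ i ≤ n, X i ω = x i} : Set Ω)
          =ᵐ[P] ({ω | ∀ i ≤ n, X i ω = x i} \
            ({ω | X (n + 1) ω = x n + 1} ∩ {ω | ∀ i ≤ n, X i ω = x i}) : Set Ω) := by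
        filter_upwards [ms] with ω hω
        refine propext ?_
        show (X (n + 1) ω = x (n + 1) ∧ ∀ i ≤ n, X i ω = x i) ↔ ((∀ i ≤ n, X i ω = x i) ∧
          ¬ (X (n + 1) ω = x n + 1 ∧ ∀ i ≤ n, X i ω = x i))
        have := hω n
        constructor
        · rintro ⟨H1, H2⟩
          exact ⟨H2, fun H => by omega⟩
        · rintro ⟨H1, H2⟩
          refine ⟨?_, H1⟩
          have h3 := H1 n le_rfl
          have h4 : ¬ X (n + 1) ω = x n + 1 := fun H => H2 ⟨H, H1⟩
          omega
      have e' : ({ω | X' (n + 1) ω = x (n + 1)} ∩ {ω | ∀ i ≤ n, X' i ω = x i} : Set Ω')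
          =ᵐ[P'] ({ω | ∀ i ≤ n, X' i ω = x i} \
            ({ω | X' (n + 1) ω = x n + 1} ∩ {ω | ∀ i ≤ n, X' i ω = x i}) : Set Ω') := by
        filter_upwards [ms'] with ω hω
        refine propext ?_
        show (X' (n + 1) ω = x (n + 1) ∧ ∀ i ≤ n, X' i ω = x i) ↔ ((∀ i ≤ n, X' i ω = x i) ∧
          ¬ (X' (n + 1) ω = x n + 1 ∧ ∀ i ≤ n, X' i ω = x i))
        have := hω n
        constructor
        · rintro ⟨H1, H2⟩
          exact ⟨H2, fun H => by omega⟩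
        · rintro ⟨H1, H2⟩
          refine ⟨?_, H1⟩
          have h3 := H1 n le_rfl
          have h4 : ¬ X' (n + 1) ω = x n + 1 := fun H => H2 ⟨H, H1⟩
          omega
      have mU : MeasurableSet {ω | X (n + 1) ω = x n + 1} :=
        h.meas (n + 1) (measurableSet_singleton _)
      have mU' : MeasurableSet {ω | X' (n + 1) ω = x n + 1} :=
        h'.meas (n + 1) (measurableSet_singleton _)
      rw [measure_congr e, measure_congr e',
        measure_sdiff inter_subset_right
          (mU.inter (h.measurableSet_path n x)).nullMeasurableSet (measure_ne_top _ _),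
        measure_sdiff inter_subset_right
          (mU'.inter (h'.measurableSet_path n x)).nullMeasurableSet (measure_ne_top _ _), ih, hup']
    · rw [measure_mono_null (t := {ω | ¬ ∀ n, X (n + 1) ω = X n ω + 1 ∨ X (n + 1) ω = X n ω - 1})
        ?_ ms, measure_mono_null
        (t := {ω | ¬ ∀ n, X' (n + 1) ω = X' n ω + 1 ∨ X' (n + 1) ω = X' n ω - 1}) ?_ ms']
      · rintro ω ⟨H1, H2⟩ H
        have h1 : X' (n + 1) ω = x (n + 1) := H1
        have h2 := H2 n le_rfl
        have := H n
        omega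
      · rintro ω ⟨H1, H2⟩ H
        have h1 : X (n + 1) ω = x (n + 1) := H1
        have h2 := H2 n le_rfl
        have := H n
        omega

lemma measurable_path (h : IsCookieRW M p P X) : Measurable fun ω n => X n ω :=
  measurable_pi_iff.2 h.meas

/-- The law of the path is determined by the cookies. -/
lemma map_path_eq (h : IsCookieRW M p P X) (h' : IsCookieRW M p P' X') :
    P.map (fun ω n => X n ω) = P'.map (fun ω n => X' n ω) := by
  have hP := h.isProb
  have hP' := h'.isProb
  have p1 := Measure.isProbabilityMeasure_map h.measurable_path.aemeasurable (μ := P)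
  have p2 := Measure.isProbabilityMeasure_map h'.measurable_path.aemeasurable (μ := P')
  have hN : ∀ N, (P.map (fun ω n => X n ω)).map (Finset.range (N + 1)).restrict
      = (P'.map (fun ω n => X' n ω)).map (Finset.range (N + 1)).restrict := by
    intro N
    have hr := Finset.measurable_restrict (X := fun _ : ℕ => ℤ) (Finset.range (N + 1))
    refine Measure.ext_of_singleton fun c => ?_
    rw [Measure.map_apply hr (measurableSet_singleton _),
      Measure.map_apply hr (measurableSet_singleton _),
      Measure.map_apply h.measurable_path (hr (measurableSet_singleton _)),
      Measure.map_apply h'.measurable_path (hr (measurableSet_singleton _))]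
    have key := h.measure_path_eq h' N
      (fun i => if hi : i ∈ Finset.range (N + 1) then c ⟨i, hi⟩ else 0)
    convert key using 2
    all_goals
      ext ω
      simp only [mem_preimage, mem_singleton_iff, funext_iff, Finset.restrict, Subtype.forall,
        Finset.mem_range, mem_ofPred_eq]
      refine forall_congr' fun i => ?_
      constructor
      · intro H hi
        rw [dif_pos (by omega)]
        exact H (by omega)
      · intro H hi
        have := H (by omega)
        rwa [dif_pos hi] at this
  refine IsProjectiveLimit.unique (P := fun I => (P'.map fun ω n => X' n ω).map I.restrict) ?_
    fun I => rfl
  intro I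
  obtain ⟨N, hIN⟩ : ∃ N, I ⊆ Finset.range (N + 1) :=
    ⟨I.sup id, fun i hi => Finset.mem_range.2 (Nat.lt_succ_of_le (Finset.le_sup (f := id) hi))⟩
  have e : (I.restrict : (ℕ → ℤ) → I → ℤ)
      = Finset.restrict₂ (π := fun _ => ℤ) hIN ∘ (Finset.range (N + 1)).restrict := rfl
  rw [e, ← Measure.map_map (Finset.measurable_restrict₂ _) (Finset.measurable_restrict _), hN,
    Measure.map_map (Finset.measurable_restrict₂ _) (Finset.measurable_restrict _)]
  rfl

/-- If all cookies favour steps to the right, then so does the walk conditioned on its past. -/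
lemma measure_le_two_mul_up (h : IsCookieRW M p P X) (hp : ∀ j, 1 ≤ j → 1 / 2 ≤ cookieP M p j)
    (n : ℕ) (S : Set (Finset.range (n + 1) → ℤ)) :
    P {ω | (fun i => X i ω : Finset.range (n + 1) → ℤ) ∈ S}
      ≤ 2 * P ({ω | X (n + 1) ω = X n ω + 1}
        ∩ {ω | (fun i => X i ω : Finset.range (n + 1) → ℤ) ∈ S}) := by
  have hP := h.isProb
  set φ : Ω → Finset.range (n + 1) → ℤ := fun ω i => X i ω with hφ
  have mφ : Measurable φ := measurable_pi_iff.2 fun i => h.meas i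
  have mU : MeasurableSet {ω | X (n + 1) ω = X n ω + 1} :=
    measurableSet_eq_fun (h.meas (n + 1)) ((h.meas n).add measurable_const)
  have hc : ∀ c, P.map φ {c} ≤ 2 * (P.restrict {ω | X (n + 1) ω = X n ω + 1}).map φ {c} := by
    intro c
    rw [Measure.map_apply mφ (measurableSet_singleton _),
      Measure.map_apply mφ (measurableSet_singleton _),
      Measure.restrict_apply (mφ (measurableSet_singleton _))]
    set x : ℕ → ℤ := fun i => if hi : i ∈ Finset.range (n + 1) then c ⟨i, hi⟩ else 0 with hx
    have e : φ ⁻¹' {c} = {ω | ∀ i ≤ n, X i ω = x i} := by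
      ext ω
      simp only [mem_preimage, mem_singleton_iff, funext_iff, hφ, Subtype.forall,
        Finset.mem_range, mem_ofPred_eq]
      refine forall_congr' fun i => ⟨fun H hi => ?_, fun H hi => ?_⟩
      · rw [hx]
        simp only
        rw [dif_pos (by simp; omega)]
        exact H (by omega)
      · have H2 := H (by omega)
        rw [hx] at H2
        simp only at H2
        rwa [dif_pos (by simp; omega)] at H2
    rw [e]
    rcases eq_zero_or_pos (P {ω | ∀ i ≤ n, X i ω = x i}) with h0 | h0
    · rw [h0]; exact zero_le
    have hx0 : x 0 = 0 := by
      by_contra H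
      exact h0.ne' (h.measure_path_eq_zero n H)
    have e2 : {ω | ∀ i ≤ n, X i ω = x i} ∩ {ω | X (n + 1) ω = X n ω + 1}
        = {ω | X (n + 1) ω = x n + 1} ∩ {ω | ∀ i ≤ n, X i ω = x i} := by
      ext ω
      constructor
      · rintro ⟨H1, H2⟩
        exact ⟨by rw [mem_ofPred_eq, ← H1 n le_rfl]; exact H2, H1⟩
      · rintro ⟨H1, H2⟩
        exact ⟨H2, by rw [mem_ofPred_eq, H2 n le_rfl]; exact H1⟩
    rw [e2, h.cond n x hx0 h0, ← mul_assoc]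
    refine le_mul_of_one_le_left zero_le ?_
    have h1 := hp (((Finset.range (n + 1)).filter (fun i => x i = x n)).card)
      (Finset.card_pos.2 ⟨n, by simp⟩)
    calc (1 : ℝ≥0∞) = 2 * ENNReal.ofReal (1 / 2) := by
          rw [← ENNReal.ofReal_ofNat, ← ENNReal.ofReal_mul (by norm_num)]; norm_num
      _ ≤ _ := by gcongr
  have hS := (Set.to_countable S).measurableSet
  have h1 := Measure.tsum_indicator_apply_singleton (P.map φ) S hS
  have h2 := Measure.tsum_indicator_apply_singleton
    ((P.restrict {ω | X (n + 1) ω = X n ω + 1}).map φ) S hS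
  rw [Measure.map_apply mφ hS] at h1
  rw [Measure.map_apply mφ hS, Measure.restrict_apply (mφ hS)] at h2
  change P (φ ⁻¹' S) ≤ 2 * P ({ω | X (n + 1) ω = X n ω + 1} ∩ φ ⁻¹' S)
  rw [inter_comm, ← h1, ← h2, ← ENNReal.tsum_mul_left]
  refine ENNReal.tsum_le_tsum fun c => ?_
  by_cases hcS : c ∈ S
  · rw [indicator_of_mem hcS, indicator_of_mem hcS]; exact hc c
  · rw [indicator_of_notMem hcS, indicator_of_notMem hcS]; simp

/-- The increments of the walk before it hits `m` are nonnegative on average. -/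
lemma integral_stopped_step_nonneg (h : IsCookieRW M p P X)
    (hp : ∀ j, 1 ≤ j → 1 / 2 ≤ cookieP M p j) (m : ℤ) (n : ℕ) :
    0 ≤ ∫ ω, {ω | ∀ i ≤ n, X i ω ≠ m}.indicator (fun ω => ((X (n + 1) ω : ℝ) - X n ω)) ω ∂P := by
  have hP := h.isProb
  set E : Set Ω := {ω | ∀ i ≤ n, X i ω ≠ m} with hE
  set U : Set Ω := {ω | X (n + 1) ω = X n ω + 1} with hU
  have mU : MeasurableSet U :=
    measurableSet_eq_fun (h.meas (n + 1)) ((h.meas n).add measurable_const)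
  have mE : MeasurableSet E := by
    simp only [hE, Set.ofPred_forall]
    exact MeasurableSet.iInter fun i => MeasurableSet.iInter fun _ =>
      (h.meas i (measurableSet_singleton m)).compl
  have hUE := h.measure_le_two_mul_up hp n {c | ∀ i, c i ≠ m}
  have e : {ω | (fun i => X i ω : Finset.range (n + 1) → ℤ) ∈ {c | ∀ i, c i ≠ m}} = E := by
    ext ω
    simp only [hE, mem_ofPred_eq, Subtype.forall, Finset.mem_range, Nat.lt_succ_iff]
  rw [e] at hUE
  have hr : P.real E ≤ 2 * P.real (U ∩ E) := by
    have := ENNReal.toReal_mono (by finiteness) hUE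
    rwa [ENNReal.toReal_mul, ENNReal.toReal_ofNat] at this
  have hi : ∀ᵐ ω ∂P, E.indicator (fun ω => ((X (n + 1) ω : ℝ) - X n ω)) ω
      = 2 * (U ∩ E).indicator (fun _ => (1 : ℝ)) ω - E.indicator (fun _ => (1 : ℝ)) ω := by
    filter_upwards [h.ae_steps] with ω hω
    by_cases hωE : ω ∈ E
    · rw [indicator_of_mem hωE, indicator_of_mem hωE]
      rcases hω n with H | H
      · have hUE : ω ∈ U ∩ E := ⟨H, hωE⟩
        rw [indicator_of_mem hUE, H]; push_cast; ring
      · rw [indicator_of_notMem, H]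
        · push_cast; ring
        · rintro ⟨H1, -⟩
          have H2 : X (n + 1) ω = X n ω + 1 := H1
          omega
    · rw [indicator_of_notMem hωE, indicator_of_notMem hωE, indicator_of_notMem fun H => hωE H.2]
      ring
  rw [integral_congr_ae hi, integral_sub
    (((integrable_const 1).indicator (mU.inter mE)).const_mul 2)
    ((integrable_const 1).indicator mE), integral_const_mul, integral_indicator_const _ mE,
    integral_indicator_const _ (mU.inter mE)]
  simp only [smul_eq_mul, mul_one]
  linarith

/-- The walk is unlikely to go far to the left without hitting `m` first. -/
lemma measureReal_stopped_le (h : IsCookieRW M p P X)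
    (hp : ∀ j, 1 ≤ j → 1 / 2 ≤ cookieP M p j) (m k : ℕ) (n : ℕ) :
    (m + k : ℝ) * P.real {ω | (∀ i ≤ n, X i ω ≠ m) ∧ X n ω ≤ -(k : ℤ)} ≤ m := by
  have hP := h.isProb
  set E : ℕ → Set Ω := fun n => {ω | ∀ i ≤ n, X i ω ≠ m} with hE
  have mE : ∀ n, MeasurableSet (E n) := by
    intro n
    simp only [hE, Set.ofPred_forall]
    exact MeasurableSet.iInter fun i => MeasurableSet.iInter fun _ =>
      (h.meas i (measurableSet_singleton _)).compl
  set d : ℕ → Ω → ℝ := fun i => (E i).indicator fun ω => ((X (i + 1) ω : ℝ) - X i ω) with hd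
  have hm : ∀ n, Measurable fun ω => (X n ω : ℝ) := fun n =>
    (measurable_from_top (f := fun z : ℤ => (z : ℝ))).comp (h.meas n)
  have hdi : ∀ i, Integrable (d i) P := by
    intro i
    refine Integrable.of_bound (((hm (i + 1)).sub (hm i)).indicator (mE i)).aestronglyMeasurable 1
      ?_
    filter_upwards [h.ae_steps] with ω hω
    rw [hd]
    simp only
    by_cases hωE : ω ∈ E i
    · rw [indicator_of_mem hωE]
      rcases hω i with H | H <;> rw [H] <;> simp
    · rw [indicator_of_notMem hωE]; simp
  have hY : ∀ᵐ ω ∂P, ∀ n, (ω ∈ E n → ∑ i ∈ Finset.range n, d i ω = X n ω ∧ X n ω < m)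
      ∧ (ω ∉ E n → ∑ i ∈ Finset.range n, d i ω = m) := by
    filter_upwards [h.ae_steps, h.ae_start] with ω hs h0 n
    induction n with
    | zero =>
      refine ⟨fun hω => ?_, fun hω => ?_⟩
      · have := hω 0 le_rfl
        rw [h0] at this ⊢
        simp; omega
      · simp only [hE, mem_ofPred_eq, Nat.le_zero, forall_eq, not_not, h0] at hω
        rw [← Int.cast_natCast (R := ℝ), ← hω]
        simp
    | succ n ih =>
      rw [Finset.sum_range_succ]
      by_cases hω : ω ∈ E n
      · have hdn : d n ω = X (n + 1) ω - X n ω := indicator_of_mem hω _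
        rw [(ih.1 hω).1, hdn]
        have h3 := (ih.1 hω).2
        have h4 := hs n
        refine ⟨fun H => ⟨by ring, ?_⟩, fun H => ?_⟩
        · have := H (n + 1) le_rfl
          omega
        · have : X (n + 1) ω = m := by
            by_contra H2
            refine H fun i hi => ?_
            rcases Nat.le_succ_iff.1 hi with hi | rfl
            · exact hω i hi
            · exact H2
          rw [this]; push_cast; ring
      · have hdn : d n ω = 0 := indicator_of_notMem hω _
        rw [ih.2 hω, hdn, add_zero]
        exact ⟨fun H => absurd (fun i hi => H i (by omega)) hω, fun _ => rfl⟩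
  have hsum : 0 ≤ ∫ ω, ∑ i ∈ Finset.range n, d i ω ∂P := by
    rw [integral_finsetSum _ fun i _ => hdi i]
    exact Finset.sum_nonneg fun i _ => h.integral_stopped_step_nonneg hp m i
  have h_int : Integrable (fun ω => ∑ i ∈ Finset.range n, d i ω) P :=
    integrable_finsetSum _ fun i _ => hdi i
  have mA : MeasurableSet {ω | (∀ i ≤ n, X i ω ≠ m) ∧ X n ω ≤ -(k : ℤ)} :=
    (mE n).inter (h.meas n (measurableSet_Iic (a := -(k : ℤ))))
  have hle : ∫ ω, (m + k : ℝ) * {ω | (∀ i ≤ n, X i ω ≠ m) ∧ X n ω ≤ -(k : ℤ)}.indicator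
      (fun _ => (1 : ℝ)) ω ∂P ≤ ∫ ω, (m - ∑ i ∈ Finset.range n, d i ω) ∂P := by
    refine integral_mono_ae (((integrable_const 1).indicator mA).const_mul _)
      ((integrable_const _).sub h_int) ?_
    filter_upwards [hY] with ω hω
    by_cases hA : ω ∈ {ω | (∀ i ≤ n, X i ω ≠ m) ∧ X n ω ≤ -(k : ℤ)}
    · rw [indicator_of_mem hA, ((hω n).1 hA.1).1]
      have h1 : X n ω ≤ -(k : ℤ) := hA.2
      have h2 : (X n ω : ℝ) ≤ -(k : ℝ) := by exact_mod_cast h1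
      linarith
    · rw [indicator_of_notMem hA, mul_zero]
      by_cases hωE : ω ∈ E n
      · rw [((hω n).1 hωE).1]
        have h2 : (X n ω : ℝ) < m := by exact_mod_cast ((hω n).1 hωE).2
        linarith
      · rw [(hω n).2 hωE, sub_self]
  rw [integral_const_mul, integral_indicator_const _ mA, integral_sub (integrable_const _) h_int]
    at hle
  simp only [smul_eq_mul, mul_one, integral_const, probReal_univ, one_mul] at hle
  linarith

end IsCookieRW

/-- The first hitting time of level `n` by a deterministic path. -/
def IsHit (x : ℕ → ℤ) (n t : ℕ) : Prop := x t = n ∧ ∀ s < t, x s ≠ n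

lemma isHit_hitT {Ω : Type*} {X : ℕ → Ω → ℤ} {n : ℕ} {ω : Ω} (h : ∃ t, X t ω = n) :
    IsHit (fun t => X t ω) n (hitT X n ω) :=
  ⟨Nat.sInf_mem h, fun _ hs => Nat.notMem_of_lt_sInf hs⟩

namespace FollowsCoins

variable {b : ℤ → ℕ → Bool} {x : ℕ → ℤ} {T : ℕ → ℕ}

lemma failureChain_isHit (h : FollowsCoins b x) {n t : ℕ} (ht : IsHit x n t) (μ : ℝ) (g : ℕ → ℝ) :
    failureChain μ g b n 0
      = Real.exp (-μ * (∑ i ∈ Finset.range n, leftSteps x t (i + 1) : ℕ))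
        * g (leftSteps x t 0) := by
  have h1 := failureChain_eq μ g b (l := leftSteps x t) (n := n) fun i hi =>
    (h.leftSteps_eq_failures (by omega) (by rw [ht.1]; omega)).2
  rwa [leftSteps_eq_zero ht.2] at h1

lemma monotone_isHit (h : FollowsCoins b x) (hT : ∀ n, IsHit x n (T n)) : Monotone T := by
  intro m n hmn
  by_contra H
  have := h.lt_of_forall_ne (n := m) (by omega) (t := T n) fun s hs => (hT m).2 s (by omega)
  rw [(hT n).1] at this
  omega

lemma exists_excess_le (h : FollowsCoins b x) (hT : ∀ n, IsHit x n (T n)) {K : ℕ}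
    (hK : ∀ n, leftSteps x (T n) 0 < K) :
    ∃ B, ∀ n, T n ≤ B + n + 2 * ∑ i ∈ Finset.range n, leftSteps x (T n) (i + 1) := by
  have hbdd : BddAbove (range fun n => leftSteps x (T n) 0) :=
    ⟨K, by rintro _ ⟨n, rfl⟩; exact (hK n).le⟩
  obtain ⟨n₀, hn₀⟩ := Nat.sSup_mem (range_nonempty fun n => leftSteps x (T n) 0) hbdd
  have hmax : ∀ n, leftSteps x (T n) 0 ≤ leftSteps x (T n₀) 0 := fun n =>
    (le_csSup hbdd (mem_range_self n)).trans hn₀.ge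
  have hm := h.monotone_isHit hT
  refine ⟨Nat.count (fun s => x s < 0) (T n₀) + K, fun n => ?_⟩
  have h1 := h.hitting_time_eq (hT n).2 (hT n).1
  have h2 := hK n
  have h3 : Nat.count (fun s => x s < 0) (T n) ≤ Nat.count (fun s => x s < 0) (T n₀) := by
    rcases le_total n n₀ with hn | hn
    · exact Nat.count_monotone _ (hm hn)
    · exact (h.count_neg_eq (hm hn) (by rw [(hT n₀).1]; omega)
        (le_antisymm (hmax n) (leftSteps_mono x 0 (hm hn)))).2.le
  omega

lemma abs_exp_sub_failureChain_le (h : FollowsCoins b x) {n t B : ℕ} (ht : IsHit x n t)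
    (hB : t ≤ B + n + 2 * ∑ i ∈ Finset.range n, leftSteps x t (i + 1)) {μ : ℝ} (hμ : 0 ≤ μ) :
    |Real.exp (-μ * t) - failureChain (2 * μ) (fun _ => 1) b n 0| ≤ μ * (B + n) := by
  rw [h.failureChain_isHit ht, mul_one]
  have h0 := h.hitting_time_eq ht.2 ht.1
  set S := ∑ i ∈ Finset.range n, leftSteps x t (i + 1) with hS
  have h1 : (t : ℝ) ≤ B + n + 2 * S := by exact_mod_cast hB
  have h2 : (2 * S : ℝ) ≤ t := by
    have : 2 * S ≤ t := by omega
    exact_mod_cast this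
  have h3 : Real.exp (-μ * t) ≤ Real.exp (-(2 * μ) * S) := by
    rw [Real.exp_le_exp]; nlinarith
  have h4 : Real.exp (-μ * t) = Real.exp (-(2 * μ) * S) * Real.exp (-(μ * (t - 2 * S))) := by
    rw [← Real.exp_add]; ring_nf
  have h5 := Real.add_one_le_exp (-(μ * (t - 2 * S)))
  have h6 : Real.exp (-(2 * μ) * S) ≤ 1 :=
    Real.exp_le_one_iff.2 (by nlinarith [S.cast_nonneg (α := ℝ)])
  have h7 := (Real.exp_pos (-(2 * μ) * S)).le
  have h8 : μ * (t - 2 * S) ≤ μ * (B + n) := mul_le_mul_of_nonneg_left (by linarith) hμ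
  have h9 : 0 ≤ μ * (t - 2 * S) := mul_nonneg hμ (by linarith)
  rw [abs_sub_comm, abs_of_nonneg (by linarith), h4]
  nlinarith

end FollowsCoins

namespace IsCoinField

variable {M : ℕ} {p : ℕ → ℝ} {Ω : Type*} [MeasurableSpace Ω] {P : Measure Ω}
  {ξ : Ω → ℤ → ℕ → Bool}

/-- The walk driven by the coins hits every level to the right of the origin. -/
lemma ae_exists_eq (h : IsCoinField M (fun v => cookieP M p (v + 1)) P ξ) :
    ∀ᵐ ω ∂P, ∀ n : ℕ, ∃ t, coinWalk (ξ ω) t = n := by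
  have hP := h.isProb
  refine ae_all_iff.2 fun n => ?_
  have hp : ∀ j, 1 ≤ j → 1 / 2 ≤ cookieP M p j := by
    intro j hj
    have := h.half_le (j - 1)
    rwa [Nat.sub_add_cancel hj] at this
  set A : Set Ω := {ω | (∀ i, {v | ξ ω i v = true}.Infinite) ∧ ∀ t, coinWalk (ξ ω) t ≠ n} with hA
  have hle : ∀ k : ℕ, P A ≤ ENNReal.ofReal (n / (n + (k + 1 : ℕ))) := by
    intro k
    have hsub : A ⊆ ⋃ N, {ω | ω ∈ A ∧ ∀ t, N ≤ t → coinWalk (ξ ω) t ≤ -((k + 1 : ℕ) : ℤ)} := by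
      intro ω hω
      obtain ⟨N, hN⟩ := eventually_atTop.1
        ((followsCoins_coinWalk (ξ ω)).eventually_le_of_forall_ne hω.1 hω.2 (k + 1))
      exact mem_iUnion.2 ⟨N, hω, hN⟩
    refine (measure_mono hsub).trans ?_
    rw [Monotone.measure_iUnion]
    · refine iSup_le fun N => ?_
      refine (measure_mono (t := {ω | (∀ i ≤ N, coinWalk (ξ ω) i ≠ n)
        ∧ coinWalk (ξ ω) N ≤ -((k + 1 : ℕ) : ℤ)}) ?_).trans ?_
      · rintro ω ⟨H1, H2⟩
        exact ⟨fun i _ => H1.2 i, H2 N le_rfl⟩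
      · refine (ENNReal.le_ofReal_iff_toReal_le (measure_ne_top _ _) (by positivity)).2 ?_
        rw [le_div_iff₀' (by positivity)]
        exact h.isCookieRW.measureReal_stopped_le hp n (k + 1) N
    · exact fun N N' hN ω hω => ⟨hω.1, fun t ht => hω.2 t (hN.trans ht)⟩
  have hlim : Tendsto (fun k : ℕ => ENNReal.ofReal ((n : ℝ) / (n + (k + 1 : ℕ)))) atTop (𝓝 0) := by
    rw [← ENNReal.ofReal_zero]
    refine (ENNReal.continuous_ofReal.tendsto 0).comp (Tendsto.const_div_atTop ?_ _)
    exact tendsto_atTop_add_const_left _ _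
      ((tendsto_natCast_atTop_atTop (R := ℝ)).comp (tendsto_add_atTop_nat 1))
  have hA0 : P A = 0 := le_antisymm (ge_of_tendsto' hlim hle) zero_le
  filter_upwards [h.ae_infinite, measure_eq_zero_iff_ae_notMem.1 hA0] with ω h1 h2
  by_contra H
  exact h2 ⟨h1, not_exists.1 H⟩

/-- The number of steps from `0` to `-1` stays bounded along the hitting times. -/
lemma ae_exists_leftSteps_lt (h : IsCoinField M (fun v => cookieP M p (v + 1)) P ξ) {α C : ℝ}
    {J : ℕ} (hκ : MigrationKernel α C J (failureLaw P fun v ω => ξ ω 0 v)) (hα0 : 0 < α)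
    (hα1 : α < 1) :
    ∀ᵐ ω ∂P, ∃ K, ∀ n,
      leftSteps (coinWalk (ξ ω)) (hitT (fun t ω => coinWalk (ξ ω) t) n ω) 0 < K := by
  have hP := h.isProb
  set L : ℕ → Ω → ℕ := fun n ω =>
    leftSteps (coinWalk (ξ ω)) (hitT (fun t ω => coinWalk (ξ ω) t) n ω) 0 with hL
  set G : Set Ω := {ω | ∀ n : ℕ, ∃ t, coinWalk (ξ ω) t = n} with hG
  have hhit : ∀ ω ∈ G, ∀ n, IsHit (coinWalk (ξ ω)) n (hitT (fun t ω => coinWalk (ξ ω) t) n ω) :=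
    fun ω hω n => isHit_hitT (X := fun t ω => coinWalk (ξ ω) t) (hω n)
  set A : Set Ω := {ω | ω ∈ G ∧ ∀ K, ∃ n, K ≤ L n ω} with hA
  have hε : ∀ ε : ℝ, 0 < ε → P A ≤ ENNReal.ofReal ε := by
    intro ε hε
    obtain ⟨K, hK⟩ := hκ.exists_tail_bound (γ := 0) le_rfl hα0 hα1 (A := 1 / 2) (by norm_num) hε
    set g : ℕ → ℝ := fun j => if K ≤ j then 1 / 2 * (1 + (j : ℝ) ^ (0 : ℝ)) else 0 with hg
    have hg1 : ∀ j, g j = if K ≤ j then 1 else 0 := fun j => by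
      rw [hg]; simp only [Real.rpow_zero]; norm_num
    have hgabs : ∀ j, |g j| ≤ 1 := fun j => by rw [hg1]; split_ifs <;> simp
    have hsub : A ⊆ ⋃ n, {ω | ω ∈ G ∧ K ≤ L n ω} := fun ω hω =>
      mem_iUnion.2 ((hω.2 K).imp fun n hn => ⟨hω.1, hn⟩)
    refine (measure_mono hsub).trans ?_
    rw [Monotone.measure_iUnion]
    · refine iSup_le fun n => ?_
      have hch : ∀ ω ∈ G, failureChain 0 g (ξ ω) n 0 = if K ≤ L n ω then 1 else 0 := by
        intro ω hω
        rw [(followsCoins_coinWalk (ξ ω)).failureChain_isHit (hhit ω hω n), hg1]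
        simp [hL]
      have mS : MeasurableSet {ω | failureChain 0 g (ξ ω) n 0 = 1} :=
        (measurable_failureChain 0 g n 0).comp h.measurable (measurableSet_singleton 1)
      refine (measure_mono (t := {ω | failureChain 0 g (ξ ω) n 0 = 1}) ?_).trans ?_
      · rintro ω ⟨H1, H2⟩
        rw [mem_ofPred_eq, hch ω H1, if_pos H2]
      · refine (ENNReal.le_ofReal_iff_toReal_le (measure_ne_top _ _) hε.le).2 ?_
        refine le_trans (le_of_eq ?_) (hK n)
        rw [← h.integral_failureChain le_rfl hgabs n 0]
        have e : ∀ᵐ ω ∂P, failureChain 0 g (ξ ω) n 0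
            = {ω | failureChain 0 g (ξ ω) n 0 = 1}.indicator (fun _ => (1 : ℝ)) ω := by
          filter_upwards [h.ae_exists_eq] with ω hω
          have h1 := hch ω hω
          by_cases hKL : K ≤ L n ω
          · rw [if_pos hKL] at h1
            rw [indicator_of_mem (by exact h1), h1]
          · rw [if_neg hKL] at h1
            rw [indicator_of_notMem, h1]
            simp [h1]
        rw [integral_congr_ae e, integral_indicator_const _ mS]
        simp [Measure.real]
    · intro n n' hn ω hω
      exact ⟨hω.1, hω.2.trans (leftSteps_mono _ 0
        ((followsCoins_coinWalk (ξ ω)).monotone_isHit (hhit ω hω.1) hn))⟩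
  have hA0 : P A = 0 := by
    by_contra H
    have h1 := hε ((P A).toReal / 2) (half_pos (ENNReal.toReal_pos H (measure_ne_top _ _)))
    rw [ENNReal.le_ofReal_iff_toReal_le (measure_ne_top _ _) (by positivity)] at h1
    linarith [ENNReal.toReal_pos H (measure_ne_top _ _)]
  filter_upwards [h.ae_exists_eq, measure_eq_zero_iff_ae_notMem.1 hA0] with ω h1 h2
  by_contra H
  push Not at H
  exact h2 ⟨h1, H⟩

end IsCoinField

lemma measurable_hitT {Ω : Type*} [MeasurableSpace Ω] {X : ℕ → Ω → ℤ} (hX : ∀ t, Measurable (X t))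
    (n : ℕ) : Measurable (hitT X n) :=
  measurable_sInf_setOf fun t => hX t (measurableSet_singleton _)

/-- The Laplace transforms of the rescaled hitting times converge for the walk driven by coins. -/
lemma IsCoinField.exists_tendsto_laplace {M : ℕ} {p : ℕ → ℝ} {Ω : Type*} [MeasurableSpace Ω]
    {P : Measure Ω} {ξ : Ω → ℤ → ℕ → Bool}
    (h : IsCoinField M (fun v => cookieP M p (v + 1)) P ξ) (hα0 : 0 < cookieAlpha M p)
    (hα1 : cookieAlpha M p < 1) :
    ∃ a : ℝ, 0 < a ∧ ∀ lam : ℝ, 0 < lam →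
      Tendsto (fun n : ℕ => ∫ ω, Real.exp (-(lam / (n : ℝ) ^ (1 / ((cookieAlpha M p + 1) / 2)))
        * hitT (fun t ω => coinWalk (ξ ω) t) n ω) ∂P) atTop
        (𝓝 (Real.exp (-a * lam ^ ((cookieAlpha M p + 1) / 2)))) := by
  have hP := h.isProb
  obtain ⟨C, J, hκ⟩ := (h.isCoinSeq 0).exists_migrationKernel
  have hsum : ∑ v ∈ Finset.range M, (2 * cookieP M p (v + 1) - 1) - 1 = cookieAlpha M p := by
    rw [cookieAlpha, Finset.range_eq_Ico,
      Finset.sum_Ico_add' (fun i => 2 * cookieP M p i - 1) 0 M 1]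
    refine congrArg (· - 1) (Finset.sum_congr (by ext i; simp) fun i hi => ?_)
    rw [cookieP, if_pos (Finset.mem_Icc.1 hi).2]
  rw [hsum] at hκ
  obtain ⟨a, ha, hlim⟩ := hκ.exists_tendsto_iterate_one hα0 hα1
  set ν := (cookieAlpha M p + 1) / 2 with hν
  have hν0 : 0 < ν := by rw [hν]; linarith
  have hν1 : ν < 1 := by rw [hν]; linarith
  refine ⟨a * 2 ^ ν, by positivity, fun lam hlam => ?_⟩
  set T := hitT (fun t ω => coinWalk (ξ ω) t) with hT
  have h2 := hlim (2 * lam) (by positivity)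
  rw [Real.mul_rpow (by norm_num) hlam.le,
    show -a * (2 ^ ν * lam ^ ν) = -(a * 2 ^ ν) * lam ^ ν by ring] at h2
  have hμ : ∀ n : ℕ, 0 ≤ lam / (n : ℝ) ^ (1 / ν) := fun n => by positivity
  have hmT : ∀ n : ℕ, AEStronglyMeasurable
      (fun ω => Real.exp (-(lam / (n : ℝ) ^ (1 / ν)) * T n ω)) P := fun n =>
    (Real.measurable_exp.comp (((measurable_from_top (f := fun k : ℕ => (k : ℝ))).comp
      (measurable_hitT h.isCookieRW.meas n)).const_mul _)).aestronglyMeasurable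
  have hmF : ∀ n : ℕ, AEStronglyMeasurable
      (fun ω => failureChain (2 * (lam / (n : ℝ) ^ (1 / ν))) (fun _ => 1) (ξ ω) n 0) P := fun n =>
    ((measurable_failureChain _ _ n 0).comp h.measurable).aestronglyMeasurable
  have hbT : ∀ (n : ℕ) ω, ‖Real.exp (-(lam / (n : ℝ) ^ (1 / ν)) * T n ω)‖ ≤ 1 := fun n ω => by
    rw [Real.norm_eq_abs, Real.abs_exp, Real.exp_le_one_iff, neg_mul]
    exact neg_nonpos.2 (mul_nonneg (hμ n) (Nat.cast_nonneg _))
  have hbF : ∀ (n : ℕ) ω,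
      ‖failureChain (2 * (lam / (n : ℝ) ^ (1 / ν))) (fun _ => 1) (ξ ω) n 0‖ ≤ 1 := fun n ω =>
    abs_failureChain_le (mul_nonneg zero_le_two (hμ n)) (fun _ => by simp) (ξ ω) n 0
  have hiT := fun n => Integrable.of_bound (hmT n) 1 (ae_of_all _ (hbT n))
  have hiF := fun n => Integrable.of_bound (hmF n) 1 (ae_of_all _ (hbF n))
  have hD : Tendsto (fun n : ℕ => ∫ ω, (Real.exp (-(lam / (n : ℝ) ^ (1 / ν)) * T n ω)
      - failureChain (2 * (lam / (n : ℝ) ^ (1 / ν))) (fun _ => 1) (ξ ω) n 0) ∂P) atTop (𝓝 0) := by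
    rw [← integral_zero Ω ℝ (μ := P)]
    refine tendsto_integral_of_dominated_convergence (fun _ => 2) (fun n => ?_)
      (integrable_const _) (fun n => ae_of_all _ fun ω => ?_) ?_
    · exact (hmT n).sub (hmF n)
    · exact (norm_sub_le _ _).trans (by linarith [hbT n ω, hbF n ω])
    · filter_upwards [h.ae_exists_eq, h.ae_exists_leftSteps_lt hκ hα0 hα1] with ω h1 ⟨K, hK⟩
      have hhit : ∀ n, IsHit (coinWalk (ξ ω)) n (T n ω) := fun n =>
        isHit_hitT (X := fun t ω => coinWalk (ξ ω) t) (h1 n)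
      have hf := followsCoins_coinWalk (ξ ω)
      obtain ⟨B, hB⟩ := hf.exists_excess_le hhit hK
      refine squeeze_zero_norm (fun n => hf.abs_exp_sub_failureChain_le (hhit n) (hB n) (hμ n)) ?_
      have hr : 1 < 1 / ν := by rw [lt_div_iff₀ hν0]; linarith
      have t1 : Tendsto (fun n : ℕ => (n : ℝ) ^ (-(1 / ν))) atTop (𝓝 0) :=
        (tendsto_rpow_neg_atTop (by positivity)).comp tendsto_natCast_atTop_atTop
      have t2 : Tendsto (fun n : ℕ => (n : ℝ) ^ (-(1 / ν - 1))) atTop (𝓝 0) :=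
        (tendsto_rpow_neg_atTop (by linarith)).comp tendsto_natCast_atTop_atTop
      have t3 := (t1.const_mul (lam * B)).add (t2.const_mul lam)
      simp only [mul_zero, add_zero] at t3
      refine t3.congr' ?_
      filter_upwards [eventually_gt_atTop 0] with n hn
      have hn' : (0 : ℝ) < n := Nat.cast_pos.2 hn
      rw [neg_sub, Real.rpow_sub hn', Real.rpow_neg hn'.le, Real.rpow_one]
      field_simp
  have hch : ∀ n : ℕ, ∫ ω, failureChain (2 * (lam / (n : ℝ) ^ (1 / ν))) (fun _ => 1) (ξ ω) n 0 ∂P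
      = (killOp (failureLaw P fun v ω => ξ ω 0 v) (2 * lam / (n : ℝ) ^ (1 / ν)))^[n]
        (fun _ => 1) 0 := fun n => by
    rw [h.integral_failureChain (mul_nonneg zero_le_two (hμ n)) (fun _ => by simp), mul_div_assoc]
  have h3 := hD.add h2
  rw [zero_add] at h3
  refine h3.congr fun n => ?_
  rw [← hch n, ← integral_add]
  · simp only [sub_add_cancel]
  · exact (hiT n).sub (hiF n)
  · exact hiF n

/-- The Laplace transforms of the rescaled hitting times of a cookie random walk converge. -/
lemma IsCookieRW.exists_tendsto_laplace {M : ℕ} {p : ℕ → ℝ}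
    (hp : ∀ i, 1 ≤ i → i ≤ M → 1 / 2 ≤ p i ∧ p i < 1) {Ω : Type*} [MeasurableSpace Ω]
    {P : Measure Ω} {X : ℕ → Ω → ℤ} (h : IsCookieRW M p P X) (hα0 : 0 < cookieAlpha M p)
    (hα1 : cookieAlpha M p < 1) :
    ∃ a : ℝ, 0 < a ∧ ∀ lam : ℝ, 0 < lam →
      Tendsto (fun n : ℕ => ∫ ω, Real.exp (-(lam / (n : ℝ) ^ (1 / ((cookieAlpha M p + 1) / 2)))
        * hitT X n ω) ∂P) atTop (𝓝 (Real.exp (-a * lam ^ ((cookieAlpha M p + 1) / 2)))) := by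
  have hq : ∀ v, 1 / 2 ≤ cookieP M p (v + 1) ∧ cookieP M p (v + 1) < 1 := by
    intro v
    rw [cookieP]
    split_ifs with hv
    · exact hp _ (by omega) hv
    · norm_num
  obtain ⟨Q, hQ⟩ := exists_isCoinField (M := M) (q := fun v => cookieP M p (v + 1))
    (fun v => (hq v).1) (fun v => (hq v).2) fun v hv => by rw [cookieP, if_neg (by omega)]
  obtain ⟨a, ha, hlim⟩ := hQ.exists_tendsto_laplace hα0 hα1
  refine ⟨a, ha, fun lam hlam => (hlim lam hlam).congr fun n => ?_⟩
  have hm : AEStronglyMeasurable (fun x : ℕ → ℤ =>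
      Real.exp (-(lam / (n : ℝ) ^ (1 / ((cookieAlpha M p + 1) / 2)))
        * hitT (fun t (x : ℕ → ℤ) => x t) n x)) (P.map fun ω n => X n ω) :=
    (Real.measurable_exp.comp (((measurable_from_top (f := fun k : ℕ => (k : ℝ))).comp
      (measurable_hitT (fun t => measurable_pi_apply t) n)).const_mul _)).aestronglyMeasurable
  have h1 := integral_map h.measurable_path.aemeasurable hm
  rw [h.map_path_eq hQ.isCookieRW] at h1 hm
  exact (integral_map hQ.isCookieRW.measurable_path.aemeasurable hm).symm.trans h1

/-- The function `x ↦ exp (-lam * x)` on `[0, ∞)`. -/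
def expNegBCF (lam : ℝ≥0) : BoundedContinuousFunction ℝ≥0 ℝ :=
  BoundedContinuousFunction.ofNormedAddCommGroup (fun x => Real.exp (-lam * x)) (by fun_prop) 1
    fun x => by
      rw [Real.norm_eq_abs, Real.abs_exp, Real.exp_le_one_iff, neg_mul]
      exact neg_nonpos.2 (by positivity)

lemma expNegBCF_apply (lam x : ℝ≥0) : expNegBCF lam x = Real.exp (-lam * x) := rfl

/-- The polynomials in `x ↦ exp (-x)`. -/
def expNegAlgebra : StarSubalgebra ℝ (BoundedContinuousFunction ℝ≥0 ℝ) where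
  toSubalgebra := Algebra.adjoin ℝ {expNegBCF 1}
  star_mem' := fun {a} ha => by rwa [show star a = a from by ext; simp]

lemma separatesPoints_expNegAlgebra :
    (expNegAlgebra.map
      (BoundedContinuousFunction.toContinuousMapStarₐ ℝ)).SeparatesPoints := by
  intro x y hxy
  refine ⟨expNegBCF 1, ⟨(expNegBCF 1).toContinuousMap,
    ⟨expNegBCF 1, Algebra.subset_adjoin (mem_singleton _), rfl⟩, rfl⟩, ?_⟩
  rw [expNegBCF_apply, expNegBCF_apply]
  intro h
  rw [Real.exp_eq_exp] at h
  exact hxy (by simpa using h)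

lemma measureReal_gt_le (μ : Measure ℝ≥0) [IsProbabilityMeasure μ] {lam : ℝ≥0} (hlam : 0 < lam) :
    μ.real (Ioi lam⁻¹) / 2 ≤ 1 - ∫ x, expNegBCF lam x ∂μ := by
  have h1 : ∫ x, (Ioi lam⁻¹).indicator (fun _ => (1 / 2 : ℝ)) x ∂μ
      ≤ ∫ x, (1 - expNegBCF lam x) ∂μ := by
    refine integral_mono ((integrable_const _).indicator measurableSet_Ioi)
      ((integrable_const _).sub ((expNegBCF lam).integrable μ)) fun x => ?_
    simp only
    rw [expNegBCF_apply]
    by_cases hx : x ∈ Ioi lam⁻¹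
    · rw [indicator_of_mem hx]
      have h2 : 1 ≤ lam * x := by
        have h3 : lam⁻¹ < x := hx
        calc 1 = lam * lam⁻¹ := (mul_inv_cancel₀ hlam.ne').symm
          _ ≤ lam * x := by gcongr
      have h3 : (1 : ℝ) ≤ lam * x := by exact_mod_cast h2
      have h4 : Real.exp (-lam * x) ≤ Real.exp (-1) := Real.exp_le_exp.2 (by linarith)
      linarith [Real.exp_neg_one_lt_d9]
    · rw [indicator_of_notMem hx, sub_nonneg, Real.exp_le_one_iff, neg_mul]
      exact neg_nonpos.2 (by positivity)
  rw [integral_indicator_const _ measurableSet_Ioi, integral_sub (integrable_const _)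
    ((expNegBCF lam).integrable μ)] at h1
  simp only [smul_eq_mul, integral_const, probReal_univ, one_mul] at h1
  linarith

/-- Tightness from the convergence of Laplace transforms to a function continuous at `0`. -/
lemma isTightMeasureSet_of_tendsto_laplace {μ : ℕ → ProbabilityMeasure ℝ≥0} {φ : ℝ → ℝ}
    (hμ : ∀ lam : ℝ≥0, 0 < lam →
      Tendsto (fun n => ∫ x, expNegBCF lam x ∂(μ n : Measure ℝ≥0)) atTop (𝓝 (φ lam)))
    (hφ : Tendsto φ (𝓝[>] 0) (𝓝 1)) :
    IsTightMeasureSet {(μ n : Measure ℝ≥0) | n} := by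
  rw [isTightMeasureSet_iff_exists_isCompact_measure_compl_le]
  intro ε hε
  obtain ⟨δ, hδ, hδε⟩ : ∃ δ : ℝ, 0 < δ ∧ ENNReal.ofReal δ ≤ ε := by
    rcases eq_or_ne ε ⊤ with rfl | h
    · exact ⟨1, one_pos, le_top⟩
    · exact ⟨ε.toReal, ENNReal.toReal_pos hε.ne' h, (ENNReal.ofReal_toReal h).le⟩
  obtain ⟨lam, hlam, hlamδ⟩ : ∃ lam : ℝ≥0, 0 < lam ∧ 1 - δ / 2 < φ lam := by
    obtain ⟨l, h1, h2⟩ := ((hφ.eventually (lt_mem_nhds (show 1 - δ / 2 < 1 by linarith))).and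
      self_mem_nhdsWithin).exists
    exact ⟨⟨l, le_of_lt h2⟩, h2, h1⟩
  obtain ⟨N, hN⟩ := eventually_atTop.1 ((hμ lam hlam).eventually (lt_mem_nhds hlamδ))
  have hs : ∀ n, ∃ K, IsCompact K ∧ (μ n : Measure ℝ≥0) Kᶜ ≤ ε := fun n => by
    obtain ⟨K, h1, h2⟩ := isTightMeasureSet_iff_exists_isCompact_measure_compl_le.1
      (isTightMeasureSet_singleton (μ := (μ n : Measure ℝ≥0))) ε hε
    exact ⟨K, h1, h2 _ rfl⟩
  choose K hK hKε using hs
  refine ⟨Iic lam⁻¹ ∪ ⋃ n ∈ Finset.range N, K n, ?_, ?_⟩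
  · refine IsCompact.union ?_ ((Finset.range N).isCompact_biUnion fun n _ => hK n)
    rw [← Icc_bot]
    exact isCompact_Icc
  · rintro _ ⟨n, rfl⟩
    rcases lt_or_ge n N with hn | hn
    · refine (measure_mono (compl_subset_compl.2 ?_)).trans (hKε n)
      exact subset_union_of_subset_right
        (subset_biUnion_of_mem (u := K) (Finset.mem_coe.2 (Finset.mem_range.2 hn))) _
    · refine (measure_mono (t := Ioi lam⁻¹) ?_).trans (le_trans ?_ hδε)
      · rw [← compl_Iic]
        exact compl_subset_compl.2 subset_union_left
      · rw [ENNReal.le_ofReal_iff_toReal_le (measure_ne_top _ _) hδ.le]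
        have h1 := measureReal_gt_le (μ n : Measure ℝ≥0) hlam
        have h2 := hN n hn
        rw [Measure.real] at h1
        linarith

lemma expNegBCF_one_pow (k : ℕ) : expNegBCF 1 ^ k = expNegBCF k := by
  ext x
  rw [BoundedContinuousFunction.coe_pow, Pi.pow_apply, expNegBCF_apply, expNegBCF_apply,
    ← Real.exp_nat_mul]
  push_cast
  ring_nf

/-- The continuity theorem for Laplace transforms. -/
theorem exists_tendsto_of_tendsto_laplace {μ : ℕ → ProbabilityMeasure ℝ≥0} {φ : ℝ → ℝ}
    (hμ : ∀ lam : ℝ≥0, 0 < lam →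
      Tendsto (fun n => ∫ x, expNegBCF lam x ∂(μ n : Measure ℝ≥0)) atTop (𝓝 (φ lam)))
    (hφ : Tendsto φ (𝓝[>] 0) (𝓝 1)) :
    ∃ μ₀ : ProbabilityMeasure ℝ≥0, Tendsto μ atTop (𝓝 μ₀) ∧
      ∀ lam : ℝ≥0, 0 < lam → ∫ x, expNegBCF lam x ∂(μ₀ : Measure ℝ≥0) = φ lam := by
  have ht := isTightMeasureSet_of_tendsto_laplace hμ hφ
  have hc : IsCompact (closure {μ n | n}) :=
    isCompact_closure_of_isTightMeasureSet (by simpa using ht)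
  set U : Ultrafilter ℕ := Ultrafilter.of atTop
  have hU : ∀ᶠ ρ in (U.map μ : Filter (ProbabilityMeasure ℝ≥0)), ρ ∈ closure {μ n | n} :=
    Eventually.of_forall (f := (U : Filter ℕ)) fun n => subset_closure ⟨n, rfl⟩
  obtain ⟨μ₀, -, h₀⟩ := hc.ultrafilter_le_nhds (U.map μ) (le_principal_iff.2 hU)
  have h₁ : Tendsto μ (U : Filter ℕ) (𝓝 μ₀) := h₀
  have hlap : ∀ lam : ℝ≥0, 0 < lam → ∫ x, expNegBCF lam x ∂(μ₀ : Measure ℝ≥0) = φ lam :=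
    fun lam hlam => tendsto_nhds_unique
      (ProbabilityMeasure.tendsto_iff_forall_integral_tendsto.1 h₁ (expNegBCF lam))
      ((hμ lam hlam).mono_left (Ultrafilter.of_le atTop))
  refine ⟨μ₀, ProbabilityMeasure.tendsto_of_tight_of_separatesPoints ℝ ht
    separatesPoints_expNegAlgebra fun g hg => ?_, hlap⟩
  have hg' : g ∈ Algebra.adjoin ℝ {expNegBCF 1} := hg
  rw [Algebra.adjoin_singleton_eq_range_aeval] at hg'
  obtain ⟨r, rfl⟩ := hg'
  change Tendsto (fun n => ∫ x, (Polynomial.aeval (expNegBCF 1) r) x ∂(μ n : Measure ℝ≥0)) atTop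
    (𝓝 (∫ x, (Polynomial.aeval (expNegBCF 1) r) x ∂(μ₀ : Measure ℝ≥0)))
  clear hg
  induction r using Polynomial.induction_on' with
  | add r s hr hs =>
    simp only [map_add, BoundedContinuousFunction.coe_add, Pi.add_apply]
    rw [integral_add (BoundedContinuousFunction.integrable _ _)
      (BoundedContinuousFunction.integrable _ _)]
    refine (hr.add hs).congr fun n => ?_
    rw [integral_add (BoundedContinuousFunction.integrable _ _)
      (BoundedContinuousFunction.integrable _ _)]
  | monomial k c =>
    rw [Polynomial.aeval_monomial, ← Algebra.smul_def, expNegBCF_one_pow]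
    simp only [BoundedContinuousFunction.coe_smul, integral_smul]
    refine Tendsto.const_smul ?_ c
    rcases Nat.eq_zero_or_pos k with rfl | hk
    · simp [expNegBCF_apply]
    · have hk0 : (0 : ℝ≥0) < k := Nat.cast_pos.2 hk
      rw [hlap k hk0]
      exact hμ k hk0

/-- For `0 < α < 1` and `ν = (α+1)/2`, the hitting times satisfy
`T_n / n^{1/ν} → S` in distribution, where `S` is a positive strictly stable law of
index `ν`, i.e. the law on `[0,∞)` with Laplace transform `λ ↦ e^{-a λ^ν}` for some
`a > 0`. -/
theorem hitting_time_stable_limit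
    (M : ℕ) (hM : 1 ≤ M) (p : ℕ → ℝ)
    (hp : ∀ i, 1 ≤ i → i ≤ M → (1 / 2 : ℝ) ≤ p i ∧ p i < 1)
    {Ω : Type*} [MeasurableSpace Ω] (P : Measure Ω) (X : ℕ → Ω → ℤ)
    (hX : IsCookieRW M p P X)
    (hα0 : 0 < cookieAlpha M p) (hα1 : cookieAlpha M p < 1) :
    ∃ a : ℝ, 0 < a ∧ ∃ μ : Measure ℝ, IsProbabilityMeasure μ ∧ μ (Set.Iio 0) = 0 ∧
      (∀ lam : ℝ, 0 ≤ lam →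
        ∫ x, Real.exp (-lam * x) ∂μ
          = Real.exp (-a * lam ^ ((cookieAlpha M p + 1) / 2))) ∧
      ∀ f : BoundedContinuousFunction ℝ ℝ,
        Tendsto
          (fun n : ℕ =>
            ∫ ω, f ((hitT X n ω : ℝ)
              / (n : ℝ) ^ (1 / ((cookieAlpha M p + 1) / 2))) ∂P)
          atTop (𝓝 (∫ x, f x ∂μ)) := by
  obtain ⟨a, ha, hlim⟩ := hX.exists_tendsto_laplace hp hα0 hα1
  have hP := hX.isProb
  set ν := (cookieAlpha M p + 1) / 2 with hν
  have hν0 : 0 < ν := by rw [hν]; linarith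
  have hmZ : ∀ n : ℕ, Measurable fun ω => (hitT X n ω : ℝ≥0) / (n : ℝ≥0) ^ (1 / ν) := fun n =>
    ((measurable_from_top (f := fun k : ℕ => (k : ℝ≥0))).comp
      (measurable_hitT hX.meas n)).div_const _
  set ρ : ℕ → ProbabilityMeasure ℝ≥0 := fun n =>
    ⟨P.map fun ω => (hitT X n ω : ℝ≥0) / (n : ℝ≥0) ^ (1 / ν),
      Measure.isProbabilityMeasure_map (hmZ n).aemeasurable⟩ with hρ
  have h_int : ∀ (n : ℕ) (f : BoundedContinuousFunction ℝ≥0 ℝ), ∫ x, f x ∂(ρ n : Measure ℝ≥0)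
      = ∫ ω, f ((hitT X n ω : ℝ≥0) / (n : ℝ≥0) ^ (1 / ν)) ∂P := fun n f =>
    integral_map (hmZ n).aemeasurable f.continuous.measurable.aestronglyMeasurable
  have hlap : ∀ lam : ℝ≥0, 0 < lam →
      Tendsto (fun n => ∫ x, expNegBCF lam x ∂(ρ n : Measure ℝ≥0)) atTop
        (𝓝 (Real.exp (-a * (lam : ℝ) ^ ν))) := fun lam hlam => by
    refine (hlim lam hlam).congr fun n => ?_
    rw [h_int]
    refine integral_congr_ae (ae_of_all _ fun ω => ?_)
    simp only [expNegBCF_apply, NNReal.coe_div, NNReal.coe_rpow, NNReal.coe_natCast]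
    congr 1
    ring
  have hφ : Tendsto (fun lam : ℝ => Real.exp (-a * lam ^ ν)) (𝓝[>] 0) (𝓝 1) := by
    have h1 : Continuous fun lam : ℝ => Real.exp (-a * lam ^ ν) :=
      Real.continuous_exp.comp (continuous_const.mul (Real.continuous_rpow_const hν0.le))
    have h2 := h1.tendsto 0
    rw [Real.zero_rpow hν0.ne', mul_zero, Real.exp_zero] at h2
    exact h2.mono_left nhdsWithin_le_nhds
  obtain ⟨μ₀, hμ₀, hL⟩ := exists_tendsto_of_tendsto_laplace hlap hφ
  have hcoe : Measurable ((↑) : ℝ≥0 → ℝ) := measurable_coe_nnreal_real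
  refine ⟨a, ha, (μ₀ : Measure ℝ≥0).map (↑), Measure.isProbabilityMeasure_map hcoe.aemeasurable,
    ?_, fun lam hlam => ?_, fun f => ?_⟩
  · rw [Measure.map_apply hcoe measurableSet_Iio]
    convert measure_empty (μ := (μ₀ : Measure ℝ≥0))
    ext x
    simp
  · rw [integral_map hcoe.aemeasurable (by fun_prop)]
    rcases hlam.eq_or_lt with rfl | hlam'
    · simp [Real.zero_rpow hν0.ne']
    · exact hL ⟨lam, hlam⟩ hlam'
  · rw [integral_map hcoe.aemeasurable f.continuous.measurable.aestronglyMeasurable]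
    refine (ProbabilityMeasure.tendsto_iff_forall_integral_tendsto.1 hμ₀
      (f.compContinuous ⟨(↑), NNReal.continuous_coe⟩)).congr fun n => ?_
    rw [h_int]
    refine integral_congr_ae (ae_of_all _ fun ω => ?_)
    simp
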